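/- (Ottaviani–Sturmfels conjecture for dim L = 3.) Let K be an algebraically closed field and n ≥ 4. The vanishing ideal I_{1,3,n} of the Kalman variety K_{1,3,n} is minimally generated by C(n−3,3) homogeneous polynomials of degree 3, 2·C(n−2,3) of degree 4, 2·C(n−2,3) of degree 5, and C(n−1,3) of degree 6. Precisely: dim_K (I_{1,3,n})_j − dim_K (A₊·I_{1,3,n})_j equals C(n−3,3) for j = 3, equals 2·C(n−2,3) for j = 4 and for j = 5, equals C(n−1,3) for j = 6, and equals 0 for every other j ≥ 0. Here C(a,b) denotes the binomial coefficient. -/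

import Mathlib

set_option synthInstance.maxHeartbeats 1000000
set_option maxHeartbeats 4000000

open Matrix

/-- The span of the first `d` standard basis vectors of `K^n`. -/
def firstCoordsSubspace (K : Type*) [Field K] (n d : ℕ) : Submodule K (Fin n → K) where
  carrier := {v | ∀ i : Fin n, d ≤ (i : ℕ) → v i = 0}
  add_mem' := fun hv hw i hi => by simp [hv i hi, hw i hi]
  zero_mem' := fun i _ => rfl
  smul_mem' := fun c v hv i hi => by simp [hv i hi]

/-- The Kalman variety `K_{s,d,n}`: matrices having an `s`-dimensional invariant
subspace contained in the span `L` of the first `d` standard basis vectors. -/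
def kalmanSet (K : Type*) [Field K] (n d s : ℕ) : Set (Matrix (Fin n) (Fin n) K) :=
  {M | ∃ U : Submodule K (Fin n → K), U ≤ firstCoordsSubspace K n d ∧
    Module.finrank K U = s ∧ ∀ v ∈ U, M.mulVec v ∈ U}

/-- The upper-left `d × d` block `α` of an `n × n` matrix. -/
def alphaBlock {K : Type*} [Field K] {n : ℕ} (d : ℕ) (h : d ≤ n)
    (M : Matrix (Fin n) (Fin n) K) : Matrix (Fin d) (Fin d) K :=
  fun i j => M (Fin.castLE h i) (Fin.castLE h j)

/-- The lower-left `(n-d) × d` block `γ` of an `n × n` matrix. -/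
def gammaBlock {K : Type*} [Field K] {n : ℕ} (d : ℕ) (h : d ≤ n)
    (M : Matrix (Fin n) (Fin n) K) : Matrix (Fin (n - d)) (Fin d) K :=
  fun i j => M ⟨d + (i : ℕ), by have := i.isLt; omega⟩ (Fin.castLE h j)

/-- The reduced Kalman matrix: the `d(n-d) × d` matrix obtained by stacking
`γ, γα, γα², …, γα^{d-1}`; row `(k, i)` is row `i` of the block `γ * α^k`. -/
def redKalman {K : Type*} [Field K] {n : ℕ} (d : ℕ) (h : d ≤ n)
    (M : Matrix (Fin n) (Fin n) K) : Matrix (Fin d × Fin (n - d)) (Fin d) K :=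
  fun p j => (gammaBlock d h M * (alphaBlock d h M) ^ (p.1 : ℕ)) p.2 j

/-- The vanishing ideal of a set of `n × n` matrices, inside the polynomial
coordinate ring `A = K[x_{ij}]` of the matrix space. -/
def matVanishingIdeal (K : Type*) [Field K] (n : ℕ)
    (S : Set (Matrix (Fin n) (Fin n) K)) : Ideal (MvPolynomial (Fin n × Fin n) K) where
  carrier := {f | ∀ M ∈ S, MvPolynomial.eval (fun p => M p.1 p.2) f = 0}
  add_mem' := fun ha hb M hM => by simp [ha M hM, hb M hM]
  zero_mem' := fun M hM => by simp
  smul_mem' := fun c f hf M hM => by simp [smul_eq_mul, hf M hM]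

/-- The coordinate ring `A` of the space of `n × n` matrices. -/
abbrev MatCoordRing (K : Type*) [Field K] (n : ℕ) := MvPolynomial (Fin n × Fin n) K

/-- The vanishing ideal `I_{s,d,n}` of the Kalman variety. -/
noncomputable def kalmanIdeal (K : Type*) [Field K] (n d s : ℕ) :
    Ideal (MatCoordRing K n) :=
  matVanishingIdeal K n (kalmanSet K n d s)

/-- The irrelevant (maximal graded) ideal `A₊` of the polynomial ring,
generated by all the variables. -/
noncomputable def irrelevantIdeal (K : Type*) [Field K] (n : ℕ) :
    Ideal (MatCoordRing K n) :=
  Ideal.span (Set.range MvPolynomial.X)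

/-- The coordinate ring `O_{s,d,n} = A/I_{s,d,n}` of the Kalman variety. -/
abbrev KalmanCoordRing (K : Type*) [Field K] (n d s : ℕ) :=
  MatCoordRing K n ⧸ kalmanIdeal K n d s

/-- The degree-`j` graded piece of a (homogeneous) ideal `J ⊆ A`, as a
`K`-subspace of `A`. -/
noncomputable def gradedPiece (K : Type*) [Field K] (n : ℕ)
    (J : Ideal (MatCoordRing K n)) (j : ℕ) : Submodule K (MatCoordRing K n) :=
  Submodule.restrictScalars K J ⊓ MvPolynomial.homogeneousSubmodule (Fin n × Fin n) K j

/-- The number of minimal generators of degree `j` of a homogeneous ideal `J`: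
`dim_K J_j − dim_K (A₊·J)_j`. -/
noncomputable def minGens (K : Type*) [Field K] (n : ℕ)
    (J : Ideal (MatCoordRing K n)) (j : ℕ) : ℕ :=
  Module.finrank K (gradedPiece K n J j) -
    Module.finrank K (gradedPiece K n (irrelevantIdeal K n * J) j)

namespace Kalman

section VanishingTools

open MvPolynomial

attribute [local instance] MvPolynomial.weightedGradedAlgebra

variable {K : Type*} [Field K] {σ : Type*}

lemma dvd_of_vanishing [IsAlgClosed K] [Finite σ] {p f : MvPolynomial σ K} (hp : Irreducible p)
    (h : ∀ x : σ → K, eval x p = 0 → eval x f = 0) : p ∣ f := by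
  have hprime : (Ideal.span {p}).IsPrime :=
    (Ideal.span_singleton_prime hp.ne_zero).2 (UniqueFactorizationMonoid.irreducible_iff_prime.1 hp)
  have h1 := IsPrime.vanishingIdeal_zeroLocus (K := K) (Ideal.span {p})
  rw [← Ideal.mem_span_singleton, ← h1, mem_vanishingIdeal_iff]
  intro x hx
  rw [zeroLocus_span] at hx
  exact h x (hx p rfl)

lemma eval_eq_zero_of_curve [Infinite K] (c : σ → Polynomial K) (y : σ) (hy : c y ≠ 0)
    (g : MvPolynomial σ K)
    (h : ∀ t : K, (c y).eval t * eval (fun i => (c i).eval t) g = 0) (t : K) :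
    eval (fun i => (c i).eval t) g = 0 := by
  have key : ∀ t, (aeval c g : Polynomial K).eval t = eval (fun i => (c i).eval t) g := by
    intro t
    have : (Polynomial.evalRingHom t).comp (aeval c : MvPolynomial σ K →ₐ[K] _).toRingHom =
        eval (fun i => (c i).eval t) := by
      ext j <;> simp
    exact congrArg (fun φ => φ g) this
  have h0 : c y * aeval c g = 0 := by
    apply Polynomial.funext
    intro t
    rw [Polynomial.eval_mul, key, h t, Polynomial.eval_zero]
  rw [← key, (mul_eq_zero.1 h0).resolve_left hy, Polynomial.eval_zero]

lemma eval_eq_zero_of_curve_through [Infinite K] (c : σ → Polynomial K) (p : σ → K)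
    (hp : ∀ i, (c i).eval 0 = p i) (y : σ) (hy : c y ≠ 0) (g : MvPolynomial σ K)
    (h : ∀ (t : K) (q : σ → K), (∀ i, q i = (c i).eval t) → q y * eval q g = 0) :
    eval p g = 0 := by
  have := eval_eq_zero_of_curve c y hy g (fun t => h t _ fun i => rfl) 0
  rwa [funext hp] at this

lemma eval_eq_zero_of_free [Infinite K] (y : σ) (p : σ → K) (g : MvPolynomial σ K)
    (h : ∀ q : σ → K, (∀ i, i ≠ y → q i = p i) → q y * eval q g = 0) :
    eval p g = 0 := by
  classical
  refine eval_eq_zero_of_curve_through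
    (fun i => if i = y then Polynomial.X + Polynomial.C (p y) else Polynomial.C (p i)) p ?_ y ?_ g ?_
  · intro i
    split_ifs with hi <;> simp [hi]
  · simp only [if_true]; exact Polynomial.X_add_C_ne_zero _
  · intro t q hq
    exact h q fun i hi => by simp [hq i, hi]

lemma mem_span_of_forall_step (W : σ → ℕ) (i : σ) (hi : W i = 1) (S : Set (MvPolynomial σ K))
    (hS : ∀ s ∈ S, ∃ n, IsWeightedHomogeneous W s n) (M : Set (MvPolynomial σ K))
    (hM : ∀ f ∈ M, ∃ g ∈ M, f - X i * g ∈ Ideal.span S) (f : MvPolynomial σ K) (hf : f ∈ M) :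
    f ∈ Ideal.span S := by
  classical
  have hom : (Ideal.span S).IsHomogeneous (weightedHomogeneousSubmodule K W) :=
    Ideal.homogeneous_span _ _ fun s hs => hS s hs
  have iter : ∀ k : ℕ, ∃ g ∈ M, f - X i ^ k * g ∈ Ideal.span S := by
    intro k
    induction k with
    | zero => exact ⟨f, hf, by simp⟩
    | succ k ih =>
      obtain ⟨g, hg, h⟩ := ih
      obtain ⟨g', hg', h'⟩ := hM g hg
      refine ⟨g', hg', ?_⟩
      have := add_mem h (Ideal.mul_mem_left _ (X i ^ k) h')
      convert this using 1
      ring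
  rw [mem_iff_weightedHomogeneousComponent_mem K W hom]
  intro m
  obtain ⟨g, hg, h⟩ := iter (m + 1)
  have h1 := weightedHomogeneousComponent_mem_of_mem K W hom h m
  have h2 : weightedHomogeneousComponent W m (X i ^ (m + 1) * g) = 0 := by
    ext d
    rw [coeff_weightedHomogeneousComponent, coeff_zero]
    split_ifs with hd
    · rw [X_pow_eq_monomial, coeff_monomial_mul', if_neg]
      intro hle
      have h3 := Finsupp.le_weight W (s := i) (by omega) d
      have h4 := hle i
      rw [Finsupp.single_eq_same] at h4
      omega
    · rfl
  rwa [map_sub, h2, sub_zero] at h1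

/-- The substitution `X i ↦ 0`. -/
noncomputable def kill (K : Type*) [Field K] {σ : Type*} [DecidableEq σ] (i : σ) :
    MvPolynomial σ K →ₐ[K] MvPolynomial σ K :=
  aeval (Function.update X i 0)

variable [DecidableEq σ]

lemma eval_kill (i : σ) (x : σ → K) (f : MvPolynomial σ K) :
    eval x (kill K i f) = eval (Function.update x i 0) f := by
  have : (eval x).comp (kill K i).toRingHom = eval (Function.update x i 0) := by
    ext j
    · simp [kill]
    · by_cases h : j = i
      · subst h; simp [kill]
      · simp [kill, h]
  exact congrArg (fun φ => φ f) this

lemma X_dvd_sub_kill (i : σ) (f : MvPolynomial σ K) : X i ∣ f - kill K i f := by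
  induction f using MvPolynomial.induction_on with
  | C a => simp [kill]
  | add p q hp hq =>
    rw [map_add, add_sub_add_comm]; exact dvd_add hp hq
  | mul_X p j hp =>
    rw [map_mul]
    by_cases h : j = i
    · subst h; simp [kill]
    · have : kill K i (X j) = X j := by simp [kill, h]
      rw [this, ← sub_mul]; exact hp.mul_right _

lemma exists_eq_kill_add (i : σ) (f : MvPolynomial σ K) :
    ∃ g, f = kill K i f + X i * g := by
  obtain ⟨g, hg⟩ := X_dvd_sub_kill i f
  exact ⟨g, by rw [← hg]; ring⟩

lemma X_dvd_of_vanishing [Infinite K] (i : σ) (f : MvPolynomial σ K)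
    (h : ∀ x : σ → K, x i = 0 → eval x f = 0) : X i ∣ f := by
  have : kill K i f = 0 := by
    apply MvPolynomial.funext
    intro x
    rw [eval_kill, map_zero]
    exact h _ (by simp)
  have h2 := X_dvd_sub_kill i f
  rwa [this, sub_zero] at h2

end VanishingTools
section PlaneCase

open MvPolynomial

/-- `a · v` for the planar data `c = (a₁, a₂, v₁, v₂, β₁₁, β₁₂, β₂₁, β₂₂)`. -/
def planeA {R : Type*} [CommRing R] (c : Fin 8 → R) : R := c 0 * c 2 + c 1 * c 3

/-- `a · βv` for the planar data `c = (a₁, a₂, v₁, v₂, β₁₁, β₁₂, β₂₁, β₂₂)`. -/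
def planeB {R : Type*} [CommRing R] (c : Fin 8 → R) : R :=
  c 0 * (c 4 * c 2 + c 5 * c 3) + c 1 * (c 6 * c 2 + c 7 * c 3)

/-- `v × βv` for the planar data `c = (a₁, a₂, v₁, v₂, β₁₁, β₁₂, β₂₁, β₂₂)`. -/
def planeZ {R : Type*} [CommRing R] (c : Fin 8 → R) : R :=
  c 2 * (c 6 * c 2 + c 7 * c 3) - c 3 * (c 4 * c 2 + c 5 * c 3)

variable {K : Type*} [Field K] {σ : Type*}

/-- The generators of the planar ideal. -/
def planeGens (K : Type*) [Field K] {σ : Type*} (x : Fin 8 → σ) : Set (MvPolynomial σ K) :=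
  {planeA fun i => X (x i), planeB fun i => X (x i), planeZ fun i => X (x i)}

lemma eval_planeA (x : Fin 8 → σ) (p : σ → K) :
    eval p (planeA fun i => (X (x i) : MvPolynomial σ K)) = planeA fun i => p (x i) := by
  simp [planeA]

lemma eval_planeB (x : Fin 8 → σ) (p : σ → K) :
    eval p (planeB fun i => (X (x i) : MvPolynomial σ K)) = planeB fun i => p (x i) := by
  simp [planeB]

lemma eval_planeZ (x : Fin 8 → σ) (p : σ → K) :
    eval p (planeZ fun i => (X (x i) : MvPolynomial σ K)) = planeZ fun i => p (x i) := by
  simp [planeZ]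

lemma notMem_vars_of_mem_supported {i : σ} {f : MvPolynomial σ K}
    (h : f ∈ supported K ({i}ᶜ : Set σ)) : i ∉ f.vars := fun hi =>
  (mem_supported.1 h) hi rfl

lemma isRelPrime_X_pow_of_eval [DecidableEq σ] {i : σ} {f : MvPolynomial σ K} (n : ℕ) (p : σ → K)
    (hp : p i = 0) (h : eval p f ≠ 0) : IsRelPrime (X i ^ n) f := by
  apply IsRelPrime.pow_left
  refine ((X_prime (R := K) (i := i)).irreducible.isRelPrime_iff_not_dvd).2 ?_
  rintro ⟨g, rfl⟩
  simp [hp] at h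

variable [DecidableEq σ]

lemma irreducible_planeZ {x : Fin 8 → σ} (hx : Function.Injective x) :
    Irreducible (planeZ fun i => (X (x i) : MvPolynomial σ K)) := by
  have h := irreducible_mul_X_add (R := K) (X (x 2) ^ 2)
    (X (x 2) * X (x 3) * (X (x 7) - X (x 4)) - X (x 5) * X (x 3) ^ 2) (x 6) (by simp)
    (notMem_vars_of_mem_supported ?_) (notMem_vars_of_mem_supported ?_)
    (isRelPrime_X_pow_of_eval 2 (Function.update 1 (x 2) 0) (by simp) ?_)
  · convert h using 1
    simp only [planeZ]; ring
  · apply pow_mem; apply X_mem_supported.2; simp [hx.eq_iff]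
  · have hm : ∀ j, j ≠ 6 → (X (x j) : MvPolynomial σ K) ∈ supported K ({x 6}ᶜ : Set σ) := by
      intro j hj; apply X_mem_supported.2; simp [hx.eq_iff, hj]
    exact sub_mem (mul_mem (mul_mem (hm 2 (by decide)) (hm 3 (by decide)))
      (sub_mem (hm 7 (by decide)) (hm 4 (by decide))))
      (mul_mem (hm 5 (by decide)) (pow_mem (hm 3 (by decide)) _))
  · simp [hx.eq_iff]

/-- The weight counting the variables `a₁, a₂`. -/
def planeWeight {σ : Type*} [DecidableEq σ] (x : Fin 8 → σ) (i : σ) : ℕ :=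
  if i = x 0 ∨ i = x 1 then 1 else 0

lemma planeGens_homogeneous {x : Fin 8 → σ} (hx : Function.Injective x) :
    ∀ s ∈ planeGens K x, ∃ n, IsWeightedHomogeneous (planeWeight x) s n := by
  have h : ∀ i, IsWeightedHomogeneous (planeWeight x) (X (x i) : MvPolynomial σ K)
      (if i = 0 ∨ i = 1 then 1 else 0) := by
    intro i
    have := isWeightedHomogeneous_X K (planeWeight x) (x i)
    simpa [planeWeight, hx.eq_iff] using this
  rintro s (rfl | rfl | rfl)
  · exact ⟨1, ((h 0).mul (h 2)).add ((h 1).mul (h 3))⟩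
  · exact ⟨1, ((h 0).mul (((h 4).mul (h 2)).add ((h 5).mul (h 3)))).add
      ((h 1).mul (((h 6).mul (h 2)).add ((h 7).mul (h 3))))⟩
  · exact ⟨0, ((h 2).mul (((h 6).mul (h 2)).add ((h 7).mul (h 3)))).sub
      ((h 3).mul (((h 4).mul (h 2)).add ((h 5).mul (h 3))))⟩

/-- Points with `a₂ ≠ 0` are dense in the planar variety. -/
lemma plane_dense [IsAlgClosed K] {x : Fin 8 → σ} (hx : Function.Injective x) (g : MvPolynomial σ K)
    (hg : ∀ p : σ → K, planeA (fun i => p (x i)) = 0 → planeB (fun i => p (x i)) = 0 →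
      planeZ (fun i => p (x i)) = 0 → p (x 1) * eval p g = 0) (p : σ → K)
    (hA : planeA (fun i => p (x i)) = 0) (hB : planeB (fun i => p (x i)) = 0)
    (hZ : planeZ (fun i => p (x i)) = 0) : eval p g = 0 := by
  by_cases h2 : p (x 2) = 0
  · by_cases h3 : p (x 3) = 0
    · refine eval_eq_zero_of_free (x 1) p g fun q hq => ?_
      have hqi : ∀ j, j ≠ 1 → q (x j) = p (x j) := fun j hj => hq _ (by simpa [hx.eq_iff] using hj)
      apply hg
      · simp [planeA, hqi, h2, h3]
      · simp [planeB, hqi, h2, h3]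
      · simp [planeZ, hqi, h2, h3]
    · -- `v ∥ (0, 1)`: move along `v₁ = t`, `a₂ = -(a₁ + t) t / v₂`
      have h1 : p (x 1) = 0 := by simpa [planeA, h2, h3] using hA
      have h5 : p (x 5) = 0 := by simpa [planeZ, h2, h3] using hZ
      refine eval_eq_zero_of_curve_through (fun i =>
        if i = x 2 then Polynomial.X
        else if i = x 0 then Polynomial.C (p (x 0)) + Polynomial.X
        else if i = x 1 then
          -((Polynomial.C (p (x 0)) + Polynomial.X) * Polynomial.X * Polynomial.C (p (x 3))⁻¹)
        else if i = x 5 then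
          -(Polynomial.X * Polynomial.C ((p (x 4) - p (x 7)) * (p (x 3))⁻¹))
        else if i = x 7 then
          Polynomial.C (p (x 7)) - Polynomial.X * Polynomial.C (p (x 6) * (p (x 3))⁻¹)
        else Polynomial.C (p i)) p ?_ (x 1) ?_ g ?_
      · intro i
        split_ifs with k0 k1 k2 k3 k4 <;> simp [*]
      · simp only [hx.eq_iff]
        simp only [Fin.reduceEq, if_true, if_false, neg_ne_zero]
        refine mul_ne_zero (mul_ne_zero ?_ Polynomial.X_ne_zero) ?_
        · rw [add_comm]; exact Polynomial.X_add_C_ne_zero _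
        · simpa using h3
      · intro t q hq
        have q0 := hq (x 0)
        have q1 := hq (x 1)
        have q2 := hq (x 2)
        have q3 := hq (x 3)
        have q4 := hq (x 4)
        have q5 := hq (x 5)
        have q6 := hq (x 6)
        have q7 := hq (x 7)
        simp [hx.eq_iff] at q0 q1 q2 q3 q4 q5 q6 q7
        apply hg
        · simp only [planeA, q0, q1, q2, q3]
          field_simp
          ring
        · simp only [planeB, q0, q1, q2, q3, q4, q5, q6, q7]
          field_simp
          ring
        · simp only [planeZ, q2, q3, q4, q5, q6, q7]
          field_simp
          ring
  · refine eval_eq_zero_of_curve_through (fun i =>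
        if i = x 0 then Polynomial.C (p (x 0)) - Polynomial.C (p (x 3)) * Polynomial.X
        else if i = x 1 then Polynomial.C (p (x 1)) + Polynomial.C (p (x 2)) * Polynomial.X
        else Polynomial.C (p i)) p ?_ (x 1) ?_ g ?_
    · intro i
      split_ifs with k0 k1 <;> simp [*]
    · simp only [hx.eq_iff]
      simp only [Fin.reduceEq, if_true, if_false]
      intro h
      have := congrArg (fun f => Polynomial.coeff f 1) h
      simp [h2] at this
    · intro t q hq
      have q0 := hq (x 0)
      have q1 := hq (x 1)
      have q2 := hq (x 2)
      have q3 := hq (x 3)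
      have q4 := hq (x 4)
      have q5 := hq (x 5)
      have q6 := hq (x 6)
      have q7 := hq (x 7)
      simp [hx.eq_iff] at q0 q1 q2 q3 q4 q5 q6 q7
      simp only [planeA, planeB, planeZ] at hA hB hZ
      apply hg
      · simp only [planeA, q0, q1, q2, q3]
        linear_combination hA
      · simp only [planeB, q0, q1, q2, q3, q4, q5, q6, q7]
        linear_combination hB + t * hZ
      · simp only [planeZ, q2, q3, q4, q5, q6, q7]
        linear_combination hZ

variable [IsAlgClosed K] [Finite σ]

/-- Elements vanishing on the slice `a₂ = 0`. -/
lemma plane_slice {x : Fin 8 → σ} (hx : Function.Injective x) (f : MvPolynomial σ K)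
    (hf : ∀ p : σ → K, planeA (fun i => p (x i)) = 0 → planeB (fun i => p (x i)) = 0 →
      planeZ (fun i => p (x i)) = 0 → p (x 1) = 0 → eval p f = 0) :
    ∃ g, f - X (x 1) * g ∈ Ideal.span (planeGens K x) := by
  obtain ⟨g1, hg1⟩ := exists_eq_kill_add (x 1) f
  set f1 := kill K (x 1) f with hf1
  obtain ⟨g0, hg0⟩ := exists_eq_kill_add (x 0) f1
  set f0 := kill K (x 0) f1 with hf0
  have e1 : ∀ p : σ → K, eval p f1 = eval (Function.update p (x 1) 0) f := fun p => eval_kill _ _ _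
  have e0 : ∀ p : σ → K, eval p f0 = eval (Function.update p (x 0) 0) f1 := fun p => eval_kill _ _ _
  -- the part free of `a`
  have hZ : planeZ (fun i => (X (x i) : MvPolynomial σ K)) ∣ f0 := by
    apply dvd_of_vanishing (irreducible_planeZ hx)
    intro p hp
    rw [eval_planeZ] at hp
    rw [e0, e1]
    apply hf
    · simp [planeA, hx.eq_iff]
    · simp [planeB, hx.eq_iff]
    · simpa [planeZ, Function.update_apply, hx.eq_iff] using hp
    · simp
  -- the coefficient of `a₁`
  have hg : ∀ p : σ → K, p (x 2) = 0 → p (x 5) * p (x 3) = 0 → eval p g0 = 0 := by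
    intro p h2 h53
    refine eval_eq_zero_of_free (x 0) p g0 fun q hq => ?_
    have hqi : ∀ j, j ≠ 0 → q (x j) = p (x j) := fun j hj => hq _ (by simpa [hx.eq_iff] using hj)
    have h1 : eval q f1 = 0 := by
      rw [e1]
      apply hf
      · simp [planeA, hx.eq_iff, hqi, h2]
      · simp [planeB, hx.eq_iff, hqi, h2, h53]
      · simp [planeZ, hx.eq_iff, hqi, h2, h53]
      · simp
    have h0 : eval q f0 = 0 := by
      rw [e0, e1]
      apply hf
      · simp [planeA, hx.eq_iff]
      · simp [planeB, hx.eq_iff]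
      · simp [planeZ, hx.eq_iff, hqi, h2, h53]
      · simp
    rw [hg0, map_add, h0, zero_add, map_mul, eval_X] at h1
    exact h1
  obtain ⟨r, hr⟩ := exists_eq_kill_add (x 2) g0
  have hr5 : X (x 5) * X (x 3) ∣ kill K (x 2) g0 := by
    have a5 : X (x 5) ∣ kill K (x 2) g0 := by
      apply X_dvd_of_vanishing
      intro p hp
      rw [eval_kill]
      apply hg <;> simp [hx.eq_iff, hp]
    have a3 : X (x 3) ∣ kill K (x 2) g0 := by
      apply X_dvd_of_vanishing
      intro p hp
      rw [eval_kill]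
      apply hg <;> simp [hx.eq_iff, hp]
    obtain ⟨s, hs⟩ := a5
    rw [hs] at a3 ⊢
    refine mul_dvd_mul_left _ (((X_prime (R := K) (i := x 3)).dvd_or_dvd a3).resolve_left ?_)
    rw [X_dvd_X]
    simp [hx.eq_iff]
  obtain ⟨s, hs⟩ := hr5
  obtain ⟨z, hz⟩ := hZ
  have hA : planeA (fun i => (X (x i) : MvPolynomial σ K)) ∈ Ideal.span (planeGens K x) :=
    Ideal.subset_span (by simp [planeGens])
  have hB : planeB (fun i => (X (x i) : MvPolynomial σ K)) ∈ Ideal.span (planeGens K x) :=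
    Ideal.subset_span (by simp [planeGens])
  have hZ : planeZ (fun i => (X (x i) : MvPolynomial σ K)) ∈ Ideal.span (planeGens K x) :=
    Ideal.subset_span (by simp [planeGens])
  refine ⟨g1 - X (x 3) * r - (X (x 6) * X (x 2) + X (x 7) * X (x 3) - X (x 4) * X (x 3)) * s, ?_⟩
  have := add_mem (add_mem (Ideal.mul_mem_right z _ hZ)
    (Ideal.mul_mem_left _ (r - X (x 4) * s) hA)) (Ideal.mul_mem_left _ s hB)
  convert this using 1
  rw [hg1, hg0, hz, hr, hs]
  simp only [planeA, planeB]
  ring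

/-- The planar ideal is radical. -/
lemma plane_radical {x : Fin 8 → σ} (hx : Function.Injective x) (f : MvPolynomial σ K)
    (hf : ∀ p : σ → K, planeA (fun i => p (x i)) = 0 → planeB (fun i => p (x i)) = 0 →
      planeZ (fun i => p (x i)) = 0 → eval p f = 0) :
    f ∈ Ideal.span (planeGens K x) := by
  refine mem_span_of_forall_step (planeWeight x) (x 1) (by simp [planeWeight])
    (planeGens K x) (planeGens_homogeneous hx)
    {f | ∀ p : σ → K, planeA (fun i => p (x i)) = 0 → planeB (fun i => p (x i)) = 0 →
      planeZ (fun i => p (x i)) = 0 → eval p f = 0} ?_ f hf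
  intro f hf
  obtain ⟨g, hg⟩ := plane_slice hx f fun p hA hB hZ _ => hf p hA hB hZ
  refine ⟨g, plane_dense hx g fun p hA hB hZ => ?_, hg⟩
  have h1 : Ideal.span (planeGens K x) ≤ RingHom.ker (eval p) := by
    rw [Ideal.span_le]
    rintro s (rfl | rfl | rfl)
    · simpa [RingHom.mem_ker, eval_planeA] using hA
    · simpa [RingHom.mem_ker, eval_planeB] using hB
    · simpa [RingHom.mem_ker, eval_planeZ] using hZ
  have h2 := h1 hg
  rw [RingHom.mem_ker, map_sub, hf p hA hB hZ, map_mul, eval_X, zero_sub, neg_eq_zero] at h2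
  exact h2

end PlaneCase
section ThreeVec

variable {R : Type*} [CommRing R]

/-- The dot product of two vectors of length three. -/
def dot (w v : Fin 3 → R) : R := w 0 * v 0 + w 1 * v 1 + w 2 * v 2

/-- Matrix times column. -/
def mv (a : Fin 3 → Fin 3 → R) (v : Fin 3 → R) : Fin 3 → R := fun i => dot (a i) v

/-- Row times matrix. -/
def rv (w : Fin 3 → R) (a : Fin 3 → Fin 3 → R) : Fin 3 → R :=
  fun j => w 0 * a 0 j + w 1 * a 1 j + w 2 * a 2 j

/-- The cross product. -/
def crs (x y : Fin 3 → R) : Fin 3 → R :=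
  ![x 1 * y 2 - x 2 * y 1, x 2 * y 0 - x 0 * y 2, x 0 * y 1 - x 1 * y 0]

/-- The determinant of three rows. -/
def det3 (x y z : Fin 3 → R) : R := dot (crs x y) z

@[simp] lemma crs_zero (x y : Fin 3 → R) : crs x y 0 = x 1 * y 2 - x 2 * y 1 := rfl
@[simp] lemma crs_one (x y : Fin 3 → R) : crs x y 1 = x 2 * y 0 - x 0 * y 2 := rfl
@[simp] lemma crs_two (x y : Fin 3 → R) : crs x y 2 = x 0 * y 1 - x 1 * y 0 := rfl

lemma map_dot {S : Type*} [CommRing S] (φ : R →+* S) (w v : Fin 3 → R) :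
    φ (dot w v) = dot (fun i => φ (w i)) (fun i => φ (v i)) := by
  simp [dot]

lemma map_rv {S : Type*} [CommRing S] (φ : R →+* S) (a : Fin 3 → Fin 3 → R) (v : Fin 3 → R) :
    (fun i => φ (rv v a i)) = rv (fun i => φ (v i)) (fun i j => φ (a i j)) := by
  funext i; simp [rv]

lemma map_crs {S : Type*} [CommRing S] (φ : R →+* S) (x y : Fin 3 → R) :
    (fun i => φ (crs x y i)) = crs (fun i => φ (x i)) (fun i => φ (y i)) := by
  funext i; fin_cases i <;> simp

lemma map_det3 {S : Type*} [CommRing S] (φ : R →+* S) (x y z : Fin 3 → R) :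
    φ (det3 x y z) = det3 (fun i => φ (x i)) (fun i => φ (y i)) (fun i => φ (z i)) := by
  simp [det3, dot]

variable {K : Type*} [Field K]

lemma exists_smul_of_crs_eq_zero {v y : Fin 3 → K} (hv : v ≠ 0) (h : ∀ i, crs v y i = 0) :
    ∃ c : K, ∀ i, y i = c * v i := by
  have h0 := h 0
  have h1 := h 1
  have h2 := h 2
  simp only [crs_zero, crs_one, crs_two] at h0 h1 h2
  obtain ⟨j, hj⟩ := Function.ne_iff.1 hv
  refine ⟨y j / v j, fun i => ?_⟩
  rw [Pi.zero_apply] at hj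
  rw [div_mul_eq_mul_div, eq_div_iff hj]
  fin_cases i <;> fin_cases j <;> simp only [Fin.zero_eta, Fin.mk_one, Fin.reduceFinMk] <;>
    first | ring1 | linear_combination h0 | linear_combination -h0 | linear_combination h1 |
      linear_combination -h1 | linear_combination h2 | linear_combination -h2

lemma crs_eq_zero_of_smul {v y : Fin 3 → K} (c : K) (h : ∀ i, y i = c * v i) (i : Fin 3) :
    crs v y i = 0 := by
  fin_cases i <;> simp [h] <;> ring

/-- The linear map attached to a `3 × 3` array. -/
def mvLin (a : Fin 3 → Fin 3 → K) : (Fin 3 → K) →ₗ[K] (Fin 3 → K) where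
  toFun := mv a
  map_add' x y := by funext i; simp [mv, dot]; ring
  map_smul' c x := by funext i; simp [mv, dot]; ring

lemma exists_eigenvector_mem [IsAlgClosed K] (a : Fin 3 → Fin 3 → K)
    (U : Submodule K (Fin 3 → K)) (hU : ∀ u ∈ U, mv a u ∈ U) (hne : U ≠ ⊥) :
    ∃ u ∈ U, u ≠ 0 ∧ ∃ c : K, ∀ i, mv a u i = c * u i := by
  have : Nontrivial U := Submodule.nontrivial_iff_ne_bot.2 hne
  obtain ⟨c, hc⟩ := Module.End.exists_eigenvalue ((mvLin a).restrict hU)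
  obtain ⟨u, hu⟩ := hc.exists_hasEigenvector
  refine ⟨u, u.2, fun h => hu.2 (Subtype.ext h), c, fun i => ?_⟩
  have := congrArg (fun x : U => (x : Fin 3 → K) i) hu.apply_eq_smul
  simpa [mvLin, LinearMap.restrict_apply] using this

lemma exists_eigenvector [IsAlgClosed K] (a : Fin 3 → Fin 3 → K) :
    ∃ u : Fin 3 → K, u ≠ 0 ∧ ∃ c : K, ∀ i, mv a u i = c * u i := by
  obtain ⟨u, -, h⟩ := exists_eigenvector_mem a ⊤ (fun _ _ => trivial) top_ne_bot
  exact ⟨u, h⟩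

end ThreeVec

section Coordinates

/-- Coordinates: a covector `w`, a vector `v`, a matrix `α`, and free parameters. -/
abbrev Coord (ε : Type*) := (Fin 3 ⊕ Fin 3) ⊕ ((Fin 3 × Fin 3) ⊕ ε)

variable {ε : Type*}

/-- The coordinates of `w`. -/
abbrev iw (i : Fin 3) : Coord ε := Sum.inl (Sum.inl i)

/-- The coordinates of `v`. -/
abbrev iv (i : Fin 3) : Coord ε := Sum.inl (Sum.inr i)

/-- The coordinates of `α`. -/
abbrev ia (i j : Fin 3) : Coord ε := Sum.inr (Sum.inl (i, j))

variable {R : Type*} [CommRing R]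

/-- The `w`-part of a family indexed by coordinates. -/
abbrev pw (c : Coord ε → R) : Fin 3 → R := fun i => c (iw i)

/-- The `v`-part of a family indexed by coordinates. -/
abbrev pv (c : Coord ε → R) : Fin 3 → R := fun i => c (iv i)

/-- The `α`-part of a family indexed by coordinates. -/
abbrev pa (c : Coord ε → R) : Fin 3 → Fin 3 → R := fun i j => c (ia i j)

/-- `w αᵏ v` for `k = 0, 1, 2`. -/
def formF (c : Coord ε → R) : Fin 3 → R :=
  ![dot (pw c) (pv c), dot (pw c) (mv (pa c) (pv c)), dot (pw c) (mv (pa c) (mv (pa c) (pv c)))]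

/-- `v × α v`. -/
def formZ (c : Coord ε → R) : Fin 3 → R := crs (pv c) (mv (pa c) (pv c))

/-- `det (w; wα; wα²)`. -/
def formD (c : Coord ε → R) : R := det3 (pw c) (rv (pw c) (pa c)) (rv (rv (pw c) (pa c)) (pa c))

lemma map_formF {S : Type*} [CommRing S] (φ : R →+* S) (c : Coord ε → R) (k : Fin 3) :
    φ (formF c k) = formF (fun i => φ (c i)) k := by
  fin_cases k <;> simp [formF, dot, mv]

lemma map_formZ {S : Type*} [CommRing S] (φ : R →+* S) (c : Coord ε → R) (k : Fin 3) :
    φ (formZ c k) = formZ (fun i => φ (c i)) k := by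
  fin_cases k <;> simp [formZ, dot, mv]

lemma map_formD {S : Type*} [CommRing S] (φ : R →+* S) (c : Coord ε → R) :
    φ (formD c) = formD (fun i => φ (c i)) := by
  simp [formD, det3, dot, rv]

open MvPolynomial

variable {K : Type*} [Field K]

lemma eval_formF (p : Coord ε → K) (k : Fin 3) :
    eval p (formF (X : Coord ε → MvPolynomial (Coord ε) K) k) = formF p k := by
  rw [map_formF]; simp

lemma eval_formZ (p : Coord ε → K) (k : Fin 3) :
    eval p (formZ (X : Coord ε → MvPolynomial (Coord ε) K) k) = formZ p k := by
  rw [map_formZ]; simp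

lemma eval_formD (p : Coord ε → K) :
    eval p (formD (X : Coord ε → MvPolynomial (Coord ε) K)) = formD p := by
  rw [map_formD]; simp

/-- Deform an eigenvector `v` in the direction `u`, keeping the eigenvalue. -/
lemma eval_eq_zero_of_eigencurve [Infinite K] (p : Coord ε → K) (lam : K)
    (hp : ∀ i, mv (pa p) (pv p) i = lam * p (iv i)) (j : Fin 3) (hj : p (iv j) ≠ 0)
    (u : Fin 3 → K) (hu : u j = 0) (cw : Fin 3 → Polynomial K)
    (hcw : ∀ i, (cw i).eval 0 = p (iw i)) (y : Coord ε)
    (hy : (∃ k, y = iw k ∧ cw k ≠ 0) ∨ ∃ k, y = iv k ∧ u k ≠ 0)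
    (g : MvPolynomial (Coord ε) K)
    (h : ∀ (t : K) (q : Coord ε → K), (∀ i, q (iw i) = (cw i).eval t) →
      (∀ i, q (iv i) = p (iv i) + t * u i) → (∀ i, mv (pa q) (pv q) i = lam * q (iv i)) →
      q y * eval q g = 0) : eval p g = 0 := by
  refine eval_eq_zero_of_curve_through (Sum.elim
    (Sum.elim cw fun i => Polynomial.C (p (iv i)) + Polynomial.C (u i) * Polynomial.X)
    (Sum.elim (fun ik => Polynomial.C (p (ia ik.1 ik.2)) - if ik.2 = j then
      Polynomial.C ((mv (pa p) u ik.1 - lam * u ik.1) / p (iv j)) * Polynomial.X else 0)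
      fun e => Polynomial.C (p (Sum.inr (Sum.inr e))))) p ?_ y ?_ g ?_
  · rintro ((i | i) | (⟨i, k⟩ | e))
    · simp [hcw]
    · simp
    · simp only [Sum.elim_inl, Sum.elim_inr]; split_ifs <;> simp
    · simp
  · rcases hy with ⟨k, rfl, hk⟩ | ⟨k, rfl, hk⟩
    · simpa using hk
    · simp only [Sum.elim_inl, Sum.elim_inr]
      intro h0
      have := congrArg (fun f => Polynomial.coeff f 1) h0
      simp [Polynomial.coeff_C] at this
      exact hk this
  · intro t q hq
    refine h t q (fun i => by simp [hq]) (fun i => by rw [hq]; simp; ring) fun i => ?_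
    have e := hp i
    have ha : ∀ i k, q (ia i k) = p (ia i k) - if k = j then
        ((mv (pa p) u i - lam * u i) / p (iv j)) * t else 0 := by
      intro i k
      rw [hq]
      simp only [Sum.elim_inl, Sum.elim_inr]; split_ifs <;> simp
    have hv : ∀ i, q (iv i) = p (iv i) + t * u i := fun i => by rw [hq]; simp; ring
    simp only [mv, dot, pa, pv] at e ha ⊢
    simp only [ha, hv]
    fin_cases j <;> simp only [Fin.zero_eta, Fin.mk_one, Fin.reduceFinMk, Fin.isValue] at hj hu ⊢ <;>
      simp only [Fin.reduceEq, if_true, if_false, hu] <;> field_simp <;>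
      first | linear_combination p (iv 0) * e | linear_combination p (iv 1) * e |
        linear_combination p (iv 2) * e

end Coordinates
section IrreducibleD

open MvPolynomial

/-- `det (w; wα; wα²)` with generic `α`. -/
noncomputable def genD {R : Type*} [CommRing R] (w : Fin 3 → R) : MvPolynomial (Fin 3 × Fin 3) R :=
  det3 (fun i => C (w i)) (rv (fun i => C (w i)) fun i j => X (i, j))
    (rv (rv (fun i => C (w i)) fun i j => X (i, j)) fun i j => X (i, j))

lemma genD_homogeneous {R : Type*} [CommRing R] (w : Fin 3 → R) : (genD w).IsHomogeneous 3 := by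
  have hX : ∀ i j, (X (i, j) : MvPolynomial (Fin 3 × Fin 3) R).IsHomogeneous 1 :=
    fun i j => isHomogeneous_X _ _
  have hC : ∀ i, (C (w i) : MvPolynomial (Fin 3 × Fin 3) R).IsHomogeneous 0 :=
    fun i => isHomogeneous_C _ _
  have h1 : ∀ j, (rv (fun i => (C (w i) : MvPolynomial (Fin 3 × Fin 3) R))
      (fun i j => X (i, j)) j).IsHomogeneous 1 := fun j =>
    (((hC 0).mul (hX 0 j)).add ((hC 1).mul (hX 1 j))).add ((hC 2).mul (hX 2 j))
  have h2 : ∀ j, (rv (rv (fun i => (C (w i) : MvPolynomial (Fin 3 × Fin 3) R))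
      fun i j => X (i, j)) (fun i j => X (i, j)) j).IsHomogeneous 2 := fun j =>
    (((h1 0).mul (hX 0 j)).add ((h1 1).mul (hX 1 j))).add ((h1 2).mul (hX 2 j))
  have h3 : ∀ j k, (C (w j) * rv (fun i => (C (w i) : MvPolynomial (Fin 3 × Fin 3) R))
      (fun i j => X (i, j)) k - C (w k) * rv (fun i => (C (w i) : MvPolynomial (Fin 3 × Fin 3) R))
      (fun i j => X (i, j)) j).IsHomogeneous 1 := fun j k => by
    simpa using ((hC j).mul (h1 k)).sub ((hC k).mul (h1 j))
  exact (((h3 1 2).mul (h2 0)).add ((h3 2 0).mul (h2 1))).add ((h3 0 1).mul (h2 2))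

lemma irreducible_genD_unit (F : Type*) [Field F] :
    Irreducible (genD ![(1 : F), 0, 0]) := by
  have h := irreducible_mul_X_add (R := F) (X ((0 : Fin 3), (1 : Fin 3)) ^ 2)
    (X (0, 1) * X (0, 2) * (X (2, 2) - X (1, 1)) - X (0, 2) ^ 2 * X (2, 1)) (1, 2) (by simp)
    (notMem_vars_of_mem_supported ?_) (notMem_vars_of_mem_supported ?_)
    (isRelPrime_X_pow_of_eval 2 (Function.update 1 (0, 1) 0) (by simp) ?_)
  · convert h using 1
    simp [genD, det3, dot, rv]; ring
  · apply pow_mem; apply X_mem_supported.2; simp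
  · have hm : ∀ j, j ≠ ((1 : Fin 3), (2 : Fin 3)) →
        (X j : MvPolynomial (Fin 3 × Fin 3) F) ∈ supported F ({(1, 2)}ᶜ : Set (Fin 3 × Fin 3)) := by
      intro j hj; apply X_mem_supported.2; simpa using hj
    exact sub_mem (mul_mem (mul_mem (hm _ (by decide)) (hm _ (by decide)))
      (sub_mem (hm _ (by decide)) (hm _ (by decide))))
      (mul_mem (pow_mem (hm _ (by decide)) _) (hm _ (by decide)))
  · simp

lemma map_genD {R S : Type*} [CommRing R] [CommRing S] (φ : R →+* S) (w : Fin 3 → R) :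
    MvPolynomial.map φ (genD w) = genD fun i => φ (w i) := by
  simp [genD, det3, dot, rv]

lemma irreducible_genD {R F : Type*} [CommRing R] [IsDomain R] [Field F] (s : R →+* F)
    (w : Fin 3 → R) (h0 : s (w 0) = 1) (h1 : s (w 1) = 0) (h2 : s (w 2) = 0)
    (hr : ∀ r, r ∣ w 0 ^ 3 → r ∣ w 2 ^ 3 → IsUnit r) : Irreducible (genD w) := by
  have hs : MvPolynomial.map s (genD w) = genD ![(1 : F), 0, 0] := by
    rw [map_genD]
    congr 1
    funext i; fin_cases i <;> simp [h0, h1, h2]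
  have hirr := irreducible_genD_unit F
  have hne : genD w ≠ 0 := by
    intro h; rw [h, map_zero] at hs; exact hirr.ne_zero hs.symm
  have key : ∀ f g, genD w = f * g → IsUnit (MvPolynomial.map s f) → IsUnit f := by
    intro f g hfg hu
    have hf0 : f ≠ 0 := fun h => hne (by rw [hfg, h, zero_mul])
    have hg0 : g ≠ 0 := fun h => hne (by rw [hfg, h, mul_zero])
    have e1 := totalDegree_mul_of_isDomain hf0 hg0
    rw [← hfg, (genD_homogeneous w).totalDegree hne] at e1
    have hs' : genD ![(1 : F), 0, 0] = MvPolynomial.map s f * MvPolynomial.map s g := by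
      rw [← map_mul, ← hfg, hs]
    have hsf0 : MvPolynomial.map s f ≠ 0 := hu.ne_zero
    have hsg0 : MvPolynomial.map s g ≠ 0 := fun h => hirr.ne_zero (by rw [hs', h, mul_zero])
    have e2 := totalDegree_mul_of_isDomain hsf0 hsg0
    rw [← hs', (genD_homogeneous _).totalDegree hirr.ne_zero] at e2
    have e3 : (MvPolynomial.map s f).totalDegree = 0 := by
      obtain ⟨c, -, hc⟩ := MvPolynomial.isUnit_iff_eq_C_of_isReduced.1 hu
      rw [hc, totalDegree_C]
    have e4 : (MvPolynomial.map s g).totalDegree ≤ g.totalDegree :=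
      Finset.sup_mono (support_map_subset s g)
    have e5 : f.totalDegree = 0 := by omega
    rw [totalDegree_eq_zero_iff_eq_C] at e5
    rw [e5]
    refine (hr (coeff 0 f) ?_ ?_).map C
    · have := congrArg (eval fun ij : Fin 3 × Fin 3 =>
        if ij = (0, 1) ∨ ij = (1, 2) then (1 : R) else 0) hfg
      rw [e5, map_mul, eval_C] at this
      refine ⟨_, Eq.trans ?_ this⟩
      simp [genD, det3, dot, rv]
      ring
    · have := congrArg (eval fun ij : Fin 3 × Fin 3 =>
        if ij = (2, 1) ∨ ij = (1, 0) then (1 : R) else 0) hfg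
      rw [e5, map_mul, eval_C] at this
      rw [← dvd_neg]
      refine ⟨_, Eq.trans ?_ this⟩
      simp [genD, det3, dot, rv]
      ring
  refine ⟨fun h => hirr.not_isUnit (hs ▸ h.map (MvPolynomial.map s)), fun f g hfg => ?_⟩
  have hs' : genD ![(1 : F), 0, 0] = MvPolynomial.map s f * MvPolynomial.map s g := by
    rw [← map_mul, ← hfg, hs]
  rcases hirr.isUnit_or_isUnit hs' with h | h
  · exact Or.inl (key f g hfg h)
  · exact Or.inr (key g f (hfg.trans (mul_comm _ _)) h)

variable {K : Type*} [Field K] {ε : Type*}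

/-- Move the coordinates of `α` to the front. -/
def coordEquiv (ε : Type*) : Coord ε ≃ (Fin 3 × Fin 3) ⊕ ((Fin 3 ⊕ Fin 3) ⊕ ε) where
  toFun := Sum.elim (fun x => Sum.inr (Sum.inl x)) (Sum.elim Sum.inl fun e => Sum.inr (Sum.inr e))
  invFun := Sum.elim (fun x => Sum.inr (Sum.inl x)) (Sum.elim Sum.inl fun e => Sum.inr (Sum.inr e))
  left_inv := by rintro (x | (x | x)) <;> rfl
  right_inv := by rintro (x | (x | x)) <;> rfl

lemma exists_coordEquiv (K : Type*) [Field K] (ε : Type*) :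
    ∃ Φ : MvPolynomial (Coord ε) K ≃ₐ[K]
      MvPolynomial (Fin 3 × Fin 3) (MvPolynomial ((Fin 3 ⊕ Fin 3) ⊕ ε) K),
      (∀ i, Φ (X (iw i)) = C (X (Sum.inl (Sum.inl i)))) ∧ ∀ i j, Φ (X (ia i j)) = X (i, j) := by
  refine ⟨(renameEquiv K (coordEquiv ε)).trans
    (sumAlgEquiv K (Fin 3 × Fin 3) ((Fin 3 ⊕ Fin 3) ⊕ ε)), fun i => ?_, fun i j => ?_⟩
  · rw [AlgEquiv.trans_apply, renameEquiv_apply, rename_X]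
    exact sumAlgEquiv_X_inr ..
  · rw [AlgEquiv.trans_apply, renameEquiv_apply, rename_X]
    exact sumAlgEquiv_X_inl ..

lemma irreducible_formD :
    Irreducible (formD (X : Coord ε → MvPolynomial (Coord ε) K)) := by
  classical
  obtain ⟨Φ, hw, ha⟩ := exists_coordEquiv K ε
  rw [← MulEquiv.irreducible_iff Φ]
  have h1 : Φ (formD X) = genD (fun i => (X (Sum.inl (Sum.inl i)) :
      MvPolynomial ((Fin 3 ⊕ Fin 3) ⊕ ε) K)) := by
    have h2 := map_formD (Φ : MvPolynomial (Coord ε) K →+* MvPolynomial (Fin 3 × Fin 3) (MvPolynomial ((Fin 3 ⊕ Fin 3) ⊕ ε) K)) X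
    refine h2.trans ?_
    have hw' : pw (fun i => (Φ : MvPolynomial (Coord ε) K →+* MvPolynomial (Fin 3 × Fin 3) (MvPolynomial ((Fin 3 ⊕ Fin 3) ⊕ ε) K)) (X i)) =
      fun i => C (X (Sum.inl (Sum.inl i))) := funext hw
    have ha' : pa (fun i => (Φ : MvPolynomial (Coord ε) K →+* MvPolynomial (Fin 3 × Fin 3) (MvPolynomial ((Fin 3 ⊕ Fin 3) ⊕ ε) K)) (X i)) =
      fun i j => X (i, j) := funext fun i => funext fun j => ha i j
    rw [formD, hw', ha', genD]
  rw [h1]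
  refine irreducible_genD (eval fun i => if i = Sum.inl (Sum.inl 0) then (1 : K) else 0) _
    (by simp) (by simp) (by simp) fun r hr0 hr2 => ?_
  obtain ⟨i, -, hi⟩ := (dvd_prime_pow (X_prime (R := K)) 3).1 hr0
  rcases Nat.eq_zero_or_pos i with rfl | hpos
  · simpa using hi.isUnit_iff.2 (by simp)
  · exfalso
    have h3 : X (Sum.inl (Sum.inl 0)) ∣ (X (Sum.inl (Sum.inl 2)) ^ 3 :
        MvPolynomial ((Fin 3 ⊕ Fin 3) ⊕ ε) K) :=
      ((dvd_pow_self _ hpos.ne').trans hi.symm.dvd).trans hr2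
    have h4 := (X_prime (R := K)).dvd_of_dvd_pow h3
    rw [X_dvd_X] at h4
    simp at h4

end IrreducibleD
section CayleyHamilton

variable {R : Type*} [CommRing R]

/-- The trace of a `3 × 3` array. -/
def tr3 (a : Fin 3 → Fin 3 → R) : R := a 0 0 + a 1 1 + a 2 2

/-- The sum of the principal `2 × 2` minors. -/
def mi3 (a : Fin 3 → Fin 3 → R) : R :=
  a 0 0 * a 1 1 - a 0 1 * a 1 0 + (a 0 0 * a 2 2 - a 0 2 * a 2 0) + (a 1 1 * a 2 2 - a 1 2 * a 2 1)

lemma rv_rv_rv (a : Fin 3 → Fin 3 → R) (w : Fin 3 → R) (j : Fin 3) :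
    rv (rv (rv w a) a) a j =
      tr3 a * rv (rv w a) a j - mi3 a * rv w a j + det3 (a 0) (a 1) (a 2) * w j := by
  simp only [rv, tr3, mi3, det3, dot, crs_zero, crs_one, crs_two]
  fin_cases j <;> simp only [Fin.zero_eta, Fin.mk_one, Fin.reduceFinMk, Fin.isValue] <;> ring

lemma dot_mv (a : Fin 3 → Fin 3 → R) (w v : Fin 3 → R) : dot w (mv a v) = dot (rv w a) v := by
  simp only [dot, mv, rv]; ring

lemma crs_crs (r s y : Fin 3 → R) (i : Fin 3) :
    crs (crs r s) y i = dot r y * s i - dot s y * r i := by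
  fin_cases i <;> simp [dot] <;> ring

lemma dot_crs_left (r s : Fin 3 → R) : dot r (crs r s) = 0 := by simp [dot]; ring

lemma dot_crs_right (r s : Fin 3 → R) : dot s (crs r s) = 0 := by simp [dot]; ring

lemma dot_crs (r s t : Fin 3 → R) : dot t (crs r s) = det3 r s t := by simp [det3, dot]; ring

lemma det3_rot (r s t : Fin 3 → R) : det3 s t r = det3 r s t := by simp [det3, dot]; ring

/-- The adjugate identity. -/
lemma sum_crs_mul (r s t : Fin 3 → R) (l m : Fin 3) :
    crs s t l * r m + crs t r l * s m + crs r s l * t m = if l = m then det3 r s t else 0 := by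
  fin_cases l <;> fin_cases m <;> simp [det3, dot] <;> ring

/-- If `det (w; wα; wα²) = 0` then the cross products of the rows are eigenvectors of `α`. -/
lemma crs_crs_eq_zero (a : Fin 3 → Fin 3 → R) (w : Fin 3 → R)
    (h : det3 w (rv w a) (rv (rv w a) a) = 0) (i : Fin 3) :
    crs (crs w (rv w a)) (mv a (crs w (rv w a))) i = 0 ∧
    crs (crs (rv w a) (rv (rv w a) a)) (mv a (crs (rv w a) (rv (rv w a) a))) i = 0 ∧
    crs (crs (rv (rv w a) a) w) (mv a (crs (rv (rv w a) a) w)) i = 0 := by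
  have e : ∀ n, dot (rv (rv (rv w a) a) a) n = tr3 a * dot (rv (rv w a) a) n -
      mi3 a * dot (rv w a) n + det3 (a 0) (a 1) (a 2) * dot w n := by
    intro n; simp only [dot, rv_rv_rv]; ring
  have h1 := (det3_rot w (rv w a) (rv (rv w a) a)).trans h
  have h2 := (det3_rot _ _ _).trans h1
  refine ⟨?_, ?_, ?_⟩ <;> rw [crs_crs, dot_mv, dot_mv] <;>
    simp only [e, dot_crs_left, dot_crs_right, dot_crs, h, h1, h2] <;> ring

end CayleyHamilton

section Radical

open MvPolynomial

variable {K : Type*} [Field K] {ε : Type*}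

lemma eval_aeval {σ τ : Type*} (p : τ → K) (c : σ → MvPolynomial τ K) (f : MvPolynomial σ K) :
    eval p (aeval c f) = eval (fun i => eval p (c i)) f := by
  have : (eval p).comp (aeval c : MvPolynomial σ K →ₐ[K] _).toRingHom =
      eval fun i => eval p (c i) := by
    ext j <;> simp
  exact congrArg (fun φ => φ f) this

/-- A polynomial family without `v`, pairing to zero with all eigenvectors, is zero. -/
lemma eq_zero_of_forall_eigenvector [IsAlgClosed K] [Finite ε]
    (q : Fin 3 → MvPolynomial (Coord ε) K)
    (h : ∀ (p : Coord ε → K) (n : Fin 3 → K), (∀ i, crs n (mv (pa p) n) i = 0) →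
      dot (fun l => eval p (q l)) n = 0) (l : Fin 3) : q l = 0 := by
  classical
  apply MvPolynomial.funext
  intro p₀
  set σ : Coord ε → MvPolynomial (Coord ε) K := Sum.elim (fun i => C (p₀ (Sum.inl i)))
    (Sum.elim (fun ij => X (Sum.inr (Sum.inl ij))) fun e => C (p₀ (Sum.inr (Sum.inr e)))) with hσ
  set q' : Fin 3 → MvPolynomial (Coord ε) K := fun l => aeval σ (q l) with hq'
  have hev : ∀ p l, eval p (q' l) = eval (fun i => eval p (σ i)) (q l) := by
    exact fun p l => eval_aeval p σ (q l)
  have hpa : ∀ p : Coord ε → K, pa (fun i => eval p (σ i)) = pa p := by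
    intro p; funext i j
    change eval p (σ (ia i j)) = p (ia i j)
    simp [hσ]
  set w : Fin 3 → MvPolynomial (Coord ε) K := pw X with hw
  set a : Fin 3 → Fin 3 → MvPolynomial (Coord ε) K := pa X with ha
  have hdvd : ∀ n : Fin 3 → MvPolynomial (Coord ε) K,
      (∀ p : Coord ε → K, formD p = 0 →
        ∀ i, crs (fun i => eval p (n i)) (mv (pa p) fun i => eval p (n i)) i = 0) →
      formD X ∣ dot q' n := by
    intro n hn
    refine dvd_of_vanishing irreducible_formD fun p hp => ?_
    rw [eval_formD] at hp
    have := h (fun i => eval p (σ i)) (fun i => eval p (n i)) (by rw [hpa]; exact hn p hp)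
    rw [map_dot]
    simpa only [hev] using this
  have hwp : ∀ p : Coord ε → K, (fun i => eval p (w i)) = pw p := fun p => by simp [hw]
  have hap : ∀ p : Coord ε → K, (fun i j => eval p (a i j)) = pa p := fun p => by simp [ha]
  have hcrs := fun p : Coord ε → K => crs_crs_eq_zero (pa p) (pw p)
  obtain ⟨s₀, h₀⟩ := hdvd (crs (rv w a) (rv (rv w a) a)) fun p hp i => by
    simpa only [map_crs, map_rv, hwp, hap] using (hcrs p hp i).2.1
  obtain ⟨s₁, h₁⟩ := hdvd (crs (rv (rv w a) a) w) fun p hp i => by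
    simpa only [map_crs, map_rv, hwp, hap] using (hcrs p hp i).2.2
  obtain ⟨s₂, h₂⟩ := hdvd (crs w (rv w a)) fun p hp i => by
    simpa only [map_crs, map_rv, hwp, hap] using (hcrs p hp i).1
  have hq : q' l = s₀ * w l + s₁ * rv w a l + s₂ * rv (rv w a) a l := by
    have hD : (formD X : MvPolynomial (Coord ε) K) ≠ 0 := irreducible_formD.ne_zero
    apply mul_left_cancel₀ hD
    have e := fun m => sum_crs_mul w (rv w a) (rv (rv w a) a) m l
    have hD' : det3 w (rv w a) (rv (rv w a) a) = formD X := rfl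
    have : formD X * q' l = dot q' (crs (rv w a) (rv (rv w a) a)) * w l +
        dot q' (crs (rv (rv w a) a) w) * rv w a l + dot q' (crs w (rv w a)) * rv (rv w a) a l := by
      have e0 := e 0
      have e1 := e 1
      have e2 := e 2
      rw [hD'] at e0 e1 e2
      simp only [dot]
      have hsum : formD X * q' l = q' 0 * (if 0 = l then formD X else 0) +
          q' 1 * (if 1 = l then formD X else 0) + q' 2 * (if 2 = l then formD X else 0) := by
        fin_cases l <;> simp [mul_comm]
      rw [hsum, ← e0, ← e1, ← e2]
      ring
    rw [this, h₀, h₁, h₂]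
    ring
  have h3 := congrArg (eval (Sum.elim 0 fun i => p₀ (Sum.inr i))) hq
  rw [hev] at h3
  have h4 : (fun i => eval (Sum.elim 0 fun i => p₀ (Sum.inr i)) (σ i)) = p₀ := by
    funext i
    rcases i with i | (i | i) <;> simp [hσ]
  rw [h4] at h3
  rw [h3, map_zero]
  simp [hw, rv]

end Radical
section EigenIdeal

open MvPolynomial

variable {K : Type*} [Field K] {ε : Type*}

/-- Set `v = 0`. -/
noncomputable def killV (K : Type*) [Field K] (ε : Type*) :
    MvPolynomial (Coord ε) K →ₐ[K] MvPolynomial (Coord ε) K :=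
  aeval (Sum.elim (Sum.elim (fun i => X (iw i)) fun _ => 0) fun e => X (Sum.inr e))

lemma killV_X_iv (i : Fin 3) : killV K ε (X (iv i)) = 0 := by simp [killV]

lemma killV_X_ia (i j : Fin 3) : killV K ε (X (ia i j)) = X (ia i j) := by simp [killV]

lemma exists_eq_killV_add (f : MvPolynomial (Coord ε) K) :
    ∃ h : Fin 3 → MvPolynomial (Coord ε) K, f = killV K ε f + dot (pv X) h := by
  induction f using MvPolynomial.induction_on with
  | C a => exact ⟨0, by simp [killV, dot]⟩
  | add p q hp hq =>
    obtain ⟨h, hh⟩ := hp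
    obtain ⟨k, hk⟩ := hq
    refine ⟨fun i => h i + k i, ?_⟩
    rw [map_add]
    nth_rewrite 1 [hh]
    nth_rewrite 1 [hk]
    simp only [dot]; ring
  | mul_X p j hp =>
    obtain ⟨h, hh⟩ := hp
    rw [map_mul]
    rcases j with (i | i) | e
    · refine ⟨fun l => h l * X (iw i), ?_⟩
      nth_rewrite 1 [hh]
      simp [killV, dot]; ring
    · refine ⟨fun l => if l = i then p else 0, ?_⟩
      rw [killV_X_iv]
      fin_cases i <;> simp [dot] <;> ring
    · refine ⟨fun l => h l * X (Sum.inr e), ?_⟩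
      nth_rewrite 1 [hh]
      simp [killV, dot]; ring

lemma killV_pderiv_dot (j : Fin 3) (h : Fin 3 → MvPolynomial (Coord ε) K) :
    killV K ε (pderiv (iv j) (dot (pv X) h)) = killV K ε (h j) := by
  simp only [dot, pv, map_add, Derivation.leibniz, smul_eq_mul, map_mul, killV_X_iv, zero_mul,
    zero_add]
  fin_cases j <;> simp

lemma killV_pderiv_mul (j : Fin 3) (p q : MvPolynomial (Coord ε) K) :
    killV K ε (pderiv (iv j) (p * q)) = killV K ε p * killV K ε (pderiv (iv j) q) +
      killV K ε q * killV K ε (pderiv (iv j) p) := by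
  simp [Derivation.leibniz]

lemma eval_killV (p : Coord ε → K) (f : MvPolynomial (Coord ε) K) :
    eval p (killV K ε f) = eval (Sum.elim (Sum.elim (pw p) 0) fun e => p (Sum.inr e)) f := by
  rw [killV, eval_aeval]
  congr 2
  funext i
  rcases i with (i | i) | i <;> simp

/-- The variables of the planar problem on the slice `v₂ = 0`. -/
def planeVarsZ (ε : Type*) : Fin 8 → Coord ε :=
  ![ia 2 0, ia 2 1, iv 0, iv 1, ia 0 0, ia 0 1, ia 1 0, ia 1 1]

lemma planeVarsZ_injective : Function.Injective (planeVarsZ ε) := by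
  intro i j h
  fin_cases i <;> fin_cases j <;> simp [planeVarsZ] at h ⊢

lemma formZ_eq_zero_of_pv_eq_zero {p : Coord ε → K} (h : ∀ i, p (iv i) = 0) (l : Fin 3) :
    formZ p l = 0 := by
  have : ∀ (a : Fin 3 → Fin 3 → K) (v : Fin 3 → K), (∀ i, v i = 0) → crs v (mv a v) l = 0 := by
    intro a v hv
    fin_cases l <;> simp [hv]
  exact this (pa p) (pv p) h

lemma formZ_eq_zero_of_smul {p : Coord ε → K} {a : Fin 3 → Fin 3 → K} {n : Fin 3 → K}
    (hn : ∀ i, crs n (mv a n) i = 0) (t : K) (ha : ∀ i j, p (ia i j) = a i j)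
    (h : ∀ i, p (iv i) = n i * t) (l : Fin 3) : formZ p l = 0 := by
  have : ∀ v : Fin 3 → K, (∀ i, v i = n i * t) → crs v (mv a v) l = t ^ 2 * crs n (mv a n) l := by
    intro v hv
    fin_cases l <;> simp [hv, mv, dot] <;> ring
  have e : pa p = a := by
    funext i j
    exact ha i j
  unfold formZ
  rw [e, this (pv p) h, hn, mul_zero]

/-- Polynomials vanishing on eigenvectors have no linear part in `v`. -/
lemma killV_pderiv_eq_zero [IsAlgClosed K] [Finite ε] (f : MvPolynomial (Coord ε) K)
    (hf : ∀ p : Coord ε → K, (∀ l, formZ p l = 0) → eval p f = 0) (j : Fin 3) :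
    killV K ε (pderiv (iv j) f) = 0 := by
  obtain ⟨h, hh⟩ := exists_eq_killV_add f
  have h0 : killV K ε f = 0 := by
    apply MvPolynomial.funext
    intro p
    rw [eval_killV, map_zero]
    exact hf _ (formZ_eq_zero_of_pv_eq_zero fun i => by simp)
  rw [h0, zero_add] at hh
  rw [hh, killV_pderiv_dot]
  refine eq_zero_of_forall_eigenvector (fun l => killV K ε (h l)) (fun p n hn => ?_) j
  by_cases hn0 : n = 0
  · subst hn0; simp [dot]
  obtain ⟨k, hk⟩ := Function.ne_iff.1 hn0
  rw [Pi.zero_apply] at hk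
  have key : eval (Sum.elim (Sum.elim (pw p) 0) fun e => p (Sum.inr e))
      (dot (fun i => C (n i)) h) = 0 := by
    refine eval_eq_zero_of_curve_through
      (Sum.elim (Sum.elim (fun i => Polynomial.C (p (iw i)))
        fun i => Polynomial.C (n i) * Polynomial.X)
        fun e => Polynomial.C (p (Sum.inr e))) _ ?_ (iv k) ?_ _ ?_
    · rintro ((i | i) | e) <;> simp
    · simpa using hk
    · intro t q hq
      have hqv : ∀ i, q (iv i) = n i * t := fun i => by rw [hq]; simp
      have hqa : ∀ i j, q (ia i j) = p (ia i j) := fun i j => by rw [hq]; simp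
      have h1 : eval q f = 0 := by
        exact hf q (formZ_eq_zero_of_smul hn t hqa hqv)
      rw [hh] at h1
      simp only [map_dot, eval_X, eval_C, hqv] at h1 ⊢
      simp only [dot] at h1 ⊢
      linear_combination n k * h1
  simp only [eval_killV]
  rw [map_dot] at key
  simp only [eval_C] at key
  simp only [dot] at key ⊢
  linear_combination key

lemma mem_formZ_slice [IsAlgClosed K] [Finite ε] (f : MvPolynomial (Coord ε) K)
    (hf : ∀ p : Coord ε → K, (∀ l, formZ p l = 0) → eval p f = 0) :
    ∃ g, f - X (iv 2) * g ∈
      Ideal.span (Set.range (formZ (X : Coord ε → MvPolynomial (Coord ε) K))) := by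
  classical
  obtain ⟨g, hg⟩ := exists_eq_kill_add (iv 2) f
  have hk : kill K (iv 2) f ∈ Ideal.span (planeGens K (planeVarsZ ε)) := by
    refine plane_radical planeVarsZ_injective _ fun p hA hB hZ => ?_
    rw [eval_kill]
    refine hf _ fun l => ?_
    simp only [planeA, planeB, planeZ, planeVarsZ] at hA hB hZ
    simp at hA hB hZ
    fin_cases l <;> simp [formZ, mv, dot]
    · exact Or.inr hA
    · exact Or.inr hA
    · linear_combination hZ
  rw [planeGens] at hk
  set A : MvPolynomial (Coord ε) K := planeA fun i => X (planeVarsZ ε i) with hA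
  set B : MvPolynomial (Coord ε) K := planeB fun i => X (planeVarsZ ε i) with hB
  set Z : MvPolynomial (Coord ε) K := planeZ fun i => X (planeVarsZ ε i) with hZ
  obtain ⟨p₁, r, hr, hk⟩ := Ideal.mem_span_insert.1 hk
  obtain ⟨p₂, p₃, rfl⟩ := Ideal.mem_span_pair.1 hr
  rw [hk] at hg
  have hkA : killV K ε A = 0 := by simp [hA, planeA, planeVarsZ, killV]
  have hkB : killV K ε B = 0 := by simp [hB, planeB, planeVarsZ, killV]
  have hkZ : killV K ε Z = 0 := by simp [hZ, planeZ, planeVarsZ, killV]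
  have hdA : A = dot (pv X) ![X (ia 2 0), X (ia 2 1), 0] := by
    simp [hA, planeA, planeVarsZ, dot]; ring
  have hdB : B = dot (pv X) ![X (ia 2 0) * X (ia 0 0) + X (ia 2 1) * X (ia 1 0),
      X (ia 2 0) * X (ia 0 1) + X (ia 2 1) * X (ia 1 1), 0] := by
    simp [hB, planeB, planeVarsZ, dot]; ring
  have hdZ : Z = dot (pv X) ![X (iv 0) * X (ia 1 0) + X (iv 1) * X (ia 1 1),
      - (X (iv 0) * X (ia 0 0) + X (iv 1) * X (ia 0 1)), 0] := by
    simp [hZ, planeZ, planeVarsZ, dot]; ring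
  have hlin : ∀ j : Fin 3, j ≠ 2 → killV K ε p₁ * killV K ε (pderiv (iv j) A) +
      killV K ε p₂ * killV K ε (pderiv (iv j) B) = 0 := by
    intro j hj
    have h1 := killV_pderiv_eq_zero f hf j
    have h2 : killV K ε (pderiv (iv j) Z) = 0 := by
      rw [hdZ, killV_pderiv_dot]
      fin_cases j <;> simp [killV]
    rw [hg] at h1
    simp only [map_add, killV_pderiv_mul, hkA, hkB, hkZ, h2, killV_X_iv] at h1
    have h3 : pderiv (iv j) (X (iv 2) : MvPolynomial (Coord ε) K) = 0 :=
      pderiv_X_of_ne (by simpa [eq_comm] using hj)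
    rw [h3, map_zero] at h1
    linear_combination h1
  have hz : killV K ε p₁ * A + killV K ε p₂ * B = 0 := by
    have h0 := hlin 0 (by decide)
    have h1 := hlin 1 (by decide)
    rw [hdA, hdB] at h0 h1
    simp only [killV_pderiv_dot] at h0 h1
    simp [killV_X_ia] at h0 h1
    rw [hdA, hdB]
    simp [dot, pv]
    linear_combination X (iv 0) * h0 + X (iv 1) * h1
  obtain ⟨h, hh⟩ := exists_eq_killV_add p₁
  obtain ⟨k, hk'⟩ := exists_eq_killV_add p₂
  have hf' : f = dot (pv X) h * A + dot (pv X) k * B + p₃ * Z + X (iv 2) * g := by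
    rw [hg]
    nth_rewrite 1 [hh]
    nth_rewrite 1 [hk']
    linear_combination hz
  set J := Ideal.span (Set.range (formZ (X : Coord ε → MvPolynomial (Coord ε) K))) ⊔
    Ideal.span {(X (iv 2) : MvPolynomial (Coord ε) K)} with hJ
  have hmem : ∀ l, formZ (X : Coord ε → MvPolynomial (Coord ε) K) l ∈ J :=
    fun l => Ideal.mem_sup_left (Ideal.subset_span ⟨l, rfl⟩)
  have hv : (X (iv 2) : MvPolynomial (Coord ε) K) ∈ J :=
    Ideal.mem_sup_right (Ideal.mem_span_singleton_self _)
  have hZJ : Z ∈ J := by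
    have : Z = formZ X 2 - (X (iv 0) * X (ia 1 2) - X (iv 1) * X (ia 0 2)) * X (iv 2) := by
      rw [hdZ]; simp [formZ, dot, mv]; ring
    rw [this]
    exact J.sub_mem (hmem 2) (J.mul_mem_left _ hv)
  have hA0 : X (iv 0) * A ∈ J := by
    have : X (iv 0) * A = - formZ X 1 +
        (mv (pa X) (pv X) 0 - X (iv 0) * X (ia 2 2)) * X (iv 2) := by
      rw [hdA]; simp [formZ, dot, mv]; ring
    rw [this]
    exact J.add_mem (J.neg_mem (hmem 1)) (J.mul_mem_left _ hv)
  have hA1 : X (iv 1) * A ∈ J := by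
    have : X (iv 1) * A = formZ X 0 +
        (mv (pa X) (pv X) 1 - X (iv 1) * X (ia 2 2)) * X (iv 2) := by
      rw [hdA]; simp [formZ, dot, mv]; ring
    rw [this]
    exact J.add_mem (hmem 0) (J.mul_mem_left _ hv)
  have hB0 : X (iv 0) * B ∈ J := by
    have : X (iv 0) * B = X (ia 0 0) * (X (iv 0) * A) + X (ia 0 1) * (X (iv 1) * A) +
        X (ia 2 1) * Z := by
      rw [hdA, hdB, hdZ]; simp [dot]; ring
    rw [this]
    exact J.add_mem (J.add_mem (J.mul_mem_left _ hA0) (J.mul_mem_left _ hA1))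
      (J.mul_mem_left _ hZJ)
  have hB1 : X (iv 1) * B ∈ J := by
    have : X (iv 1) * B = X (ia 1 0) * (X (iv 0) * A) + X (ia 1 1) * (X (iv 1) * A) -
        X (ia 2 0) * Z := by
      rw [hdA, hdB, hdZ]; simp [dot]; ring
    rw [this]
    exact J.sub_mem (J.add_mem (J.mul_mem_left _ hA0) (J.mul_mem_left _ hA1))
      (J.mul_mem_left _ hZJ)
  have hfJ : f ∈ J := by
    have : f = h 0 * (X (iv 0) * A) + h 1 * (X (iv 1) * A) + k 0 * (X (iv 0) * B) +
        k 1 * (X (iv 1) * B) + p₃ * Z + (h 2 * A + k 2 * B + g) * X (iv 2) := by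
      rw [hf']; simp only [dot, pv]; ring
    rw [this]
    exact J.add_mem (J.add_mem (J.add_mem (J.add_mem (J.add_mem (J.mul_mem_left _ hA0)
      (J.mul_mem_left _ hA1)) (J.mul_mem_left _ hB0)) (J.mul_mem_left _ hB1))
      (J.mul_mem_left _ hZJ)) (J.mul_mem_left _ hv)
  obtain ⟨q, hq, r, hr, hqr⟩ := Submodule.mem_sup.1 hfJ
  obtain ⟨g', rfl⟩ := Ideal.mem_span_singleton.1 hr
  exact ⟨g', by rwa [← hqr, add_sub_cancel_right]⟩

end EigenIdeal
section EigenIdealRadical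

open MvPolynomial

variable {K : Type*} [Field K] {ε : Type*}

lemma formZ_eq_zero_iff_of_ne {p : Coord ε → K} {j : Fin 3} (hj : p (iv j) ≠ 0) :
    (∀ l, formZ p l = 0) ↔ ∃ lam : K, ∀ i, mv (pa p) (pv p) i = lam * p (iv i) := by
  refine ⟨fun h => exists_smul_of_crs_eq_zero (fun h0 => hj (congrFun h0 j)) h, ?_⟩
  rintro ⟨lam, h⟩ l
  exact crs_eq_zero_of_smul lam h l

/-- The weight counting the coordinates of `v`. -/
def weightV (ε : Type*) : Coord ε → ℕ := Sum.elim (Sum.elim 0 1) 0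

/-- The weight counting the coordinates of `w`. -/
def weightW (ε : Type*) : Coord ε → ℕ := Sum.elim (Sum.elim 1 0) 0

section Homogeneous

variable {σ : Type*} {W : σ → ℕ}

lemma dot_homogeneous {m n : ℕ} {x y : Fin 3 → MvPolynomial σ K}
    (hx : ∀ i, IsWeightedHomogeneous W (x i) m) (hy : ∀ i, IsWeightedHomogeneous W (y i) n) :
    IsWeightedHomogeneous W (dot x y) (m + n) :=
  (((hx 0).mul (hy 0)).add ((hx 1).mul (hy 1))).add ((hx 2).mul (hy 2))

lemma sub_homogeneous {m : ℕ} {x y : MvPolynomial σ K} (hx : IsWeightedHomogeneous W x m)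
    (hy : IsWeightedHomogeneous W y m) : IsWeightedHomogeneous W (x - y) m :=
  Submodule.sub_mem (weightedHomogeneousSubmodule K W m) hx hy

lemma crs_homogeneous {m n : ℕ} {x y : Fin 3 → MvPolynomial σ K}
    (hx : ∀ i, IsWeightedHomogeneous W (x i) m) (hy : ∀ i, IsWeightedHomogeneous W (y i) n)
    (l : Fin 3) : IsWeightedHomogeneous W (crs x y l) (m + n) := by
  fin_cases l
  · exact sub_homogeneous ((hx 1).mul (hy 2)) ((hx 2).mul (hy 1))
  · exact sub_homogeneous ((hx 2).mul (hy 0)) ((hx 0).mul (hy 2))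
  · exact sub_homogeneous ((hx 0).mul (hy 1)) ((hx 1).mul (hy 0))

lemma mv_homogeneous {m n : ℕ} {a : Fin 3 → Fin 3 → MvPolynomial σ K}
    {x : Fin 3 → MvPolynomial σ K} (ha : ∀ i j, IsWeightedHomogeneous W (a i j) m)
    (hx : ∀ i, IsWeightedHomogeneous W (x i) n) (i : Fin 3) :
    IsWeightedHomogeneous W (mv a x i) (m + n) := dot_homogeneous (ha i) hx

lemma formZ_homogeneous {W : Coord ε → ℕ} {m n : ℕ} (hv : ∀ i, W (iv i) = m)
    (ha : ∀ i j, W (ia i j) = n) (l : Fin 3) :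
    IsWeightedHomogeneous W (formZ (X : Coord ε → MvPolynomial (Coord ε) K) l) (m + (n + m)) := by
  have h1 : ∀ i, IsWeightedHomogeneous W (X (iv i) : MvPolynomial (Coord ε) K) m :=
    fun i => hv i ▸ isWeightedHomogeneous_X K W _
  have h2 : ∀ i j, IsWeightedHomogeneous W (X (ia i j) : MvPolynomial (Coord ε) K) n :=
    fun i j => ha i j ▸ isWeightedHomogeneous_X K W _
  exact crs_homogeneous h1 (mv_homogeneous h2 h1) l

lemma formF_homogeneous {W : Coord ε → ℕ} {m n : ℕ} (hw : ∀ i, W (iw i) = m)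
    (hv : ∀ i, W (iv i) = n) (ha : ∀ i j, W (ia i j) = 0) (k : Fin 3) :
    IsWeightedHomogeneous W (formF (X : Coord ε → MvPolynomial (Coord ε) K) k) (m + n) := by
  have h0 : ∀ i, IsWeightedHomogeneous W (X (iw i) : MvPolynomial (Coord ε) K) m :=
    fun i => hw i ▸ isWeightedHomogeneous_X K W _
  have h1 : ∀ i, IsWeightedHomogeneous W (X (iv i) : MvPolynomial (Coord ε) K) n :=
    fun i => hv i ▸ isWeightedHomogeneous_X K W _
  have h2 : ∀ i j, IsWeightedHomogeneous W (X (ia i j) : MvPolynomial (Coord ε) K) 0 :=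
    fun i j => ha i j ▸ isWeightedHomogeneous_X K W _
  have h3 := mv_homogeneous h2 h1
  have h4 := mv_homogeneous h2 h3
  simp only [zero_add] at h3 h4
  fin_cases k
  · exact dot_homogeneous h0 h1
  · exact dot_homogeneous h0 h3
  · exact dot_homogeneous h0 h4

end Homogeneous

/-- The ideal of `v × αv` is radical. -/
lemma mem_span_formZ [IsAlgClosed K] [Finite ε] (f : MvPolynomial (Coord ε) K)
    (hf : ∀ p : Coord ε → K, (∀ l, formZ p l = 0) → eval p f = 0) :
    f ∈ Ideal.span (Set.range (formZ (X : Coord ε → MvPolynomial (Coord ε) K))) := by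
  refine mem_span_of_forall_step (weightV ε) (iv 2) rfl _ ?_
    {f | ∀ p : Coord ε → K, (∀ l, formZ p l = 0) → eval p f = 0} ?_ f hf
  · rintro _ ⟨l, rfl⟩
    exact ⟨_, formZ_homogeneous (m := 1) (n := 0) (fun _ => rfl) (fun _ _ => rfl) l⟩
  intro f hf
  obtain ⟨g, hg⟩ := mem_formZ_slice f hf
  refine ⟨g, ?_, hg⟩
  have h1 : ∀ p : Coord ε → K, (∀ l, formZ p l = 0) → p (iv 2) * eval p g = 0 := by
    intro p hp
    have h2 : Ideal.span (Set.range (formZ (X : Coord ε → MvPolynomial (Coord ε) K))) ≤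
        RingHom.ker (eval p) := by
      rw [Ideal.span_le]
      rintro _ ⟨l, rfl⟩
      exact (eval_formZ p l).trans (hp l)
    have h3 := h2 hg
    rw [RingHom.mem_ker, map_sub, hf p hp, map_mul, eval_X, zero_sub, neg_eq_zero] at h3
    exact h3
  have h2 : ∀ p : Coord ε → K, ∀ j, p (iv j) ≠ 0 → (∀ l, formZ p l = 0) → eval p g = 0 := by
    intro p j hj hp
    by_cases hv : p (iv 2) = 0
    · have hj2 : j ≠ 2 := fun h => hj (h ▸ hv)
      obtain ⟨lam, hlam⟩ := (formZ_eq_zero_iff_of_ne hj).1 hp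
      refine eval_eq_zero_of_eigencurve p lam hlam j hj (Pi.single 2 1) (by simp [hj2])
        (fun i => Polynomial.C (p (iw i))) (by simp) (iv 2) (Or.inr ⟨2, rfl, by simp⟩) g
        fun t q _ _ hq => h1 q fun l => crs_eq_zero_of_smul lam hq l
    · exact (mul_eq_zero.1 (h1 p hp)).resolve_left hv
  intro p hp
  by_cases hv : ∃ j, p (iv j) ≠ 0
  · obtain ⟨j, hj⟩ := hv
    exact h2 p j hj hp
  push Not at hv
  obtain ⟨n, hn, lam, hlam⟩ := exists_eigenvector (pa p)
  obtain ⟨k, hk⟩ := Function.ne_iff.1 hn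
  rw [Pi.zero_apply] at hk
  refine eval_eq_zero_of_curve_through
    (Sum.elim (Sum.elim (fun i => Polynomial.C (p (iw i)))
      fun i => Polynomial.C (n i) * Polynomial.X)
      fun e => Polynomial.C (p (Sum.inr e))) _ ?_ (iv k) ?_ _ ?_
  · rintro ((i | i) | e) <;> simp [hv]
  · simpa using hk
  · intro t q hq
    have hqv : ∀ i, q (iv i) = n i * t := fun i => by rw [hq]; simp
    have hqa : ∀ i j, q (ia i j) = pa p i j := fun i j => by rw [hq]; simp
    by_cases hq0 : q (iv k) = 0
    · rw [hq0, zero_mul]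
    · rw [h2 q k hq0 (formZ_eq_zero_of_smul (crs_eq_zero_of_smul lam hlam) t hqa hqv), mul_zero]

end EigenIdealRadical
section IncidenceIdeal

open MvPolynomial

variable {K : Type*} [Field K] {ε : Type*}

/-- Points where `w αᵏ v = 0` and `v × αv = 0`. -/
def Incident (p : Coord ε → K) : Prop := (∀ k, formF p k = 0) ∧ ∀ l, formZ p l = 0

/-- The equations of the incidence variety. -/
noncomputable def incidenceGens (K : Type*) [Field K] (ε : Type*) :
    Set (MvPolynomial (Coord ε) K) := Set.range (formF X) ∪ Set.range (formZ X)

lemma incident_of_eigen {p : Coord ε → K} {lam : K}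
    (h : ∀ i, mv (pa p) (pv p) i = lam * p (iv i)) (hw : dot (pw p) (pv p) = 0) :
    Incident p := by
  have h1 : mv (pa p) (pv p) = fun i => lam * pv p i := by
    funext i; exact h i
  have h2 : mv (pa p) (mv (pa p) (pv p)) = fun i => lam * (lam * pv p i) := by
    have : mv (pa p) (fun i => lam * pv p i) = fun i => lam * mv (pa p) (pv p) i := by
      funext i; simp only [mv, dot]; ring
    rw [h1, this, h1]
  refine ⟨fun k => ?_, fun l => crs_eq_zero_of_smul lam h l⟩
  unfold formF
  rw [h2, h1]
  simp only [dot] at hw ⊢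
  fin_cases k <;> simp only [Fin.zero_eta, Fin.mk_one, Fin.reduceFinMk, Fin.isValue,
    Matrix.cons_val]
  · exact hw
  · linear_combination lam * hw
  · linear_combination lam ^ 2 * hw

lemma incident_of_pv_eq_zero {p : Coord ε → K} (h : ∀ i, p (iv i) = 0) : Incident p :=
  incident_of_eigen (lam := 0) (fun i => by simp [mv, dot, h]) (by simp [dot, h])

lemma Incident.dot_eq_zero {p : Coord ε → K} (h : Incident p) : dot (pw p) (pv p) = 0 := h.1 0

lemma Incident.exists_eigen {p : Coord ε → K} (h : Incident p) {j : Fin 3} (hj : p (iv j) ≠ 0) :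
    ∃ lam : K, ∀ i, mv (pa p) (pv p) i = lam * p (iv i) := (formZ_eq_zero_iff_of_ne hj).1 h.2

lemma span_incidenceGens_le_ker {p : Coord ε → K} (h : Incident p) :
    Ideal.span (incidenceGens K ε) ≤ RingHom.ker (eval p) := by
  rw [Ideal.span_le]
  rintro _ (⟨k, rfl⟩ | ⟨l, rfl⟩)
  · exact (eval_formF p k).trans (h.1 k)
  · exact (eval_formZ p l).trans (h.2 l)

lemma formF_eq_zero_of_pw_eq_zero {p : Coord ε → K} (h : ∀ i, p (iw i) = 0) (k : Fin 3) :
    formF p k = 0 := by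
  have e : pw p = 0 := by
    funext i
    exact h i
  unfold formF
  rw [e]
  fin_cases k <;> simp [dot]

lemma formZ_congr {p q : Coord ε → K} (hv : ∀ i, q (iv i) = p (iv i))
    (ha : ∀ i j, q (ia i j) = p (ia i j)) (l : Fin 3) : formZ q l = formZ p l := by
  have e1 : pv q = pv p := by
    funext i
    exact hv i
  have e2 : pa q = pa p := by
    funext i j
    exact ha i j
  unfold formZ
  rw [e1, e2]

/-- The variables of the planar problem on the slice `w₁ = w₂ = 0`. -/
def planeVarsW (ε : Type*) : Fin 8 → Coord ε :=
  ![ia 0 1, ia 0 2, iv 1, iv 2, ia 1 1, ia 1 2, ia 2 1, ia 2 2]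

lemma planeVarsW_injective : Function.Injective (planeVarsW ε) := by
  intro i j h
  fin_cases i <;> fin_cases j <;> simp [planeVarsW] at h ⊢

lemma incident_plane {p : Coord ε → K} (h1 : p (iw 1) = 0) (h2 : p (iw 2) = 0)
    (hv : p (iv 0) = 0) (hA : planeA (fun i => p (planeVarsW ε i)) = 0)
    (hB : planeB (fun i => p (planeVarsW ε i)) = 0)
    (hZ : planeZ (fun i => p (planeVarsW ε i)) = 0) : Incident p := by
  simp [planeA, planeB, planeZ, planeVarsW] at hA hB hZ
  have e0 : mv (pa p) (pv p) 0 = 0 := by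
    simp only [mv, dot, pa, pv, hv]; linear_combination hA
  constructor
  · intro k
    fin_cases k
    · simp [formF, dot, h1, h2, hv]
    · simp [formF, dot, h1, h2, e0]
    · have : mv (pa p) (mv (pa p) (pv p)) 0 = 0 := by
        have e : mv (pa p) (mv (pa p) (pv p)) 0 = p (ia 0 0) * mv (pa p) (pv p) 0 +
          p (ia 0 1) * mv (pa p) (pv p) 1 + p (ia 0 2) * mv (pa p) (pv p) 2 := rfl
        rw [e, e0]
        simp only [mv, dot, pa, pv, hv]; linear_combination hB
      simp [formF, dot, h1, h2, this]
  · intro l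
    have e1 : mv (pa p) (pv p) 1 = p (ia 1 1) * p (iv 1) + p (ia 1 2) * p (iv 2) := by
      simp [mv, dot, hv]
    have e2 : mv (pa p) (pv p) 2 = p (ia 2 1) * p (iv 1) + p (ia 2 2) * p (iv 2) := by
      simp [mv, dot, hv]
    fin_cases l <;> simp [formZ, e0, e1, e2, hv]
    linear_combination hZ

/-- Elements vanishing on the slice `w₁ = w₂ = 0`. -/
lemma mem_incidence_slice [IsAlgClosed K] [Finite ε] (f : MvPolynomial (Coord ε) K)
    (hf : ∀ p : Coord ε → K, Incident p → p (iw 1) = 0 → p (iw 2) = 0 → eval p f = 0) :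
    f ∈ Ideal.span (incidenceGens K ε) ⊔ Ideal.span {X (iw 1), X (iw 2)} := by
  classical
  set J := Ideal.span (incidenceGens K ε) ⊔
    Ideal.span {X (iw 1), (X (iw 2) : MvPolynomial (Coord ε) K)} with hJ
  have hF : ∀ k, formF (X : Coord ε → MvPolynomial (Coord ε) K) k ∈ J :=
    fun k => Ideal.mem_sup_left (Ideal.subset_span (Or.inl ⟨k, rfl⟩))
  have hZ : ∀ l, formZ (X : Coord ε → MvPolynomial (Coord ε) K) l ∈ J :=
    fun l => Ideal.mem_sup_left (Ideal.subset_span (Or.inr ⟨l, rfl⟩))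
  have hw1 : (X (iw 1) : MvPolynomial (Coord ε) K) ∈ J :=
    Ideal.mem_sup_right (Ideal.subset_span (by simp))
  have hw2 : (X (iw 2) : MvPolynomial (Coord ε) K) ∈ J :=
    Ideal.mem_sup_right (Ideal.subset_span (by simp))
  obtain ⟨g₁, e1⟩ := exists_eq_kill_add (iw 1) f
  obtain ⟨g₂, e2⟩ := exists_eq_kill_add (iw 2) (kill K (iw 1) f)
  set f' := kill K (iw 2) (kill K (iw 1) f) with hf'
  obtain ⟨f₁, e3⟩ := exists_eq_kill_add (iw 0) f'
  have hker : ∀ p : Coord ε → K, Incident p → p (iw 1) = 0 → p (iw 2) = 0 → eval p f' = 0 := by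
    intro p hp h1 h2
    rw [hf', eval_kill, eval_kill, Function.update_eq_self_iff.2 (by simp [h1]),
      Function.update_eq_self_iff.2 h2.symm]
    exact hf p hp h1 h2
  have hspan : kill K (iw 0) f' ∈ Ideal.span (Set.range (formZ X)) := by
    refine mem_span_formZ _ fun p hp => ?_
    have : kill K (iw 0) f' = aeval (Sum.elim (Sum.elim 0 fun i => X (iv i))
        fun e => X (Sum.inr e)) f := by
      rw [hf', kill, kill, kill, ← AlgHom.comp_apply, ← AlgHom.comp_apply]
      congr 1
      ext1 i
      rcases i with (i | i) | i
      · fin_cases i <;> simp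
      · simp
      · simp
    rw [this, eval_aeval]
    refine hf _ ⟨formF_eq_zero_of_pw_eq_zero fun i => by simp, fun l => ?_⟩ (by simp) (by simp)
    rw [← hp l]
    exact formZ_congr (fun i => by simp) (fun i j => by simp) l
  have hspan' : kill K (iw 0) f' ∈ J :=
    (Ideal.span_mono Set.subset_union_right).trans le_sup_left hspan
  have hvan : ∀ p : Coord ε → K, Incident p → p (iw 1) = 0 → p (iw 2) = 0 →
      p (iw 0) * eval p f₁ = 0 := by
    intro p hp h1 h2
    have h3 := hker p hp h1 h2
    have h4 : Ideal.span (Set.range (formZ (X : Coord ε → MvPolynomial (Coord ε) K))) ≤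
        RingHom.ker (eval p) := by
      rw [Ideal.span_le]
      rintro _ ⟨l, rfl⟩
      exact (eval_formZ p l).trans (hp.2 l)
    have h5 : eval p (kill K (iw 0) f') = 0 := h4 hspan
    rw [e3, map_add, h5, map_mul, eval_X, zero_add] at h3
    exact h3
  obtain ⟨k₁, c1⟩ := exists_eq_kill_add (iw 1) f₁
  obtain ⟨k₂, c2⟩ := exists_eq_kill_add (iw 2) (kill K (iw 1) f₁)
  obtain ⟨k₃, c3⟩ := exists_eq_kill_add (iv 0) (kill K (iw 2) (kill K (iw 1) f₁))
  have hpl : kill K (iv 0) (kill K (iw 2) (kill K (iw 1) f₁)) ∈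
      Ideal.span (planeGens K (planeVarsW ε)) := by
    refine plane_radical planeVarsW_injective _ fun p hA hB hZ' => ?_
    simp only [eval_kill]
    refine eval_eq_zero_of_free (iw 0) _ _ fun q hq => ?_
    have hq' : ∀ i, i ≠ iw 0 → i ≠ iw 1 → i ≠ iw 2 → i ≠ iv 0 → q i = p i := by
      intro i h0 h1 h2 h3
      rw [hq i h0]
      simp [h1, h2, h3]
    have h1 : q (iw 1) = 0 := by rw [hq _ (by simp)]; simp
    have h2 : q (iw 2) = 0 := by rw [hq _ (by simp)]; simp
    have hpq : (fun i => q (planeVarsW ε i)) = fun i => p (planeVarsW ε i) := by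
      funext i
      apply hq' <;> fin_cases i <;> simp [planeVarsW]
    refine hvan q (incident_plane h1 h2 ?_ ?_ ?_ ?_) h1 h2
    · rw [hq _ (by simp)]; simp
    · rw [hpq, hA]
    · rw [hpq, hB]
    · rw [hpq, hZ']
  have hv0 : X (iw 0) * X (iv 0) ∈ J := by
    have : X (iw 0) * X (iv 0) = formF X 0 - X (iv 1) * X (iw 1) -
        X (iv 2) * (X (iw 2) : MvPolynomial (Coord ε) K) := by
      simp [formF, dot]; ring
    rw [this]
    exact J.sub_mem (J.sub_mem (hF 0) (J.mul_mem_left _ hw1)) (J.mul_mem_left _ hw2)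
  set a : Fin 3 → Fin 3 → MvPolynomial (Coord ε) K := pa X with ha
  set v : Fin 3 → MvPolynomial (Coord ε) K := pv X with hv
  have hav : X (iw 0) * mv a v 0 ∈ J := by
    have : X (iw 0) * mv a v 0 = formF X 1 - mv a v 1 * X (iw 1) - mv a v 2 * X (iw 2) := by
      simp [formF, dot]; ring
    rw [this]
    exact J.sub_mem (J.sub_mem (hF 1) (J.mul_mem_left _ hw1)) (J.mul_mem_left _ hw2)
  have haav : X (iw 0) * mv a (mv a v) 0 ∈ J := by
    have : X (iw 0) * mv a (mv a v) 0 =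
        formF X 2 - mv a (mv a v) 1 * X (iw 1) - mv a (mv a v) 2 * X (iw 2) := by
      simp [formF, dot]; ring
    rw [this]
    exact J.sub_mem (J.sub_mem (hF 2) (J.mul_mem_left _ hw1)) (J.mul_mem_left _ hw2)
  have hA : X (iw 0) * planeA (fun i => X (planeVarsW ε i)) ∈ J := by
    have : X (iw 0) * planeA (fun i => X (planeVarsW ε i)) =
        X (iw 0) * mv a v 0 - a 0 0 * (X (iw 0) * X (iv 0)) := by
      simp [planeA, planeVarsW, mv, dot, ha, hv]; ring
    rw [this]
    exact J.sub_mem hav (J.mul_mem_left _ hv0)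
  have hB : X (iw 0) * planeB (fun i => X (planeVarsW ε i)) ∈ J := by
    have : X (iw 0) * planeB (fun i => X (planeVarsW ε i)) =
        X (iw 0) * mv a (mv a v) 0 - a 0 0 * (X (iw 0) * mv a v 0) -
        (a 0 1 * a 1 0 + a 0 2 * a 2 0) * (X (iw 0) * X (iv 0)) := by
      simp [planeB, planeVarsW, mv, dot, ha, hv]; ring
    rw [this]
    exact J.sub_mem (J.sub_mem haav (J.mul_mem_left _ hav)) (J.mul_mem_left _ hv0)
  have hZp : X (iw 0) * planeZ (fun i => X (planeVarsW ε i)) ∈ J := by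
    have : X (iw 0) * planeZ (fun i => X (planeVarsW ε i)) =
        X (iw 0) * formZ X 0 - (v 1 * a 2 0 - v 2 * a 1 0) * (X (iw 0) * X (iv 0)) := by
      simp [planeZ, planeVarsW, formZ, mv, dot, ha, hv]; ring
    rw [this]
    exact J.sub_mem (J.mul_mem_left _ (hZ 0)) (J.mul_mem_left _ hv0)
  obtain ⟨p₁, r, hr, d1⟩ := Ideal.mem_span_insert.1 hpl
  obtain ⟨p₂, p₃, rfl⟩ := Ideal.mem_span_pair.1 hr
  set A : MvPolynomial (Coord ε) K := planeA fun i => X (planeVarsW ε i)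
  set B : MvPolynomial (Coord ε) K := planeB fun i => X (planeVarsW ε i)
  set Z : MvPolynomial (Coord ε) K := planeZ fun i => X (planeVarsW ε i)
  have : f = kill K (iw 0) f' + p₁ * (X (iw 0) * A) + p₂ * (X (iw 0) * B) +
      p₃ * (X (iw 0) * Z) + k₃ * (X (iw 0) * X (iv 0)) + (g₁ + X (iw 0) * k₁) * X (iw 1) +
      (g₂ + X (iw 0) * k₂) * X (iw 2) := by
    linear_combination e1 + e2 + e3 + X (iw 0) * (c1 + c2 + c3 + d1)
  rw [this]
  exact J.add_mem (J.add_mem (J.add_mem (J.add_mem (J.add_mem (J.add_mem hspan'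
    (J.mul_mem_left _ hA)) (J.mul_mem_left _ hB)) (J.mul_mem_left _ hZp))
    (J.mul_mem_left _ hv0)) (J.mul_mem_left _ hw1)) (J.mul_mem_left _ hw2)

end IncidenceIdeal
section IncidenceRadical

open MvPolynomial

variable {K : Type*} [Field K] {ε : Type*}

/-- Deform the covector linearly. -/
lemma eval_eq_zero_of_covector_line [Infinite K] (m : Fin 3) (p : Coord ε → K) (w' : Fin 3 → K)
    (hm : w' m ≠ 0) (g : MvPolynomial (Coord ε) K)
    (h : ∀ (t : K) (q : Coord ε → K), (∀ i, q (iw i) = p (iw i) + t * w' i) →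
      (∀ i, q (iv i) = p (iv i)) → (∀ i j, q (ia i j) = p (ia i j)) → q (iw m) * eval q g = 0) :
    eval p g = 0 := by
  refine eval_eq_zero_of_curve_through
    (Sum.elim (Sum.elim (fun i => Polynomial.C (p (iw i)) + Polynomial.C (w' i) * Polynomial.X)
      fun i => Polynomial.C (p (iv i)))
      fun e => Polynomial.C (p (Sum.inr e))) _ ?_ (iw m) ?_ _ ?_
  · rintro ((i | i) | e) <;> simp
  · intro h0
    have := congrArg (fun f => Polynomial.coeff f 1) h0
    simp [Polynomial.coeff_C] at this
    exact hm this
  · intro t q hq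
    refine h t q (fun i => ?_) (fun i => ?_) fun i j => ?_
    · rw [hq]; simp; ring
    · rw [hq]; simp
    · rw [hq]; simp

lemma incident_of_eigen' {p q : Coord ε → K} {lam : K}
    (h : ∀ i, mv (pa p) (pv p) i = lam * p (iv i)) (hv : ∀ i, q (iv i) = p (iv i))
    (ha : ∀ i j, q (ia i j) = p (ia i j))
    (hw : q (iw 0) * p (iv 0) + q (iw 1) * p (iv 1) + q (iw 2) * p (iv 2) = 0) : Incident q := by
  have e1 : pv q = pv p := by
    funext i
    exact hv i
  have e2 : pa q = pa p := by
    funext i j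
    exact ha i j
  refine incident_of_eigen (lam := lam) (fun i => ?_) ?_
  · rw [e1, e2, h, hv]
  · rw [e1]; exact hw

lemma incidenceGens_homogeneous (s : MvPolynomial (Coord ε) K) (hs : s ∈ incidenceGens K ε) :
    ∃ n, IsWeightedHomogeneous (weightW ε) s n := by
  rcases hs with ⟨k, rfl⟩ | ⟨l, rfl⟩
  · exact ⟨_, formF_homogeneous (m := 1) (n := 0) (fun _ => rfl) (fun _ => rfl)
      (fun _ _ => rfl) k⟩
  · exact ⟨_, formZ_homogeneous (m := 0) (n := 0) (fun _ => rfl) (fun _ _ => rfl) l⟩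

lemma incidence_dense_one [Infinite K] (g : MvPolynomial (Coord ε) K)
    (h : ∀ p : Coord ε → K, Incident p → p (iw 2) = 0 → p (iw 1) * eval p g = 0)
    (p : Coord ε → K) (hp : Incident p) (hw2 : p (iw 2) = 0) : eval p g = 0 := by
  have hdot : p (iw 0) * p (iv 0) + p (iw 1) * p (iv 1) + p (iw 2) * p (iv 2) = 0 :=
    hp.dot_eq_zero
  by_cases h0 : p (iv 0) = 0
  · by_cases h1 : p (iv 1) = 0
    · refine eval_eq_zero_of_covector_line 1 p (Pi.single 1 1) (by simp) g
        fun t q hqw hqv hqa => h q ?_ (by rw [hqw]; simp [hw2])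
      by_cases h2 : p (iv 2) = 0
      · refine incident_of_pv_eq_zero fun i => ?_
        rw [hqv]
        fin_cases i
        exacts [h0, h1, h2]
      · obtain ⟨lam, hlam⟩ := hp.exists_eigen h2
        refine incident_of_eigen' hlam hqv hqa ?_
        simp only [hqw, h0, h1]
        simp [hw2]
    · obtain ⟨lam, hlam⟩ := hp.exists_eigen h1
      have hw1 : p (iw 1) = 0 := by simpa [h0, hw2, h1] using hdot
      refine eval_eq_zero_of_eigencurve p lam hlam 1 h1 (Pi.single 0 1) (by simp)
        ![Polynomial.C (p (iw 0)) + Polynomial.X, -((Polynomial.C (p (iw 0)) + Polynomial.X) *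
          Polynomial.X * Polynomial.C (p (iv 1))⁻¹), 0] ?_ (iw 1) (Or.inl ⟨1, rfl, ?_⟩) g
        fun t q hqw hqv hq => h q (incident_of_eigen hq ?_) (by rw [hqw]; simp)
      · intro i; fin_cases i <;> simp [hw1, hw2]
      · simp only [Matrix.cons_val, neg_ne_zero]
        refine mul_ne_zero (mul_ne_zero ?_ Polynomial.X_ne_zero) (by simpa using h1)
        rw [add_comm]; exact Polynomial.X_add_C_ne_zero _
      · simp only [dot, pw, pv, hqw, hqv]
        simp [h0]
        field_simp
        ring
  · obtain ⟨lam, hlam⟩ := hp.exists_eigen h0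
    refine eval_eq_zero_of_covector_line 1 p ![-p (iv 1), p (iv 0), 0] (by simpa using h0) g
      fun t q hqw hqv hqa => h q (incident_of_eigen' hlam hqv hqa ?_) (by rw [hqw]; simp [hw2])
    simp only [hqw]
    simp
    linear_combination hdot

lemma incidence_dense_two [Infinite K] (g : MvPolynomial (Coord ε) K)
    (h : ∀ p : Coord ε → K, Incident p → p (iw 2) * eval p g = 0)
    (p : Coord ε → K) (hp : Incident p) : eval p g = 0 := by
  have hdot : p (iw 0) * p (iv 0) + p (iw 1) * p (iv 1) + p (iw 2) * p (iv 2) = 0 :=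
    hp.dot_eq_zero
  by_cases h0 : p (iv 0) = 0
  · by_cases h1 : p (iv 1) = 0
    · by_cases h2 : p (iv 2) = 0
      · refine eval_eq_zero_of_covector_line 2 p (Pi.single 2 1) (by simp) g
          fun t q hqw hqv hqa => h q (incident_of_pv_eq_zero fun i => ?_)
        rw [hqv]
        fin_cases i
        exacts [h0, h1, h2]
      · obtain ⟨lam, hlam⟩ := hp.exists_eigen h2
        have hw2 : p (iw 2) = 0 := by simpa [h0, h1, h2] using hdot
        refine eval_eq_zero_of_eigencurve p lam hlam 2 h2 (Pi.single 0 1) (by simp)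
          ![Polynomial.C (p (iw 0)) + Polynomial.X, Polynomial.C (p (iw 1)),
            -((Polynomial.C (p (iw 0)) + Polynomial.X) *
            Polynomial.X * Polynomial.C (p (iv 2))⁻¹)] ?_ (iw 2) (Or.inl ⟨2, rfl, ?_⟩) g
          fun t q hqw hqv hq => h q (incident_of_eigen hq ?_)
        · intro i; fin_cases i <;> simp [hw2]
        · simp only [Matrix.cons_val, neg_ne_zero]
          refine mul_ne_zero (mul_ne_zero ?_ Polynomial.X_ne_zero) (by simpa using h2)
          rw [add_comm]; exact Polynomial.X_add_C_ne_zero _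
        · simp only [dot, pw, pv, hqw, hqv]
          simp [h0, h1]
          field_simp
          ring
    · obtain ⟨lam, hlam⟩ := hp.exists_eigen h1
      refine eval_eq_zero_of_covector_line 2 p ![0, -p (iv 2), p (iv 1)] (by simpa using h1) g
        fun t q hqw hqv hqa => h q (incident_of_eigen' hlam hqv hqa ?_)
      simp only [hqw]
      simp
      linear_combination hdot
  · obtain ⟨lam, hlam⟩ := hp.exists_eigen h0
    refine eval_eq_zero_of_covector_line 2 p ![-p (iv 2), 0, p (iv 0)] (by simpa using h0) g
      fun t q hqw hqv hqa => h q (incident_of_eigen' hlam hqv hqa ?_)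
    simp only [hqw]
    simp
    linear_combination hdot

lemma mem_incidence_half [IsAlgClosed K] [Finite ε] (f : MvPolynomial (Coord ε) K)
    (hf : ∀ p : Coord ε → K, Incident p → p (iw 2) = 0 → eval p f = 0) :
    f ∈ Ideal.span (incidenceGens K ε ∪ {X (iw 2)}) := by
  refine mem_span_of_forall_step (weightW ε) (iw 1) rfl _ ?_
    {f | ∀ p : Coord ε → K, Incident p → p (iw 2) = 0 → eval p f = 0} ?_ f hf
  · rintro s (hs | rfl)
    · exact incidenceGens_homogeneous s hs
    · exact ⟨_, isWeightedHomogeneous_X K _ _⟩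
  intro f hf
  obtain ⟨q, hq, r, hr, e⟩ := Submodule.mem_sup.1
    (mem_incidence_slice f fun p hp _ h2 => hf p hp h2)
  obtain ⟨g, k, rfl⟩ := Ideal.mem_span_pair.1 hr
  refine ⟨g, incidence_dense_one g fun p hp h2 => ?_, ?_⟩
  · have h3 := hf p hp h2
    have h4 : eval p q = 0 := span_incidenceGens_le_ker hp hq
    rw [← e] at h3
    simp only [map_add, map_mul, eval_X, h4, h2] at h3
    linear_combination h3
  · have : f - X (iw 1) * g = q + k * X (iw 2) := by rw [← e]; ring
    rw [this]
    exact Ideal.add_mem _ (Ideal.span_mono Set.subset_union_left hq)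
      (Ideal.mul_mem_left _ _ (Ideal.subset_span (Or.inr rfl)))

/-- The incidence ideal is radical. -/
lemma mem_span_incidenceGens [IsAlgClosed K] [Finite ε] (f : MvPolynomial (Coord ε) K)
    (hf : ∀ p : Coord ε → K, Incident p → eval p f = 0) :
    f ∈ Ideal.span (incidenceGens K ε) := by
  refine mem_span_of_forall_step (weightW ε) (iw 2) rfl _ incidenceGens_homogeneous
    {f | ∀ p : Coord ε → K, Incident p → eval p f = 0} ?_ f hf
  intro f hf
  have h := mem_incidence_half f fun p hp _ => hf p hp
  rw [Ideal.span_union] at h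
  obtain ⟨q, hq, r, hr, e⟩ := Submodule.mem_sup.1 h
  obtain ⟨g, rfl⟩ := Ideal.mem_span_singleton.1 hr
  refine ⟨g, incidence_dense_two g fun p hp => ?_, by rwa [← e, add_sub_cancel_right]⟩
  have h3 := hf p hp
  have h4 : eval p q = 0 := span_incidenceGens_le_ker hp hq
  rw [← e] at h3
  simpa only [map_add, map_mul, eval_X, h4, zero_add] using h3

lemma eval_weighted {σ : Type*} {W : σ → ℕ} {n : ℕ} {f : MvPolynomial σ K}
    (hf : IsWeightedHomogeneous W f n) (t : K) (p : σ → K) :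
    eval (fun i => t ^ W i * p i) f = t ^ n * eval p f := by
  rw [eval_eq, eval_eq, Finset.mul_sum]
  refine Finset.sum_congr rfl fun d hd => ?_
  have : ∏ i ∈ d.support, (t ^ W i * p i) ^ d i = t ^ n * ∏ i ∈ d.support, p i ^ d i := by
    rw [← hf (mem_support_iff.1 hd), Finsupp.weight_apply, Finsupp.sum, ← Finset.prod_pow_eq_pow_sum,
      ← Finset.prod_mul_distrib]
    refine Finset.prod_congr rfl fun i _ => ?_
    rw [mul_pow, ← pow_mul, smul_eq_mul, mul_comm (d i)]
  rw [this]
  ring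

lemma exists_eigenvector_of_formD_eq_zero [IsAlgClosed K] (a : Fin 3 → Fin 3 → K)
    (w : Fin 3 → K) (h : det3 w (rv w a) (rv (rv w a) a) = 0) :
    ∃ u : Fin 3 → K, u ≠ 0 ∧ dot w u = 0 ∧ ∃ lam : K, ∀ i, mv a u i = lam * u i := by
  have hdot : ∀ (w x y : Fin 3 → K) (c : K), dot w (x + c • y) = dot w x + c * dot w y := by
    intro w x y c; simp [dot]; ring
  let U : Submodule K (Fin 3 → K) :=
    { carrier := {u | dot w u = 0 ∧ dot (rv w a) u = 0 ∧ dot (rv (rv w a) a) u = 0}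
      add_mem' := fun {x y} hx hy => by
        have := hdot
        simp only [Set.mem_ofPred_eq] at hx hy ⊢
        rw [← one_smul K y, hdot, hdot, hdot, hx.1, hx.2.1, hx.2.2, hy.1, hy.2.1, hy.2.2]
        simp
      zero_mem' := by simp [dot]
      smul_mem' := fun c x hx => by
        simp only [Set.mem_ofPred_eq] at hx ⊢
        rw [← zero_add (c • x), hdot, hdot, hdot, hx.1, hx.2.1, hx.2.2]
        simp [dot] }
  have hinv : ∀ u ∈ U, mv a u ∈ U := by
    rintro u ⟨h0, h1, h2⟩
    refine ⟨by rw [dot_mv, h1], by rw [dot_mv, h2], ?_⟩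
    rw [dot_mv]
    have e : dot (rv (rv (rv w a) a) a) u = tr3 a * dot (rv (rv w a) a) u -
        mi3 a * dot (rv w a) u + det3 (a 0) (a 1) (a 2) * dot w u := by
      simp only [dot, rv_rv_rv]; ring
    rw [e, h0, h1, h2]; ring
  have hne : U ≠ ⊥ := by
    obtain ⟨u, hu, h0⟩ := (Matrix.exists_mulVec_eq_zero_iff
      (M := Matrix.of ![w, rv w a, rv (rv w a) a])).2 (by
        rw [← h, Matrix.det_fin_three]
        simp [det3, dot]
        ring)
    intro hb
    refine hu ((Submodule.mem_bot K).1 (hb ▸ ?_))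
    have e := fun i => congrFun h0 i
    simp only [Matrix.mulVec, dotProduct, Fin.sum_univ_three] at e
    exact ⟨e 0, e 1, e 2⟩
  obtain ⟨u, hu, hu0, hlam⟩ := exists_eigenvector_mem a U hinv hne
  exact ⟨u, hu0, hu.1, hlam⟩

lemma mem_incidence_of_vanishing [IsAlgClosed K] [Finite ε] (f : MvPolynomial (Coord ε) K) {b : ℕ}
    (hb : IsWeightedHomogeneous (weightV ε) f b)
    (hf : ∀ (p : Coord ε → K) (lam : K), (∀ i, mv (pa p) (pv p) i = lam * p (iv i)) →
      dot (pw p) (pv p) = 0 → (∃ i, p (iw i) ≠ 0) → (∃ i, p (iv i) ≠ 0) → eval p f = 0) :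
    f ∈ Ideal.span (incidenceGens K ε ∪ {formD X}) := by
  have hf1 : ∀ (p : Coord ε → K) (lam : K), (∀ i, mv (pa p) (pv p) i = lam * p (iv i)) →
      dot (pw p) (pv p) = 0 → (∃ i, p (iv i) ≠ 0) → eval p f = 0 := by
    intro p lam hlam hdot hv
    by_cases hw : ∃ i, p (iw i) ≠ 0
    · exact hf p lam hlam hdot hw hv
    push Not at hw
    obtain ⟨w', k, hk, hw'⟩ : ∃ (w' : Fin 3 → K) (k : Fin 3), w' k ≠ 0 ∧ dot w' (pv p) = 0 := by
      by_cases h0 : p (iv 0) = 0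
      · exact ⟨![1, 0, 0], 0, by simp, by simp [dot, h0]⟩
      · exact ⟨![-p (iv 1), p (iv 0), 0], 1, by simpa using h0, by simp [dot]; ring⟩
    refine eval_eq_zero_of_covector_line k p w' hk f fun t q hqw hqv hqa => ?_
    by_cases hq0 : q (iw k) = 0
    · rw [hq0, zero_mul]
    · have e1 : pv q = pv p := by
        funext i
        exact hqv i
      have e2 : pa q = pa p := by
        funext i j
        exact hqa i j
      rw [hf q lam (fun i => by rw [e1, e2, hlam, hqv]) ?_ ⟨k, hq0⟩, mul_zero]
      · obtain ⟨i, hi⟩ := hv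
        exact ⟨i, by rwa [hqv]⟩
      · rw [e1]
        simp only [dot, pw, hqw, hw] at hw' ⊢
        linear_combination t * hw'
  rw [Ideal.span_union]
  rcases Nat.eq_zero_or_pos b with rfl | hpos
  · refine Ideal.mem_sup_right (Ideal.mem_span_singleton.2
      (dvd_of_vanishing irreducible_formD fun p hp => ?_))
    rw [eval_formD] at hp
    obtain ⟨u, hu0, hwu, lam, hlam⟩ := exists_eigenvector_of_formD_eq_zero (pa p) (pw p) hp
    obtain ⟨k, hk⟩ := Function.ne_iff.1 hu0
    have h1 := eval_weighted hb 0 p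
    have h2 := eval_weighted hb 0 (Sum.elim (Sum.elim (pw p) u) fun e => p (Sum.inr e))
    have h3 : (fun i => (0 : K) ^ weightV ε i * p i) = fun i => (0 : K) ^ weightV ε i *
        (Sum.elim (Sum.elim (pw p) u) fun e => p (Sum.inr e) : Coord ε → K) i := by
      funext i
      rcases i with (i | i) | i <;> simp [weightV]
    rw [← h3, h1, pow_zero, one_mul, one_mul] at h2
    rw [h2]
    exact hf1 _ lam hlam hwu ⟨k, hk⟩
  · refine Ideal.mem_sup_left (mem_span_incidenceGens f fun p hp => ?_)
    by_cases hv : ∃ j, p (iv j) ≠ 0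
    · obtain ⟨j, hj⟩ := hv
      obtain ⟨lam, hlam⟩ := hp.exists_eigen hj
      exact hf1 p lam hlam hp.dot_eq_zero ⟨j, hj⟩
    · push Not at hv
      have h1 := eval_weighted hb 0 p
      have h3 : (fun i => (0 : K) ^ weightV ε i * p i) = p := by
        funext i
        rcases i with (i | i) | i <;> simp [weightV, hv]
      rw [h3, zero_pow hpos.ne', zero_mul] at h1
      exact h1

end IncidenceRadical
section Symbols

/-- Letters: `single k q` stands for the entry `q` of row `k`, and `pair i j l` (with `i < j`)
for the entry `l` of the cross product of the rows `i` and `j`. -/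
inductive Letter (m : ℕ) : Type
  | single (k : Fin m) (q : Fin 3) : Letter m
  | pair (i j : Fin m) (h : i < j) (l : Fin 3) : Letter m

namespace Letter

variable {m : ℕ}

/-- The label of a letter. -/
def label : Letter m → Fin 3 ⊕ Fin 3
  | single _ q => Sum.inl q
  | pair _ _ _ l => Sum.inr l

/-- The rows used by a letter. -/
def rows : Letter m → Multiset (Fin m ⊕ Fin m)
  | single k _ => {Sum.inl k}
  | pair i j _ _ => {Sum.inl i, Sum.inr j}

/-- The weight of a letter. -/
def weight : Letter m → ℕ
  | single _ _ => m
  | pair _ j _ _ => m + j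

/-- The value of a letter. -/
def value {R : Type*} [CommRing R] (g : Fin m → Fin 3 → R) : Letter m → R
  | single k q => g k q
  | pair i j _ l => crs (g i) (g j) l

end Letter

variable {m : ℕ}

/-- The labels of a word. -/
def labels (s : Multiset (Letter m)) : Multiset (Fin 3 ⊕ Fin 3) := s.map Letter.label

/-- The content of a word. -/
def content (s : Multiset (Letter m)) : Multiset (Fin m ⊕ Fin m) := s.bind Letter.rows

/-- The weight of a word. -/
def wordWeight (s : Multiset (Letter m)) : ℕ := (s.map Letter.weight).sum

/-- The value of a word. -/
def wordValue {R : Type*} [CommRing R] (g : Fin m → Fin 3 → R) (s : Multiset (Letter m)) : R :=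
  (s.map (Letter.value g)).prod

@[simp] lemma labels_cons (x : Letter m) (s) : labels (x ::ₘ s) = x.label ::ₘ labels s := by
  simp [labels]
@[simp] lemma labels_add (s t : Multiset (Letter m)) : labels (s + t) = labels s + labels t := by
  simp [labels]
@[simp] lemma content_cons (x : Letter m) (s) : content (x ::ₘ s) = x.rows + content s := by
  simp [content]
@[simp] lemma content_add (s t : Multiset (Letter m)) :
    content (s + t) = content s + content t := by
  simp [content]
@[simp] lemma wordWeight_cons (x : Letter m) (s) :
    wordWeight (x ::ₘ s) = x.weight + wordWeight s := by
  simp [wordWeight]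
@[simp] lemma wordWeight_add (s t : Multiset (Letter m)) :
    wordWeight (s + t) = wordWeight s + wordWeight t := by
  simp [wordWeight]
@[simp] lemma wordValue_cons {R : Type*} [CommRing R] (g : Fin m → Fin 3 → R) (x : Letter m) (s) :
    wordValue g (x ::ₘ s) = x.value g * wordValue g s := by
  simp [wordValue]
@[simp] lemma wordValue_add {R : Type*} [CommRing R] (g : Fin m → Fin 3 → R)
    (s t : Multiset (Letter m)) : wordValue g (s + t) = wordValue g s * wordValue g t := by
  simp [wordValue]
@[simp] lemma labels_zero : labels (0 : Multiset (Letter m)) = 0 := rfl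
@[simp] lemma content_zero : content (0 : Multiset (Letter m)) = 0 := rfl
@[simp] lemma wordWeight_zero : wordWeight (0 : Multiset (Letter m)) = 0 := rfl
@[simp] lemma wordValue_zero {R : Type*} [CommRing R] (g : Fin m → Fin 3 → R) :
    wordValue g (0 : Multiset (Letter m)) = 1 := by simp [wordValue]
@[simp] lemma wordWeight_singleton (x : Letter m) : wordWeight {x} = x.weight := by
  simp [wordWeight]
@[simp] lemma wordValue_singleton {R : Type*} [CommRing R] (g : Fin m → Fin 3 → R)
    (x : Letter m) : wordValue g {x} = x.value g := by simp [wordValue]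

/-- The weight of a word is determined by its content. -/
lemma wordWeight_eq (s : Multiset (Letter m)) :
    wordWeight s = ((content s).map (Sum.elim (fun _ => m) fun j : Fin m => (j : ℕ))).sum := by
  induction s using Multiset.induction with
  | empty => rfl
  | cons x s ih =>
    rw [wordWeight_cons, content_cons, Multiset.map_add, Multiset.sum_add, ih]
    cases x <;> simp [Letter.weight, Letter.rows]

lemma exists_pair_of_inr_mem {s : Multiset (Letter m)} {j : Fin m}
    (h : Sum.inr j ∈ content s) : ∃ i hij l, Letter.pair i j hij l ∈ s := by
  obtain ⟨x, hx, hj⟩ := Multiset.mem_bind.1 h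
  cases x with
  | single k q => simp [Letter.rows] at hj
  | pair i j' hij l =>
    obtain rfl : j = j' := by simpa [Letter.rows] using hj
    exact ⟨i, hij, l, hx⟩

lemma exists_of_inl_mem {s : Multiset (Letter m)} {i : Fin m}
    (h : Sum.inl i ∈ content s) :
    (∃ q, Letter.single i q ∈ s) ∨ ∃ j hij l, Letter.pair i j hij l ∈ s := by
  obtain ⟨x, hx, hj⟩ := Multiset.mem_bind.1 h
  cases x with
  | single k q =>
    obtain rfl : i = k := by simpa [Letter.rows] using hj
    exact Or.inl ⟨q, hx⟩
  | pair i' j' hij l =>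
    obtain rfl : i = i' := by simpa [Letter.rows] using hj
    exact Or.inr ⟨j', hij, l, hx⟩

lemma mem_content_of_mem {s : Multiset (Letter m)} {x : Letter m} (hx : x ∈ s)
    {r : Fin m ⊕ Fin m} (hr : r ∈ x.rows) : r ∈ content s :=
  Multiset.mem_bind.2 ⟨x, hx, hr⟩

section Filtration

variable {S R : Type*} [CommRing S] [CommRing R] [Algebra S R] (J : Ideal R)
  (g : Fin m → Fin 3 → R)

/-- The span of an ideal and the words of weight less than `N`. -/
def lower (S : Type*) [CommRing S] [Algebra S R] (J : Ideal R) (g : Fin m → Fin 3 → R) (N : ℕ) :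
    Submodule S R :=
  J.restrictScalars S ⊔ Submodule.span S (Set.image (wordValue g) {s | wordWeight s < N})

variable {J g}

lemma ideal_le_lower {N : ℕ} {x : R} (hx : x ∈ J) : x ∈ lower S J g N :=
  Submodule.mem_sup_left hx

lemma wordValue_mem_lower {N : ℕ} {s : Multiset (Letter m)} (h : wordWeight s < N) :
    wordValue g s ∈ lower S J g N :=
  Submodule.mem_sup_right (Submodule.subset_span ⟨s, h, rfl⟩)

lemma lower_mono {N N' : ℕ} (h : N ≤ N') : lower S J g N ≤ lower S J g N' :=
  sup_le_sup_left (Submodule.span_mono (Set.image_mono fun _ hs => lt_of_lt_of_le hs h)) _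

lemma wordValue_mul_mem_lower {N : ℕ} (t : Multiset (Letter m)) {x : R}
    (hx : x ∈ lower S J g N) : wordValue g t * x ∈ lower S J g (wordWeight t + N) := by
  obtain ⟨y, hy, z, hz, rfl⟩ := Submodule.mem_sup.1 hx
  rw [mul_add]
  refine add_mem (ideal_le_lower (J.mul_mem_left _ hy)) (Submodule.mem_sup_right ?_)
  clear hx
  induction hz using Submodule.span_induction with
  | mem z hz =>
    obtain ⟨s, hs, rfl⟩ := hz
    rw [← wordValue_add]
    exact Submodule.subset_span ⟨_, by
      rw [Set.mem_ofPred_eq, wordWeight_add]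
      exact Nat.add_lt_add_left hs _, rfl⟩
  | zero => rw [mul_zero]; exact zero_mem _
  | add a b _ _ ha hb => rw [mul_add]; exact add_mem ha hb
  | smul c a _ ha => rw [mul_smul_comm]; exact Submodule.smul_mem _ _ ha

variable (S J g) in
/-- Two words of equal content whose values agree up to lower weight. -/
def WordEquiv (s t : Multiset (Letter m)) : Prop :=
  content s = content t ∧ labels s = labels t ∧
    wordValue g s - wordValue g t ∈ lower S J g (wordWeight s)

lemma WordEquiv.weight_eq {s t : Multiset (Letter m)} (h : WordEquiv S J g s t) :
    wordWeight s = wordWeight t := by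
  rw [wordWeight_eq, wordWeight_eq, h.1]

lemma WordEquiv.refl (s : Multiset (Letter m)) : WordEquiv S J g s s :=
  ⟨rfl, rfl, by rw [sub_self]; exact zero_mem _⟩

lemma WordEquiv.symm {s t : Multiset (Letter m)} (h : WordEquiv S J g s t) :
    WordEquiv S J g t s :=
  ⟨h.1.symm, h.2.1.symm, by rw [← h.weight_eq, ← neg_sub]; exact neg_mem h.2.2⟩

lemma WordEquiv.trans {s t u : Multiset (Letter m)} (h : WordEquiv S J g s t)
    (h' : WordEquiv S J g t u) : WordEquiv S J g s u := by
  refine ⟨h.1.trans h'.1, h.2.1.trans h'.2.1, ?_⟩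
  rw [← sub_add_sub_cancel]
  exact add_mem h.2.2 (by rw [h.weight_eq]; exact h'.2.2)

lemma WordEquiv.add_left {s t : Multiset (Letter m)} (h : WordEquiv S J g s t)
    (u : Multiset (Letter m)) : WordEquiv S J g (u + s) (u + t) := by
  refine ⟨by simp [h.1], by simp [h.2.1], ?_⟩
  rw [wordValue_add, wordValue_add, ← mul_sub, wordWeight_add]
  exact wordValue_mul_mem_lower u h.2.2

lemma WordEquiv.cons {s t : Multiset (Letter m)} (h : WordEquiv S J g s t) (x : Letter m) :
    WordEquiv S J g (x ::ₘ s) (x ::ₘ t) := by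
  simpa using h.add_left {x}

lemma WordEquiv.cons_cons {x y x' y' : Letter m} (h : WordEquiv S J g {x, y} {x', y'})
    (s : Multiset (Letter m)) : WordEquiv S J g (x ::ₘ y ::ₘ s) (x' ::ₘ y' ::ₘ s) := by
  have := h.add_left s
  rw [add_comm s, add_comm s] at this
  simpa using this

end Filtration
end Symbols
section Moves

variable {m : ℕ} {S R : Type*} [CommRing S] [CommRing R] [Algebra S R] {J : Ideal R}
  {g : Fin m → Fin 3 → R}

lemma mul_sub_mul_eq_crs (x y : Fin 3 → R) (p q : Fin 3) :
    x p * y q - x q * y p = 0 ∨ ∃ l, x p * y q - x q * y p = crs x y l ∨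
      x p * y q - x q * y p = -crs x y l := by
  fin_cases p <;> fin_cases q <;> simp only [Fin.zero_eta, Fin.mk_one, Fin.reduceFinMk, Fin.isValue]
  · left; ring
  · right; exact ⟨2, Or.inl (by rw [crs_two])⟩
  · right; exact ⟨1, Or.inr (by rw [crs_one]; ring)⟩
  · right; exact ⟨2, Or.inr (by rw [crs_two]; ring)⟩
  · left; ring
  · right; exact ⟨0, Or.inl (by rw [crs_zero])⟩
  · right; exact ⟨1, Or.inl (by rw [crs_one])⟩
  · right; exact ⟨0, Or.inr (by rw [crs_zero]; ring)⟩
  · left; ring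

lemma wordEquiv_single_single_of_lt {k k' : Fin m} (h : k < k') (q q' : Fin 3) :
    WordEquiv S J g {.single k q, .single k' q'} {.single k q', .single k' q} := by
  refine ⟨by simp [content, Letter.rows], Multiset.pair_comm _ _, ?_⟩
  have hw : ∀ l, crs (g k) (g k') l ∈ lower S J g
      (wordWeight {Letter.single k q, Letter.single k' q'}) := fun l => by
    have := wordValue_mem_lower (S := S) (J := J) (g := g) (s := {Letter.pair k k' h l})
      (N := wordWeight {Letter.single k q, Letter.single k' q'})
      (by simp [wordWeight, Letter.weight])
    simpa [Letter.value] using this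
  have e : wordValue g {Letter.single k q, Letter.single k' q'} -
      wordValue g {Letter.single k q', Letter.single k' q} =
      g k q * g k' q' - g k q' * g k' q := by simp [wordValue, Letter.value]
  rw [e]
  rcases mul_sub_mul_eq_crs (g k) (g k') q q' with h0 | ⟨l, h0 | h0⟩ <;> rw [h0]
  · exact zero_mem _
  · exact hw l
  · exact neg_mem (hw l)

lemma wordEquiv_single_single (k k' : Fin m) (q q' : Fin 3) :
    WordEquiv S J g {.single k q, .single k' q'} {.single k q', .single k' q} := by
  rcases lt_trichotomy k k' with h | rfl | h
  · exact wordEquiv_single_single_of_lt h q q'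
  · rw [Multiset.pair_comm]
    exact .refl _
  · rw [Multiset.pair_comm, Multiset.pair_comm (Letter.single k q')]
    exact wordEquiv_single_single_of_lt h q' q

lemma wordEquiv_pair_pair (hJ : ∀ i j k, det3 (g i) (g j) (g k) ∈ J) {i j i' j' : Fin m}
    (h : i < j) (h' : i' < j') (l l' : Fin 3) :
    WordEquiv S J g {.pair i j h l, .pair i' j' h' l'} {.pair i j h l', .pair i' j' h' l} := by
  refine ⟨by simp [content, Letter.rows], Multiset.pair_comm _ _, ?_⟩
  apply ideal_le_lower
  have hw : ∀ l, crs (crs (g i) (g j)) (crs (g i') (g j')) l ∈ J := fun l => by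
    rw [crs_crs, dot_crs, dot_crs]
    exact sub_mem (J.mul_mem_right _ (hJ _ _ _)) (J.mul_mem_right _ (hJ _ _ _))
  have e : wordValue g {Letter.pair i j h l, Letter.pair i' j' h' l'} -
      wordValue g {Letter.pair i j h l', Letter.pair i' j' h' l} =
      crs (g i) (g j) l * crs (g i') (g j') l' - crs (g i) (g j) l' * crs (g i') (g j') l := by
    simp [wordValue, Letter.value]
  rw [e]
  rcases mul_sub_mul_eq_crs (crs (g i) (g j)) (crs (g i') (g j')) l l' with h0 | ⟨l, h0 | h0⟩ <;>
    rw [h0]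
  · exact zero_mem _
  · exact hw l
  · exact neg_mem (hw l)

lemma crs_swap (r t : Fin 3 → R) (l : Fin 3) : crs t r l = -crs r t l := by
  fin_cases l <;> simp <;> ring

lemma crs_self (t : Fin 3 → R) (l : Fin 3) : crs t t l = 0 := by
  fin_cases l <;> simp [mul_comm]

lemma wordEquiv_pair_single (hJ : ∀ i j k, det3 (g i) (g j) (g k) ∈ J) {i₀ i₁ j : Fin m}
    (h₀ : i₀ < i₁) (h₁ : i₁ < j) (l q : Fin 3) :
    WordEquiv S J g {.pair i₁ j h₁ l, .single i₀ q} {.pair i₀ j (h₀.trans h₁) l, .single i₁ q} := by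
  refine ⟨?_, by simp [labels, Letter.label], ?_⟩
  · simp only [content, Letter.rows, Multiset.insert_eq_cons, Multiset.cons_bind,
      Multiset.singleton_bind]
    simp only [← Multiset.singleton_add]
    abel
  have h1 := wordValue_mem_lower (S := S) (J := J) (g := g)
    (s := {Letter.pair i₀ i₁ h₀ l, Letter.single j q})
    (N := wordWeight {Letter.pair i₁ j h₁ l, Letter.single i₀ q})
    (by simpa [wordWeight, Letter.weight] using h₁)
  have h2 := sum_crs_mul (g i₀) (g i₁) (g j) l q
  rw [crs_swap (g i₀) (g j)] at h2
  have e : wordValue g {Letter.pair i₁ j h₁ l, Letter.single i₀ q} -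
      wordValue g {Letter.pair i₀ j (h₀.trans h₁) l, Letter.single i₁ q} =
      (if l = q then det3 (g i₀) (g i₁) (g j) else 0) -
        wordValue g {Letter.pair i₀ i₁ h₀ l, Letter.single j q} := by
    rw [← h2]; simp [wordValue, Letter.value]; ring
  rw [e]
  refine sub_mem (ideal_le_lower ?_) h1
  split_ifs
  · exact hJ _ _ _
  · exact zero_mem _

lemma crs_mul_crs_mem {r s t : Fin 3 → R} (h : det3 r s t ∈ J) (p : Fin 3 → R) (l l' : Fin 3) :
    crs s t l * crs r p l' + crs t r l * crs s p l' + crs r s l * crs t p l' ∈ J := by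
  have key : ∀ q, crs s t l * r q + crs t r l * s q + crs r s l * t q ∈ J := fun q => by
    rw [sum_crs_mul]
    split_ifs
    exacts [h, zero_mem _]
  fin_cases l' <;> simp only [Fin.zero_eta, Fin.mk_one, Fin.reduceFinMk, Fin.isValue]
  · convert sub_mem (J.mul_mem_right (p 2) (key 1)) (J.mul_mem_right (p 1) (key 2)) using 1
    simp only [crs_zero]; ring
  · convert sub_mem (J.mul_mem_right (p 0) (key 2)) (J.mul_mem_right (p 2) (key 0)) using 1
    simp only [crs_one]; ring
  · convert sub_mem (J.mul_mem_right (p 1) (key 0)) (J.mul_mem_right (p 0) (key 1)) using 1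
    simp only [crs_two]; ring

lemma wordEquiv_pair_pair_rows (hJ : ∀ i j k, det3 (g i) (g j) (g k) ∈ J) {i₀ i₁ j j' : Fin m}
    (h₀ : i₀ < i₁) (h₁ : i₁ < j) (hj : j ≤ j') (l l' : Fin 3) :
    WordEquiv S J g {.pair i₁ j h₁ l, .pair i₀ j' (h₀.trans (h₁.trans_le hj)) l'}
      {.pair i₀ j (h₀.trans h₁) l, .pair i₁ j' (h₁.trans_le hj) l'} := by
  refine ⟨?_, by simp [labels, Letter.label], ?_⟩
  · simp only [content, Letter.rows, Multiset.insert_eq_cons, Multiset.cons_bind,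
      Multiset.singleton_bind]
    simp only [← Multiset.singleton_add]
    abel
  have h2 := crs_mul_crs_mem (hJ i₀ i₁ j) (g j') l l'
  rw [crs_swap (g i₀) (g j)] at h2
  have e : wordValue g {Letter.pair i₁ j h₁ l, Letter.pair i₀ j' (h₀.trans (h₁.trans_le hj)) l'} -
      wordValue g {Letter.pair i₀ j (h₀.trans h₁) l, Letter.pair i₁ j' (h₁.trans_le hj) l'} =
      (crs (g i₁) (g j) l * crs (g i₀) (g j') l' + -crs (g i₀) (g j) l * crs (g i₁) (g j') l' +
        crs (g i₀) (g i₁) l * crs (g j) (g j') l') - crs (g i₀) (g i₁) l * crs (g j) (g j') l' := by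
    simp [wordValue, Letter.value]; ring
  rw [e]
  refine sub_mem (ideal_le_lower h2) ?_
  rcases hj.eq_or_lt with rfl | hj
  · rw [crs_self, mul_zero]
    exact zero_mem _
  · have h1 := wordValue_mem_lower (S := S) (J := J) (g := g)
      (s := {Letter.pair i₀ i₁ h₀ l, Letter.pair j j' hj l'})
      (N := wordWeight {Letter.pair i₁ j h₁ l, Letter.pair i₀ j' (h₀.trans (h₁.trans_le hj.le)) l'})
      (by simp [wordWeight, Letter.weight]; omega)
    simpa [wordValue, Letter.value] using h1

end Moves

section Rearrangement

variable {m : ℕ} {S R : Type*} [CommRing S] [CommRing R] [Algebra S R] {J : Ideal R}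
  {g : Fin m → Fin 3 → R}

lemma exists_cons_cons {α : Type*} {s : Multiset α} {x y : α} (hx : x ∈ s) (hy : y ∈ s)
    (hxy : x ≠ y) : ∃ t, s = x ::ₘ y ::ₘ t := by
  obtain ⟨t, rfl⟩ := Multiset.exists_cons_of_mem hx
  obtain ⟨u, rfl⟩ := Multiset.exists_cons_of_mem ((Multiset.mem_cons.1 hy).resolve_left hxy.symm)
  exact ⟨u, rfl⟩

lemma exists_mem_label {s : Multiset (Letter m)} {a : Fin 3 ⊕ Fin 3} (h : a ∈ labels s) :
    ∃ x ∈ s, x.label = a := Multiset.mem_map.1 h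

/-- Any word with a pair is equivalent to one containing the pair of minimal rows. -/
lemma exists_wordEquiv_pair_cons (hJ : ∀ i j k, det3 (g i) (g j) (g k) ∈ J)
    {s : Multiset (Letter m)} {i₀ j₀ : Fin m} (hi : Sum.inl i₀ ∈ content s)
    (hi' : ∀ i, Sum.inl i ∈ content s → i₀ ≤ i) (hj : Sum.inr j₀ ∈ content s)
    (hj' : ∀ j, Sum.inr j ∈ content s → j₀ ≤ j) :
    ∃ h l t, WordEquiv S J g s (.pair i₀ j₀ h l ::ₘ t) := by
  obtain ⟨i₁, h₁, l, hl⟩ := exists_pair_of_inr_mem hj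
  have hle := hi' i₁ (mem_content_of_mem hl (by simp [Letter.rows]))
  rcases hle.eq_or_lt with rfl | hlt
  · obtain ⟨t, rfl⟩ := Multiset.exists_cons_of_mem hl
    exact ⟨h₁, l, t, .refl _⟩
  rcases exists_of_inl_mem hi with ⟨q, hq⟩ | ⟨j', hj'', l', hl'⟩
  · obtain ⟨t, rfl⟩ := exists_cons_cons hl hq (by simp)
    exact ⟨_, _, _, (wordEquiv_pair_single hJ hlt h₁ l q).cons_cons t⟩
  · have hjj := hj' j' (mem_content_of_mem hl' (by simp [Letter.rows]))
    obtain ⟨t, rfl⟩ := exists_cons_cons hl hl' (by simp [hlt.ne'])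
    exact ⟨_, _, _, (wordEquiv_pair_pair_rows hJ hlt h₁ hjj l l').cons_cons t⟩

lemma exists_wordEquiv_pair_cons_label (hJ : ∀ i j k, det3 (g i) (g j) (g k) ∈ J) {i j : Fin m}
    (h : i < j) (l l' : Fin 3) (t : Multiset (Letter m))
    (hl : Sum.inr l' ∈ labels (.pair i j h l ::ₘ t)) :
    ∃ u, WordEquiv S J g (.pair i j h l ::ₘ t) (.pair i j h l' ::ₘ u) := by
  by_cases hll : l = l'
  · exact ⟨t, hll ▸ .refl _⟩
  obtain ⟨x, hx, hxl⟩ := exists_mem_label hl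
  rcases Multiset.mem_cons.1 hx with rfl | hx
  · exact absurd (Sum.inr_injective hxl) hll
  obtain ⟨u, rfl⟩ := Multiset.exists_cons_of_mem hx
  cases x with
  | single k q => simp [Letter.label] at hxl
  | pair i' j' h' l'' =>
    obtain rfl := Sum.inr_injective hxl
    exact ⟨_, (wordEquiv_pair_pair hJ h h' l l'').cons_cons u⟩

lemma exists_wordEquiv_single_cons {s : Multiset (Letter m)} {k : Fin m} {q : Fin 3}
    (hs : ∀ j, Sum.inr j ∉ content s) (hk : Sum.inl k ∈ content s) (hq : Sum.inl q ∈ labels s) :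
    ∃ u, WordEquiv S J g s (.single k q ::ₘ u) := by
  rcases exists_of_inl_mem hk with ⟨q', hq'⟩ | ⟨j, hij, l, hl⟩
  · obtain ⟨x, hx, hxl⟩ := exists_mem_label hq
    cases x with
    | pair => simp [Letter.label] at hxl
    | single k' q'' =>
      obtain rfl := Sum.inl_injective hxl
      by_cases hqq : Letter.single k q' = .single k' q''
      · obtain ⟨u, rfl⟩ := Multiset.exists_cons_of_mem hx
        cases hqq
        exact ⟨u, .refl _⟩
      · obtain ⟨t, rfl⟩ := exists_cons_cons hq' hx hqq
        exact ⟨_, (wordEquiv_single_single k k' q' q'').cons_cons t⟩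
  · exact absurd (mem_content_of_mem hl (by simp [Letter.rows])) (hs j)

/-- Words with equal content and labels have equal values up to lower weight. -/
lemma wordEquiv_of_eq (hJ : ∀ i j k, det3 (g i) (g j) (g k) ∈ J) :
    ∀ (N : ℕ) (s t : Multiset (Letter m)), Multiset.card s = N → content s = content t →
      labels s = labels t → WordEquiv S J g s t := by
  intro N
  induction N with
  | zero =>
    intro s t hs _ hl
    obtain rfl := Multiset.card_eq_zero.1 hs
    have : t = 0 := by simpa [labels] using hl.symm
    rw [this]
    exact .refl _
  | succ N ih =>
    intro s t hs hc hl
    have reduce : ∀ (x : Letter m) (u u' : Multiset (Letter m)),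
        WordEquiv S J g s (x ::ₘ u) → WordEquiv S J g t (x ::ₘ u') → WordEquiv S J g s t := by
      intro x u u' h h'
      refine h.trans (.trans (.cons (ih u u' ?_ ?_ ?_) x) h'.symm)
      · have := congrArg Multiset.card h.2.1
        simp only [labels, Multiset.card_map, Multiset.card_cons, hs] at this
        omega
      · have := h.1.symm.trans (hc.trans h'.1)
        rw [content_cons, content_cons] at this
        exact add_left_cancel this
      · have := h.2.1.symm.trans (hl.trans h'.2.1)
        rw [labels_cons, labels_cons] at this
        exact (Multiset.cons_inj_right _).1 this
    by_cases hpair : ∃ j, Sum.inr j ∈ content s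
    · obtain ⟨j₀, hj, hj'⟩ : ∃ j₀, Sum.inr j₀ ∈ content s ∧
          ∀ j, Sum.inr j ∈ content s → j₀ ≤ j := by
        have := Set.exists_min_image {j | Sum.inr j ∈ content s} id (Set.toFinite _) hpair
        simpa using this
      obtain ⟨i₀, hi, hi'⟩ : ∃ i₀, Sum.inl i₀ ∈ content s ∧
          ∀ i, Sum.inl i ∈ content s → i₀ ≤ i := by
        obtain ⟨i, hij, l, h⟩ := exists_pair_of_inr_mem hj
        have := Set.exists_min_image {i | Sum.inl i ∈ content s} id (Set.toFinite _)
          ⟨i, mem_content_of_mem h (by simp [Letter.rows])⟩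
        simpa using this
      obtain ⟨h, l, u, hu⟩ := exists_wordEquiv_pair_cons (S := S) hJ hi hi' hj hj'
      rw [hc] at hi hi' hj hj'
      obtain ⟨_, l', u', hu'⟩ := exists_wordEquiv_pair_cons (S := S) hJ hi hi' hj hj'
      obtain ⟨u'', hu''⟩ := exists_wordEquiv_pair_cons_label (S := S) (J := J) (g := g) hJ h l' l u'
        (by rw [← hu'.2.1, ← hl, hu.2.1]; simp [Letter.label])
      exact reduce _ _ _ hu (hu'.trans hu'')
    · push Not at hpair
      obtain ⟨x, hx⟩ := Multiset.card_pos_iff_exists_mem.1 (hs.symm ▸ N.succ_pos : 0 < Multiset.card s)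
      cases x with
      | pair i j h l => exact absurd (mem_content_of_mem hx (by simp [Letter.rows])) (hpair j)
      | single k q =>
        obtain ⟨u, rfl⟩ := Multiset.exists_cons_of_mem hx
        obtain ⟨u', hu'⟩ := exists_wordEquiv_single_cons (S := S) (J := J) (g := g) (s := t)
          (k := k) (q := q) (by rwa [← hc]) (by rw [← hc]; simp [Letter.rows])
          (by rw [← hl]; simp [Letter.label])
        exact reduce _ _ _ (.refl _) hu'

end Rearrangement
section Theta

open MvPolynomial

variable {m : ℕ} {S R : Type*} [CommRing S] [CommRing R] [Algebra S R] {J : Ideal R}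
  {g : Fin m → Fin 3 → R}

/-- The weight of a word of content `c`. -/
def contentWeight (c : Multiset (Fin m ⊕ Fin m)) : ℕ :=
  (c.map (Sum.elim (fun _ => m) fun j : Fin m => (j : ℕ))).sum

/-- The monomial with given labels. -/
noncomputable def labelMonomial (S : Type*) [CommRing S] (d : Multiset (Fin 3 ⊕ Fin 3)) :
    MvPolynomial (Fin 3 ⊕ Fin 3) S := monomial (Multiset.toFinsupp d) 1

lemma labelMonomial_add (d e : Multiset (Fin 3 ⊕ Fin 3)) :
    labelMonomial S (d + e) = labelMonomial S d * labelMonomial S e := by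
  simp [labelMonomial, monomial_mul]

lemma labelMonomial_cons (x : Fin 3 ⊕ Fin 3) (e : Multiset (Fin 3 ⊕ Fin 3)) :
    labelMonomial S (x ::ₘ e) = X x * labelMonomial S e := by
  rw [← Multiset.singleton_add, labelMonomial_add]
  simp [labelMonomial, X]

lemma labelMonomial_zero : labelMonomial S 0 = 1 := by simp [labelMonomial]

open Classical in
/-- The linear map realizing label monomials by words of content `c`. -/
noncomputable def theta (S : Type*) [CommRing S] [Algebra S R] (g : Fin m → Fin 3 → R)
    (c : Multiset (Fin m ⊕ Fin m)) : MvPolynomial (Fin 3 ⊕ Fin 3) S →ₗ[S] R :=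
  (basisMonomials (Fin 3 ⊕ Fin 3) S).constr S fun e =>
    if h : ∃ s, content s = c ∧ labels s = Finsupp.toMultiset e then wordValue g h.choose else 0

open Classical in
lemma theta_labels (hJ : ∀ i j k, det3 (g i) (g j) (g k) ∈ J) (s : Multiset (Letter m)) :
    theta S g (content s) (labelMonomial S (labels s)) - wordValue g s ∈
      lower S J g (contentWeight (content s)) := by
  have h : ∃ t, content t = content s ∧
      labels t = Finsupp.toMultiset (Multiset.toFinsupp (labels s)) := ⟨s, rfl, by simp⟩
  have e : theta S g (content s) (labelMonomial S (labels s)) = wordValue g h.choose := by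
    have := (basisMonomials (Fin 3 ⊕ Fin 3) S).constr_basis S (fun e =>
      if h : ∃ t, content t = content s ∧ labels t = Finsupp.toMultiset e
        then wordValue g h.choose else 0) (Multiset.toFinsupp (labels s))
    rw [coe_basisMonomials] at this
    rw [theta, labelMonomial, this, dif_pos h]
  rw [e]
  have h2 := h.choose_spec
  have h3 := wordEquiv_of_eq (S := S) hJ _ h.choose s rfl h2.1 (by rw [h2.2]; simp)
  have := h3.2.2
  rwa [wordWeight_eq, h2.1] at this

open Classical in
lemma theta_eq_zero {c : Multiset (Fin m ⊕ Fin m)} {d : Multiset (Fin 3 ⊕ Fin 3)}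
    (h : ¬ ∃ s, content s = c ∧ labels s = d) : theta S g c (labelMonomial S d) = 0 := by
  have := (basisMonomials (Fin 3 ⊕ Fin 3) S).constr_basis S (fun e =>
    if h : ∃ t, content t = c ∧ labels t = Finsupp.toMultiset e
      then wordValue g h.choose else 0) (Multiset.toFinsupp d)
  rw [coe_basisMonomials] at this
  rw [theta, labelMonomial, this, dif_neg]
  simpa using h

lemma theta_mul_mem (hJ : ∀ i j k, det3 (g i) (g j) (g k) ∈ J) (c : Multiset (Fin m ⊕ Fin m))
    {E : Type*} [Fintype E] (D : E → S) (lab : E → Multiset (Fin 3 ⊕ Fin 3))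
    (d : Multiset (Fin 3 ⊕ Fin 3))
    (H : ∀ e s, content s = c → labels s = lab e + d → ∃ (t : E → Multiset (Letter m)) (r : _),
      labels r = d ∧ (∀ e', labels (t e') = lab e') ∧ (∀ e', content (t e' + r) = c) ∧
        ∑ e', D e' • wordValue g (t e') ∈ J) :
    theta S g c (labelMonomial S d * ∑ e, C (D e) * labelMonomial S (lab e)) ∈
      lower S J g (contentWeight c) := by
  have e1 : labelMonomial S d * ∑ e, C (D e) * labelMonomial S (lab e) =
      ∑ e, D e • labelMonomial S (lab e + d) := by
    rw [Finset.mul_sum]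
    refine Finset.sum_congr rfl fun e _ => ?_
    rw [labelMonomial_add, smul_eq_C_mul]
    ring
  rw [e1, map_sum]
  by_cases hex : ∃ e s, content s = c ∧ labels s = lab e + d
  · obtain ⟨e, s, hs, hs'⟩ := hex
    obtain ⟨t, r, hr, ht, htr, hsum⟩ := H e s hs hs'
    have e2 : ∑ e', theta S g c (D e' • labelMonomial S (lab e' + d)) =
        ∑ e', D e' • (theta S g c (labelMonomial S (lab e' + d)) - wordValue g (t e' + r)) +
          (∑ e', D e' • wordValue g (t e')) * wordValue g r := by
      rw [Finset.sum_mul, ← Finset.sum_add_distrib]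
      refine Finset.sum_congr rfl fun e' _ => ?_
      rw [map_smul, wordValue_add, smul_sub, smul_mul_assoc]
      ring
    rw [e2]
    refine add_mem (sum_mem fun e' _ => Submodule.smul_mem _ _ ?_)
      (ideal_le_lower (J.mul_mem_right _ hsum))
    have := theta_labels (S := S) hJ (t e' + r)
    rwa [htr, labels_add, ht, hr] at this
  · refine sum_mem fun e _ => ?_
    rw [map_smul, theta_eq_zero, smul_zero]
    · exact zero_mem _
    · exact fun ⟨s, hs, hs'⟩ => hex ⟨e, s, hs, hs'⟩

open Classical in
lemma exists_of_labels_cons {s : Multiset (Letter m)} {x : Fin 3 ⊕ Fin 3}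
    {d : Multiset (Fin 3 ⊕ Fin 3)} (h : labels s = x ::ₘ d) :
    ∃ y r, s = y ::ₘ r ∧ y.label = x ∧ labels r = d := by
  obtain ⟨y, hy, hyx, hr⟩ := (Multiset.map_eq_cons _ _ _ _).2 h
  obtain ⟨r, rfl⟩ := Multiset.exists_cons_of_mem hy
  exact ⟨y, r, rfl, hyx, by simpa [labels] using hr⟩

lemma exists_of_labels_inl_cons {s : Multiset (Letter m)} {x : Fin 3}
    {d : Multiset (Fin 3 ⊕ Fin 3)} (h : labels s = Sum.inl x ::ₘ d) :
    ∃ k r, s = .single k x ::ₘ r ∧ labels r = d := by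
  obtain ⟨y, r, rfl, hy, hr⟩ := exists_of_labels_cons h
  cases y with
  | pair => simp [Letter.label] at hy
  | single k q =>
    obtain rfl := Sum.inl_injective hy
    exact ⟨k, r, rfl, hr⟩

lemma exists_of_labels_inr_cons {s : Multiset (Letter m)} {x : Fin 3}
    {d : Multiset (Fin 3 ⊕ Fin 3)} (h : labels s = Sum.inr x ::ₘ d) :
    ∃ i j hij r, s = .pair i j hij x ::ₘ r ∧ labels r = d := by
  obtain ⟨y, r, rfl, hy, hr⟩ := exists_of_labels_cons h
  cases y with
  | single => simp [Letter.label] at hy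
  | pair i j hij q =>
    obtain rfl := Sum.inr_injective hy
    exact ⟨i, j, hij, r, rfl, hr⟩

/-- The bilinear form with matrix `M`. -/
def bil {T : Type*} [CommRing T] (M : Fin 3 → Fin 3 → T) (x y : Fin 3 → T) : T := dot x (mv M y)

lemma bil_eq_sum {T : Type*} [CommRing T] (M : Fin 3 → Fin 3 → T) (x y : Fin 3 → T) :
    bil M x y = ∑ e : Fin 3 × Fin 3, M e.1 e.2 * (x e.1 * y e.2) := by
  rw [Fintype.sum_prod_type]
  simp only [bil, dot, mv, Fin.sum_univ_three]
  ring

lemma theta_bil_single_mem (hJ : ∀ i j k, det3 (g i) (g j) (g k) ∈ J) (M : Fin 3 → Fin 3 → S)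
    (hM : ∀ i j k, bil (fun p q => algebraMap S R (M p q)) (g k) (crs (g i) (g j)) ∈ J)
    (c : Multiset (Fin m ⊕ Fin m)) (d : Multiset (Fin 3 ⊕ Fin 3)) :
    theta S g c (labelMonomial S d * bil (fun p q => C (M p q)) (fun i => X (Sum.inl i))
      fun i => X (Sum.inr i)) ∈ lower S J g (contentWeight c) := by
  have e : bil (fun p q => C (M p q)) (fun i => X (Sum.inl i)) (fun i => X (Sum.inr i)) =
      ∑ e : Fin 3 × Fin 3, C (M e.1 e.2) * labelMonomial S {Sum.inl e.1, Sum.inr e.2} := by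
    rw [bil_eq_sum]
    simp [labelMonomial_cons, labelMonomial_zero, Multiset.insert_eq_cons,
      ← Multiset.cons_zero]
  rw [e]
  refine theta_mul_mem hJ c _ _ d fun e s hs hs' => ?_
  obtain ⟨k, r, rfl, hr⟩ := exists_of_labels_inl_cons (x := e.1) (d := Sum.inr e.2 ::ₘ d)
    (by simpa [Multiset.insert_eq_cons] using hs')
  obtain ⟨i, j, hij, r, rfl, hr'⟩ := exists_of_labels_inr_cons hr
  refine ⟨fun e' => {.single k e'.1, .pair i j hij e'.2}, r, hr', fun e' => rfl, fun e' => ?_, ?_⟩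
  · rw [← hs]
    simp [content, Letter.rows]
  · have := hM i j k
    rw [bil_eq_sum] at this
    simpa [wordValue, Letter.value, Algebra.smul_def] using this

lemma theta_bil_pair_mem (hJ : ∀ i j k, det3 (g i) (g j) (g k) ∈ J) (M : Fin 3 → Fin 3 → S)
    (hM : ∀ i j i' j', bil (fun p q => algebraMap S R (M p q)) (crs (g i) (g j))
      (crs (g i') (g j')) ∈ J)
    (c : Multiset (Fin m ⊕ Fin m)) (d : Multiset (Fin 3 ⊕ Fin 3)) :
    theta S g c (labelMonomial S d * bil (fun p q => C (M p q)) (fun i => X (Sum.inr i))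
      fun i => X (Sum.inr i)) ∈ lower S J g (contentWeight c) := by
  have e : bil (fun p q => C (M p q)) (fun i => X (Sum.inr i)) (fun i => X (Sum.inr i)) =
      ∑ e : Fin 3 × Fin 3, C (M e.1 e.2) * labelMonomial S {Sum.inr e.1, Sum.inr e.2} := by
    rw [bil_eq_sum]
    simp [labelMonomial_cons, labelMonomial_zero, Multiset.insert_eq_cons,
      ← Multiset.cons_zero]
  rw [e]
  refine theta_mul_mem hJ c _ _ d fun e s hs hs' => ?_
  obtain ⟨i', j', hij', r, rfl, hr⟩ :=
    exists_of_labels_inr_cons (x := e.1) (d := Sum.inr e.2 ::ₘ d)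
    (by simpa [Multiset.insert_eq_cons] using hs')
  obtain ⟨i, j, hij, r, rfl, hr'⟩ := exists_of_labels_inr_cons hr
  refine ⟨fun e' => {.pair i' j' hij' e'.1, .pair i j hij e'.2}, r, hr', fun e' => rfl,
    fun e' => ?_, ?_⟩
  · rw [← hs]
    simp [content, Letter.rows]
  · have := hM i' j' i j
    rw [bil_eq_sum] at this
    simpa [wordValue, Letter.value, Algebra.smul_def] using this

/-- The trilinear form with coefficients `D`. -/
def tri {T : Type*} [CommRing T] (D : Fin 3 → Fin 3 → Fin 3 → T) (x y z : Fin 3 → T) : T :=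
  ∑ e : Fin 3 × Fin 3 × Fin 3, D e.1 e.2.1 e.2.2 * (x e.1 * (y e.2.1 * z e.2.2))

lemma theta_tri_mem (hJ : ∀ i j k, det3 (g i) (g j) (g k) ∈ J) (D : Fin 3 → Fin 3 → Fin 3 → S)
    (hD : ∀ i j k, tri (fun p q r => algebraMap S R (D p q r)) (g i) (g j) (g k) ∈ J)
    (c : Multiset (Fin m ⊕ Fin m)) (d : Multiset (Fin 3 ⊕ Fin 3)) :
    theta S g c (labelMonomial S d * tri (fun p q r => C (D p q r)) (fun i => X (Sum.inl i))
      (fun i => X (Sum.inl i)) fun i => X (Sum.inl i)) ∈ lower S J g (contentWeight c) := by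
  have e : tri (fun p q r => C (D p q r)) (fun i => X (Sum.inl i)) (fun i => X (Sum.inl i))
      (fun i => X (Sum.inl i)) = ∑ e : Fin 3 × Fin 3 × Fin 3, C (D e.1 e.2.1 e.2.2) *
        labelMonomial S {Sum.inl e.1, Sum.inl e.2.1, Sum.inl e.2.2} := by
    simp [tri, labelMonomial_cons, labelMonomial_zero, Multiset.insert_eq_cons,
      ← Multiset.cons_zero]
  rw [e]
  refine theta_mul_mem hJ c _ _ d fun e s hs hs' => ?_
  obtain ⟨i, r, rfl, hr⟩ := exists_of_labels_inl_cons (x := e.1)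
    (d := Sum.inl e.2.1 ::ₘ Sum.inl e.2.2 ::ₘ d)
    (by simpa [Multiset.insert_eq_cons] using hs')
  obtain ⟨j, r, rfl, hr'⟩ := exists_of_labels_inl_cons hr
  obtain ⟨k, r, rfl, hr''⟩ := exists_of_labels_inl_cons hr'
  refine ⟨fun e' => {.single i e'.1, .single j e'.2.1, .single k e'.2.2}, r, hr'', fun e' => rfl,
    fun e' => ?_, ?_⟩
  · rw [← hs]
    simp [content, Letter.rows]
  · have := hD i j k
    unfold tri at this
    simpa [wordValue, Letter.value, Algebra.smul_def] using this

end Theta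
section ThetaKernel

open MvPolynomial

variable {m : ℕ} {S R : Type*} [CommRing S] [CommRing R] [Algebra S R] {J : Ideal R}
  {g : Fin m → Fin 3 → R}

/-- The two generic vectors over `S`. -/
noncomputable def qw (S : Type*) [CommRing S] : Fin 3 → MvPolynomial (Fin 3 ⊕ Fin 3) S :=
  fun i => X (Sum.inl i)

/-- The two generic vectors over `S`. -/
noncomputable def qv (S : Type*) [CommRing S] : Fin 3 → MvPolynomial (Fin 3 ⊕ Fin 3) S :=
  fun i => X (Sum.inr i)

/-- The equations of the incidence variety and the determinant, over the base ring `S`. -/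
noncomputable def relGens (a : Fin 3 → Fin 3 → S) : Set (MvPolynomial (Fin 3 ⊕ Fin 3) S) :=
  {dot (qw S) (qv S), dot (qw S) (mv (fun i j => C (a i j)) (qv S)),
    dot (qw S) (mv (fun i j => C (a i j)) (mv (fun i j => C (a i j)) (qv S))),
    det3 (qw S) (rv (qw S) fun i j => C (a i j))
      (rv (rv (qw S) fun i j => C (a i j)) fun i j => C (a i j))} ∪
  Set.range (crs (qv S) (mv (fun i j => C (a i j)) (qv S)))

lemma theta_mul_mem_of_labelMonomial {c : Multiset (Fin m ⊕ Fin m)}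
    {q : MvPolynomial (Fin 3 ⊕ Fin 3) S}
    (h : ∀ d, theta S g c (labelMonomial S d * q) ∈ lower S J g (contentWeight c))
    (p : MvPolynomial (Fin 3 ⊕ Fin 3) S) :
    theta S g c (p * q) ∈ lower S J g (contentWeight c) := by
  rw [p.as_sum, Finset.sum_mul, map_sum]
  refine sum_mem fun e _ => ?_
  have : monomial e (coeff e p) * q =
      coeff e p • (labelMonomial S (Finsupp.toMultiset e) * q) := by
    rw [labelMonomial, Finsupp.toMultiset_toFinsupp, smul_eq_C_mul, ← mul_assoc, C_mul_monomial,
      mul_one]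
  rw [this, map_smul]
  exact Submodule.smul_mem _ _ (h _)

lemma theta_mem_of_mem_span {c : Multiset (Fin m ⊕ Fin m)}
    {G : Set (MvPolynomial (Fin 3 ⊕ Fin 3) S)}
    (h : ∀ q ∈ G, ∀ d, theta S g c (labelMonomial S d * q) ∈ lower S J g (contentWeight c))
    {q : MvPolynomial (Fin 3 ⊕ Fin 3) S} (hq : q ∈ Ideal.span G) :
    theta S g c q ∈ lower S J g (contentWeight c) := by
  induction hq using Submodule.span_induction with
  | mem q hq => simpa using theta_mul_mem_of_labelMonomial (h q hq) 1
  | zero => rw [map_zero]; exact zero_mem _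
  | add p q _ _ hp hq => rw [map_add]; exact add_mem hp hq
  | smul p q hq' hq =>
    clear hq
    induction hq' using Submodule.span_induction generalizing p with
    | mem q hq => exact theta_mul_mem_of_labelMonomial (h q hq) p
    | zero => rw [smul_zero, map_zero]; exact zero_mem _
    | add q q' _ _ hq hq' => rw [smul_add, map_add]; exact add_mem (hq p) (hq' p)
    | smul p' q _ hq => rw [smul_smul]; exact hq (p * p')

/-- The matrix of a cross product form. -/
def crsMat {T : Type*} [CommRing T] (a : Fin 3 → Fin 3 → T) : Fin 3 → Fin 3 → Fin 3 → T :=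
  ![![0, a 2, -a 1], ![-a 2, 0, a 0], ![a 1, -a 0, 0]]

lemma crs_mv_eq_bil {T : Type*} [CommRing T] (a : Fin 3 → Fin 3 → T) (x y : Fin 3 → T)
    (l : Fin 3) : crs x (mv a y) l = bil (crsMat a l) x y := by
  fin_cases l <;> simp [crsMat, bil, mv, dot] <;> ring

lemma map_crsMat {T T' : Type*} [CommRing T] [CommRing T'] (φ : T →+* T')
    (a : Fin 3 → Fin 3 → T) (l p q : Fin 3) :
    φ (crsMat a l p q) = crsMat (fun i j => φ (a i j)) l p q := by
  fin_cases l <;> fin_cases p <;> simp [crsMat]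

/-- The coefficients of `det (x; yα; zα²)`. -/
def detMat {T : Type*} [CommRing T] (a : Fin 3 → Fin 3 → T) (p q r : Fin 3) : T :=
  crs (a q) (rv (a r) a) p

lemma det3_rv_rv {T : Type*} [CommRing T] (a b : Fin 3 → Fin 3 → T) (x y z : Fin 3 → T) :
    det3 x (rv y a) (rv z b) = tri (fun p q r => crs (a q) (b r) p) x y z := by
  simp only [tri, Fintype.sum_prod_type, Fin.sum_univ_three, det3, dot, rv, crs_zero, crs_one,
    crs_two]
  ring

lemma det3_eq_tri {T : Type*} [CommRing T] (a : Fin 3 → Fin 3 → T) (x y z : Fin 3 → T) :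
    det3 x (rv y a) (rv (rv z a) a) = tri (detMat a) x y z := by
  have e : rv (rv z a) a = rv z fun r => rv (a r) a := by
    funext j; simp only [rv]; ring
  rw [e, det3_rv_rv]
  rfl

lemma map_detMat {T T' : Type*} [CommRing T] [CommRing T'] (φ : T →+* T')
    (a : Fin 3 → Fin 3 → T) (p q r : Fin 3) :
    φ (detMat a p q r) = detMat (fun i j => φ (a i j)) p q r := by
  have h1 := congrFun (map_crs φ (a q) (rv (a r) a)) p
  rw [map_rv] at h1
  exact h1

/-- The product of two arrays. -/
def mulMat {T : Type*} [CommRing T] (a b : Fin 3 → Fin 3 → T) : Fin 3 → Fin 3 → T :=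
  fun i => rv (a i) b

lemma bil_mulMat {T : Type*} [CommRing T] (a b : Fin 3 → Fin 3 → T) (x y : Fin 3 → T) :
    bil (mulMat a b) x y = dot x (mv a (mv b y)) := by
  simp only [bil, mulMat, dot, mv, rv]; ring

lemma bil_one {T : Type*} [CommRing T] (x y : Fin 3 → T) :
    bil (fun i j => if i = j then 1 else 0) x y = dot x y := by
  simp [bil, dot, mv]

lemma map_mulMat {T T' : Type*} [CommRing T] [CommRing T'] (φ : T →+* T')
    (a b : Fin 3 → Fin 3 → T) (p q : Fin 3) :
    φ (mulMat a b p q) = mulMat (fun i j => φ (a i j)) (fun i j => φ (b i j)) p q := by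
  simp [mulMat, rv]

/-- The relations are sent to lower weight. -/
lemma theta_mem (a : Fin 3 → Fin 3 → S) (h0 : ∀ i j k, det3 (g i) (g j) (g k) ∈ J)
    (h1 : ∀ i j k, det3 (g i) (g j) (rv (g k) fun p q => algebraMap S R (a p q)) ∈ J)
    (h2 : ∀ i j k, det3 (g i) (g j) (rv (rv (g k) fun p q => algebraMap S R (a p q))
      fun p q => algebraMap S R (a p q)) ∈ J)
    (h3 : ∀ i j k, det3 (g i) (rv (g j) fun p q => algebraMap S R (a p q))
      (rv (rv (g k) fun p q => algebraMap S R (a p q)) fun p q => algebraMap S R (a p q)) ∈ J)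
    (c : Multiset (Fin m ⊕ Fin m)) {q : MvPolynomial (Fin 3 ⊕ Fin 3) S}
    (hq : q ∈ Ideal.span (relGens a)) :
    theta S g c q ∈ lower S J g (contentWeight c) := by
  refine theta_mem_of_mem_span (fun q hq d => ?_) hq
  rcases hq with (rfl | rfl | rfl | rfl) | ⟨l, rfl⟩
  · have := theta_bil_single_mem (S := S) h0 (fun i j => if i = j then 1 else 0)
      (fun i j k => by
        simp only [apply_ite (algebraMap S R), map_one, map_zero]
        rw [bil_one, dot_crs]; exact h0 i j k) c d
    simp only [apply_ite (C : S → MvPolynomial (Fin 3 ⊕ Fin 3) S), map_one, map_zero] at this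
    rwa [bil_one] at this
  · exact theta_bil_single_mem (S := S) h0 a
      (fun i j k => by rw [bil, dot_mv, dot_crs]; exact h1 i j k) c d
  · have := theta_bil_single_mem (S := S) h0 (mulMat a a)
      (fun i j k => by
        simp only [map_mulMat]
        rw [bil_mulMat, dot_mv, dot_mv, dot_crs]; exact h2 i j k) c d
    simp only [map_mulMat] at this
    rwa [bil_mulMat] at this
  · have := theta_tri_mem (S := S) h0 (detMat a)
      (fun i j k => by
        simp only [map_detMat]
        exact (det3_eq_tri (fun p q => algebraMap S R (a p q)) (g i) (g j) (g k)) ▸ h3 i j k) c d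
    simp only [map_detMat] at this
    exact (det3_eq_tri (fun p q => C (a p q)) (qw S) (qw S) (qw S)) ▸ this
  · rw [crs_mv_eq_bil]
    have := theta_bil_pair_mem (S := S) h0 (crsMat a l)
      (fun i j i' j' => by
        simp only [map_crsMat]
        rw [← crs_mv_eq_bil, crs_crs, dot_mv, dot_mv, dot_crs, dot_crs]
        exact sub_mem (J.mul_mem_right _ (h1 _ _ _)) (J.mul_mem_right _ (h1 _ _ _))) c d
    simp only [map_crsMat] at this
    exact this

end ThetaKernel
section Flatten

open MvPolynomial

variable {K : Type*} [Field K] {ε : Type*}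

/-- The generic matrix over the ring of its entries (and of free parameters). -/
noncomputable def genMat (K : Type*) [Field K] (ε : Type*) :
    Fin 3 → Fin 3 → MvPolynomial ((Fin 3 × Fin 3) ⊕ ε) K := fun i j => X (Sum.inl (i, j))

lemma eval_sumAlgEquiv_symm {σ τ : Type*} (p : σ ⊕ τ → K)
    (q : MvPolynomial σ (MvPolynomial τ K)) :
    eval p ((sumAlgEquiv K σ τ).symm q) =
      eval (fun i => p (Sum.inl i)) (map (eval fun i => p (Sum.inr i)) q) := by
  have : (eval p).comp ((sumAlgEquiv K σ τ).symm : MvPolynomial σ (MvPolynomial τ K) →+* _) =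
      (eval fun i => p (Sum.inl i)).comp (map (eval fun i => p (Sum.inr i))) := by
    refine MvPolynomial.ringHom_ext (fun r => ?_) fun i => ?_
    · induction r using MvPolynomial.induction_on with
      | C r =>
        have h := sumAlgEquiv_symm_C_C (R := K) (S₁ := σ) (S₂ := τ) r
        simp only [RingHom.comp_apply, RingHom.coe_coe, map_C, eval_C]
        rw [h, eval_C]
      | add a b ha hb => rw [map_add, map_add, ha, hb, map_add]
      | mul_X a i ha =>
        rw [map_mul, map_mul, ha, map_mul]
        congr 1
        have h := sumAlgEquiv_symm_C_X (R := K) (S₁ := σ) (S₂ := τ) i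
        simp only [RingHom.comp_apply, RingHom.coe_coe, map_C, eval_C, eval_X]
        rw [h, eval_X]
    · have h := sumAlgEquiv_symm_X (R := K) (S₁ := σ) (S₂ := τ) i
      simp only [RingHom.comp_apply, RingHom.coe_coe, map_X, eval_X]
      rw [h, eval_X]
  exact congrArg (fun φ => φ q) this

lemma flatten_C_homogeneous (s : MvPolynomial ((Fin 3 × Fin 3) ⊕ ε) K) :
    IsWeightedHomogeneous (weightV ε)
      ((sumAlgEquiv K (Fin 3 ⊕ Fin 3) ((Fin 3 × Fin 3) ⊕ ε)).symm (C s)) 0 := by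
  induction s using MvPolynomial.induction_on with
  | C r =>
    rw [sumAlgEquiv_symm_C_C]
    exact isWeightedHomogeneous_C _ _
  | add a b ha hb => rw [map_add, map_add]; exact ha.add hb
  | mul_X a i ha =>
    rw [map_mul, map_mul, sumAlgEquiv_symm_C_X]
    exact ha.mul (isWeightedHomogeneous_X K (weightV ε) (Sum.inr i))

lemma flatten_labelMonomial_homogeneous (d : Multiset (Fin 3 ⊕ Fin 3)) :
    IsWeightedHomogeneous (weightV ε)
      ((sumAlgEquiv K (Fin 3 ⊕ Fin 3) ((Fin 3 × Fin 3) ⊕ ε)).symm (labelMonomial _ d))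
      (d.map (Sum.elim 0 1)).sum := by
  induction d using Multiset.induction with
  | empty =>
    rw [labelMonomial_zero, map_one]
    exact isWeightedHomogeneous_one _ _
  | cons x d ih =>
    rw [labelMonomial_cons, map_mul, sumAlgEquiv_symm_X, Multiset.map_cons, Multiset.sum_cons]
    exact (isWeightedHomogeneous_X K (weightV ε) (Sum.inl x)).mul ih

lemma sumAlgEquiv_mem_span_relGens {f : MvPolynomial (Coord ε) K}
    (hf : f ∈ Ideal.span (incidenceGens K ε ∪ {formD X})) :
    sumAlgEquiv K (Fin 3 ⊕ Fin 3) ((Fin 3 × Fin 3) ⊕ ε) f ∈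
      Ideal.span (relGens (genMat K ε)) := by
  obtain ⟨Φ, hΦ⟩ : ∃ Φ : MvPolynomial (Coord ε) K →+*
      MvPolynomial (Fin 3 ⊕ Fin 3) (MvPolynomial ((Fin 3 × Fin 3) ⊕ ε) K),
      ∀ f, Φ f = sumAlgEquiv K (Fin 3 ⊕ Fin 3) ((Fin 3 × Fin 3) ⊕ ε) f :=
    ⟨(sumAlgEquiv K (Fin 3 ⊕ Fin 3) ((Fin 3 × Fin 3) ⊕ ε) : _ →+* _), fun _ => rfl⟩
  rw [← hΦ]
  have hw : pw (fun i => Φ (X i)) = qw _ := by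
    funext i; rw [pw, hΦ]; exact sumAlgEquiv_X_inl ..
  have hv : pv (fun i => Φ (X i)) = qv _ := by
    funext i; rw [pv, hΦ]; exact sumAlgEquiv_X_inl ..
  have ha : pa (fun i => Φ (X i)) = fun i j => C (genMat K ε i j) := by
    funext i j; rw [pa, hΦ]; exact sumAlgEquiv_X_inr ..
  have : Ideal.span (incidenceGens K ε ∪ {formD X}) ≤
      (Ideal.span (relGens (genMat K ε))).comap Φ := by
    rw [Ideal.span_le]
    rintro _ ((⟨k, rfl⟩ | ⟨l, rfl⟩) | rfl)
    · refine Ideal.mem_comap.2 (Ideal.subset_span ?_)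
      rw [map_formF, formF, hw, hv, ha]
      left
      fin_cases k
      · left; rfl
      · right; left; rfl
      · right; right; left; rfl
    · refine Ideal.mem_comap.2 (Ideal.subset_span ?_)
      rw [map_formZ, formZ, hv, ha]
      exact Or.inr ⟨l, rfl⟩
    · refine Ideal.mem_comap.2 (Ideal.subset_span ?_)
      rw [map_formD, formD, hw, ha]
      left; right; right; right; rfl
  exact this hf

lemma mem_span_relGens_of_vanishing [IsAlgClosed K] [Finite ε]
    (q : MvPolynomial (Fin 3 ⊕ Fin 3) (MvPolynomial ((Fin 3 × Fin 3) ⊕ ε) K)) {b : ℕ}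
    (hb : IsWeightedHomogeneous (weightV ε)
      ((sumAlgEquiv K (Fin 3 ⊕ Fin 3) ((Fin 3 × Fin 3) ⊕ ε)).symm q) b)
    (hq : ∀ (x : (Fin 3 × Fin 3) ⊕ ε → K) (w v : Fin 3 → K) (lam : K),
      (∀ i, mv (fun i j => x (Sum.inl (i, j))) v i = lam * v i) → dot w v = 0 →
      w ≠ 0 → v ≠ 0 → eval (Sum.elim w v) (map (eval x) q) = 0) :
    q ∈ Ideal.span (relGens (genMat K ε)) := by
  have h := mem_incidence_of_vanishing _ hb fun p lam h1 h2 h3 h4 => by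
    rw [eval_sumAlgEquiv_symm]
    have := hq (fun i => p (Sum.inr i)) (pw p) (pv p) lam h1 h2
      (Function.ne_iff.2 h3) (Function.ne_iff.2 h4)
    have e : (fun i => p (Sum.inl i)) = Sum.elim (pw p) (pv p) := by
      funext i
      rcases i with i | i <;> rfl
    rwa [e]
  have := sumAlgEquiv_mem_span_relGens h
  rwa [AlgEquiv.apply_symm_apply] at this

end Flatten
section Specialization

open MvPolynomial

variable {K : Type*} [Field K] {T : Type*} {m : ℕ}

/-- Specialize the rows to `u_{i1} w₁ + u_{i2} w₂` with weighted `u`. -/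
noncomputable def spec (x : T → K) (w₁ w₂ : Fin 3 → K) :
    MvPolynomial (Fin m × Fin 3) (MvPolynomial T K) →+*
      Polynomial (MvPolynomial (Fin m ⊕ Fin m) K) :=
  eval₂Hom ((Polynomial.C.comp C).comp (eval x)) fun i =>
    Polynomial.C (C (w₁ i.2) * X (Sum.inl i.1)) * Polynomial.X ^ m +
      Polynomial.C (C (w₂ i.2) * X (Sum.inr i.1)) * Polynomial.X ^ (i.1 : ℕ)

lemma spec_X (x : T → K) (w₁ w₂ : Fin 3 → K) (i : Fin m × Fin 3) :
    spec x w₁ w₂ (X i) = Polynomial.C (C (w₁ i.2) * X (Sum.inl i.1)) * Polynomial.X ^ m +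
      Polynomial.C (C (w₂ i.2) * X (Sum.inr i.1)) * Polynomial.X ^ (i.1 : ℕ) := by
  simp [spec]

lemma spec_C (x : T → K) (w₁ w₂ : Fin 3 → K) (s : MvPolynomial T K) :
    spec (m := m) x w₁ w₂ (C s) = Polynomial.C (C (eval x s)) := by
  simp [spec]

lemma eval_spec (x : T → K) (w₁ w₂ : Fin 3 → K) (u : Fin m ⊕ Fin m → K) (t : K)
    (f : MvPolynomial (Fin m × Fin 3) (MvPolynomial T K)) :
    ((spec x w₁ w₂ f).map (eval u)).eval t =
      eval (fun i => t ^ m * u (Sum.inl i.1) * w₁ i.2 + t ^ (i.1 : ℕ) * u (Sum.inr i.1) * w₂ i.2)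
        (map (eval x) f) := by
  have : ((Polynomial.evalRingHom t).comp (Polynomial.mapRingHom (eval u))).comp
      (spec x w₁ w₂) = (eval (fun i : Fin m × Fin 3 => t ^ m * u (Sum.inl i.1) * w₁ i.2 +
        t ^ (i.1 : ℕ) * u (Sum.inr i.1) * w₂ i.2)).comp (map (eval x)) := by
    refine MvPolynomial.ringHom_ext (fun r => ?_) fun i => ?_
    · simp [spec_C]
    · simp [spec_X]; ring
  exact congrArg (fun φ => φ f) this

lemma spec_eq_zero [Infinite K] (x : T → K) (w₁ w₂ : Fin 3 → K)
    (f : MvPolynomial (Fin m × Fin 3) (MvPolynomial T K))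
    (h : ∀ y : Fin m × Fin 3 → K, (∀ i, dot (fun q => y (i, q)) (crs w₁ w₂) = 0) →
      eval y (map (eval x) f) = 0) : spec x w₁ w₂ f = 0 := by
  ext1 N
  rw [Polynomial.coeff_zero]
  refine MvPolynomial.funext fun u => ?_
  have : (spec x w₁ w₂ f).map (eval u) = 0 := by
    refine Polynomial.funext fun t => ?_
    rw [eval_spec, Polynomial.eval_zero]
    refine h _ fun i => ?_
    simp [dot]; ring
  rw [← Polynomial.coeff_map, this]
  simp

lemma natDegree_coeff_aux {A : Type*} [CommRing A] (p q : A) {a b : ℕ} (h : a < b) :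
    (Polynomial.C p * Polynomial.X ^ b + Polynomial.C q * Polynomial.X ^ a).natDegree ≤ b ∧
    (Polynomial.C p * Polynomial.X ^ b + Polynomial.C q * Polynomial.X ^ a).coeff b = p := by
  refine ⟨Polynomial.natDegree_add_le_of_degree_le (Polynomial.natDegree_C_mul_X_pow_le _ _)
    ((Polynomial.natDegree_C_mul_X_pow_le _ _).trans h.le), ?_⟩
  simp [Polynomial.coeff_X_pow, h.ne']

lemma spec_single (x : T → K) (w₁ w₂ : Fin 3 → K) (k : Fin m) (q : Fin 3) :
    spec x w₁ w₂ ((Letter.single k q).value fun i q => X (i, q)) =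
      Polynomial.C (C (w₁ q) * X (Sum.inl k)) * Polynomial.X ^ m +
        Polynomial.C (C (w₂ q) * X (Sum.inr k)) * Polynomial.X ^ (k : ℕ) := spec_X _ _ _ _

lemma spec_pair (x : T → K) (w₁ w₂ : Fin 3 → K) {i j : Fin m} (h : i < j) (l : Fin 3) :
    spec x w₁ w₂ ((Letter.pair i j h l).value fun i q => X (i, q)) =
      Polynomial.C (C (crs w₁ w₂ l) * (X (Sum.inl i) * X (Sum.inr j))) *
        Polynomial.X ^ (m + (j : ℕ)) +
      Polynomial.C (-(C (crs w₁ w₂ l) * (X (Sum.inr i) * X (Sum.inl j)))) *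
        Polynomial.X ^ (m + (i : ℕ)) := by
  fin_cases l <;> simp [Letter.value, spec_X, pow_add] <;> ring

/-- The leading coefficient of the specialization of a word. -/
lemma spec_wordValue (x : T → K) (w₁ w₂ : Fin 3 → K) (s : Multiset (Letter m)) :
    (spec x w₁ w₂ (wordValue (fun i q => X (i, q)) s)).natDegree ≤ wordWeight s ∧
    (spec x w₁ w₂ (wordValue (fun i q => X (i, q)) s)).coeff (wordWeight s) =
      monomial (Multiset.toFinsupp (content s))
        ((labels s).map (Sum.elim w₁ (crs w₁ w₂))).prod := by
  induction s using Multiset.induction with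
  | empty => simp
  | cons y s ih =>
    obtain ⟨ih1, ih2⟩ := ih
    have key : (spec x w₁ w₂ (y.value fun i q => X (i, q))).natDegree ≤ y.weight ∧
      (spec x w₁ w₂ (y.value fun i q => X (i, q))).coeff y.weight =
        monomial (Multiset.toFinsupp y.rows) (Sum.elim w₁ (crs w₁ w₂) y.label) := by
      cases y with
      | single k q =>
        rw [spec_single]
        refine ⟨(natDegree_coeff_aux _ _ k.isLt).1, (natDegree_coeff_aux _ _ k.isLt).2.trans ?_⟩
        simp [Letter.rows, Letter.label, C_mul_X_eq_monomial]
      | pair i j h l =>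
        rw [spec_pair]
        have hlt : m + (i : ℕ) < m + j := Nat.add_lt_add_left h m
        refine ⟨(natDegree_coeff_aux _ _ hlt).1, (natDegree_coeff_aux _ _ hlt).2.trans ?_⟩
        simp [Letter.rows, Letter.label, Multiset.insert_eq_cons, X, C_mul_monomial, monomial_mul,
          ← Multiset.singleton_add]
    rw [wordValue_cons, map_mul, wordWeight_cons]
    refine ⟨Polynomial.natDegree_mul_le_of_le key.1 ih1, ?_⟩
    rw [Polynomial.coeff_mul_add_eq_of_natDegree_le key.1 ih1, key.2, ih2, monomial_mul,
      content_cons, labels_cons, Multiset.map_cons, Multiset.prod_cons, map_add]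

end Specialization
section Descent

open MvPolynomial

variable {K : Type*} [Field K] {m : ℕ}

lemma labels_sum (s : Multiset (Letter m)) :
    ((labels s).map (Sum.elim 0 1 : Fin 3 ⊕ Fin 3 → ℕ)).sum =
      ((content s).map (Sum.elim 0 1 : Fin m ⊕ Fin m → ℕ)).sum := by
  induction s using Multiset.induction with
  | empty => rfl
  | cons x s ih =>
    rw [labels_cons, content_cons, Multiset.map_add, Multiset.sum_add, Multiset.map_cons,
      Multiset.sum_cons, ih]
    cases x <;> simp [Letter.label, Letter.rows]

lemma exists_crs_eq {w v : Fin 3 → K} (hw : w ≠ 0) (h : dot w v = 0) : ∃ r, crs w r = v := by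
  obtain ⟨q, hq⟩ := Function.ne_iff.1 hw
  have hq' : w q ≠ 0 := hq
  set r : Fin 3 → K := fun i => if i = q then (w q)⁻¹ else 0 with hr
  have h1 : dot w r = 1 := by
    fin_cases q <;> simp_all [dot]
  refine ⟨crs v r, ?_⟩
  funext i
  have e1 := crs_crs v r w i
  have e2 : crs w (crs v r) i = - crs (crs v r) w i := crs_swap _ _ _
  have e3 : dot r w = 1 := by rw [← h1]; simp only [dot]; ring
  have e4 : dot v w = 0 := by rw [← h]; simp only [dot]; ring
  rw [e2, e1, e3, e4]; ring

open Classical in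
lemma coeff_spec_word {T : Type*} (x : T → K) (w₁ w₂ : Fin 3 → K) (a : MvPolynomial T K)
    {s : Multiset (Letter m)} {c : Multiset (Fin m ⊕ Fin m)}
    (hs : wordWeight s ≤ contentWeight c) :
    coeff (Multiset.toFinsupp c)
      ((spec x w₁ w₂ (C a * wordValue (fun i q => X (i, q)) s)).coeff (contentWeight c)) =
      if content s = c then
        eval x a * ((labels s).map (Sum.elim w₁ (crs w₁ w₂))).prod else 0 := by
  rw [map_mul, spec_C, Polynomial.coeff_C_mul, coeff_C_mul]
  obtain ⟨h1, h2⟩ := spec_wordValue x w₁ w₂ s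
  rcases hs.lt_or_eq with h | h
  · rw [Polynomial.coeff_eq_zero_of_natDegree_lt (h1.trans_lt h), coeff_zero, mul_zero, if_neg]
    rintro rfl
    exact h.ne (wordWeight_eq s)
  · rw [← h, h2, coeff_monomial]
    simp only [EmbeddingLike.apply_eq_iff_eq, mul_ite, mul_zero]

variable {ε : Type*}

lemma exists_mem_lower (J : Ideal (MvPolynomial (Fin m × Fin 3)
      (MvPolynomial ((Fin 3 × Fin 3) ⊕ ε) K)))
    (f : MvPolynomial (Fin m × Fin 3) (MvPolynomial ((Fin 3 × Fin 3) ⊕ ε) K)) :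
    ∃ N, f ∈ lower (MvPolynomial ((Fin 3 × Fin 3) ⊕ ε) K) J (fun i q => X (i, q)) N := by
  induction f using MvPolynomial.induction_on with
  | C r =>
    refine ⟨1, ?_⟩
    have := Submodule.smul_mem (lower (MvPolynomial ((Fin 3 × Fin 3) ⊕ ε) K) J
      (fun i q => X (i, q)) 1) r (wordValue_mem_lower (s := 0) (by simp))
    rwa [wordValue_zero, smul_eq_C_mul, mul_one] at this
  | add p q hp hq =>
    obtain ⟨a, ha⟩ := hp
    obtain ⟨b, hb⟩ := hq
    exact ⟨max a b, add_mem (lower_mono (le_max_left _ _) ha) (lower_mono (le_max_right _ _) hb)⟩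
  | mul_X p i hp =>
    obtain ⟨a, ha⟩ := hp
    have := wordValue_mul_mem_lower {Letter.single i.1 i.2} ha
    rw [wordValue_singleton, mul_comm] at this
    exact ⟨_, this⟩

variable [IsAlgClosed K] [Finite ε]

/-- A polynomial in the rows over the coordinate ring of the other entries vanishes whenever
all rows annihilate an eigenvector. -/
def RowVanishing (f : MvPolynomial (Fin m × Fin 3) (MvPolynomial ((Fin 3 × Fin 3) ⊕ ε) K)) :
    Prop :=
  ∀ (x : (Fin 3 × Fin 3) ⊕ ε → K) (y : Fin m × Fin 3 → K) (v : Fin 3 → K) (lam : K), v ≠ 0 →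
    (∀ i, mv (fun i j => x (Sum.inl (i, j))) v i = lam * v i) →
    (∀ i, dot (fun q => y (i, q)) v = 0) → eval y (map (eval x) f) = 0

open Classical in
lemma content_part_mem {F : Finset (Multiset (Letter m))}
    {l : Multiset (Letter m) → MvPolynomial ((Fin 3 × Fin 3) ⊕ ε) K}
    {c : Multiset (Fin m ⊕ Fin m)} (hF : ∀ s ∈ F, wordWeight s ≤ contentWeight c)
    (hv : RowVanishing (∑ s ∈ F, C (l s) * wordValue (fun i q => X (i, q)) s)) :
    ∑ s ∈ F with content s = c, C (l s) * labelMonomial _ (labels s) ∈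
      Ideal.span (relGens (genMat K ε)) := by
  refine mem_span_relGens_of_vanishing _
    (b := (c.map (Sum.elim 0 1 : Fin m ⊕ Fin m → ℕ)).sum) ?_ ?_
  · rw [map_sum]
    refine IsWeightedHomogeneous.sum _ _ _ fun s hs => ?_
    rw [map_mul, ← (Finset.mem_filter.1 hs).2, ← labels_sum, ← zero_add (Multiset.sum _)]
    exact (flatten_C_homogeneous _).mul (flatten_labelMonomial_homogeneous _)
  · intro x w v lam hx hwv hw hv0
    obtain ⟨r, rfl⟩ := exists_crs_eq hw hwv
    have h0 : spec x w r (∑ s ∈ F, C (l s) * wordValue (fun i q => X (i, q)) s) = 0 :=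
      spec_eq_zero x w r _ fun y hy => hv x y _ lam hv0 hx hy
    have h1 := congrArg (fun p => coeff (Multiset.toFinsupp c)
      (Polynomial.coeff p (contentWeight c))) h0
    simp only [map_sum, Polynomial.finsetSum_coeff, coeff_sum, Polynomial.coeff_zero,
      coeff_zero] at h1
    rw [Finset.sum_congr rfl fun s hs => coeff_spec_word x w r (l s) (hF s hs),
      ← Finset.sum_filter] at h1
    rw [map_sum, map_sum, ← h1]
    refine Finset.sum_congr rfl fun s _ => ?_
    rw [map_mul, map_mul, map_C, eval_C]
    congr 1
    rw [labelMonomial, map_monomial, eval_monomial, map_one, one_mul]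
    simp [Finsupp.prod, Finset.prod_multiset_map_count]

open Classical in
lemma descent_step {J : Ideal (MvPolynomial (Fin m × Fin 3) (MvPolynomial ((Fin 3 × Fin 3) ⊕ ε) K))}
    (h0 : ∀ i j k, det3 (fun q => X (i, q)) (fun q => X (j, q)) (fun q => X (k, q)) ∈ J)
    (h1 : ∀ i j k, det3 (fun q => X (i, q)) (fun q => X (j, q))
      (rv (fun q => X (k, q)) fun p q => C (genMat K ε p q)) ∈ J)
    (h2 : ∀ i j k, det3 (fun q => X (i, q)) (fun q => X (j, q))
      (rv (rv (fun q => X (k, q)) fun p q => C (genMat K ε p q))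
        fun p q => C (genMat K ε p q)) ∈ J)
    (h3 : ∀ i j k, det3 (fun q => X (i, q)) (rv (fun q => X (j, q)) fun p q => C (genMat K ε p q))
      (rv (rv (fun q => X (k, q)) fun p q => C (genMat K ε p q))
        fun p q => C (genMat K ε p q)) ∈ J)
    (hJ : ∀ f ∈ J, RowVanishing f) {N : ℕ}
    {f : MvPolynomial (Fin m × Fin 3) (MvPolynomial ((Fin 3 × Fin 3) ⊕ ε) K)}
    (hf : RowVanishing f)
    (hN : f ∈ lower (MvPolynomial ((Fin 3 × Fin 3) ⊕ ε) K) J (fun i q => X (i, q)) (N + 1)) :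
    f ∈ lower (MvPolynomial ((Fin 3 × Fin 3) ⊕ ε) K) J (fun i q => X (i, q)) N := by
  obtain ⟨j, hj, z, hz, rfl⟩ := Submodule.mem_sup.1 hN
  refine add_mem (ideal_le_lower hj) ?_
  have hzv : RowVanishing z := by
    intro x y v lam hv hx hy
    have e1 := hf x y v lam hv hx hy
    rw [map_add, map_add, hJ j hj x y v lam hv hx hy, zero_add] at e1
    exact e1
  obtain ⟨l, hl, rfl⟩ := (Finsupp.mem_span_image_iff_linearCombination _).1 hz
  have hl' : ∀ s ∈ l.support, wordWeight s < N + 1 := fun s hs => hl hs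
  rw [Finsupp.linearCombination_apply, Finsupp.sum] at hzv ⊢
  simp only [smul_eq_C_mul] at hzv ⊢
  rw [← Finset.sum_filter_add_sum_filter_not _ (fun s => wordWeight s < N)]
  refine add_mem (sum_mem fun s hs => ?_) ?_
  · rw [← smul_eq_C_mul]
    exact Submodule.smul_mem _ _ (wordValue_mem_lower (Finset.mem_filter.1 hs).2)
  rw [← Finset.sum_fiberwise_of_maps_to (g := content) (t := (l.support.filter
    fun s => ¬ wordWeight s < N).image content) fun s hs => Finset.mem_image_of_mem _ hs]
  refine sum_mem fun c hc => ?_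
  obtain ⟨t, ht, rfl⟩ := Finset.mem_image.1 hc
  have ht' := Finset.mem_filter.1 ht
  have htN : contentWeight (content t) = N := by
    have := hl' t ht'.1
    have h4 := ht'.2
    have h5 : wordWeight t = contentWeight (content t) := wordWeight_eq t
    omega
  have hfil : (l.support.filter fun s => ¬ wordWeight s < N).filter
      (fun s => content s = content t) = l.support.filter fun s => content s = content t := by
    ext s
    simp only [Finset.mem_filter, and_congr_left_iff, and_iff_left_iff_imp]
    intro hs _
    have h5 : wordWeight s = contentWeight (content s) := wordWeight_eq s
    rw [hs, htN] at h5
    omega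
  rw [hfil]
  have key := content_part_mem (c := content t) (fun s hs => by
    have := hl' s hs; omega) hzv
  have key2 := theta_mem (genMat K ε) (g := fun i q => X (i, q)) h0 h1 h2 h3 (content t) key
  rw [htN, map_sum] at key2
  refine (Submodule.sub_mem_iff_right _ key2).1 ?_
  rw [← Finset.sum_sub_distrib]
  refine sum_mem fun s hs => ?_
  rw [← smul_eq_C_mul, ← smul_eq_C_mul, map_smul, ← smul_sub]
  have := theta_labels (S := MvPolynomial ((Fin 3 × Fin 3) ⊕ ε) K)
    (g := fun i q => X (i, q)) h0 s
  rw [(Finset.mem_filter.1 hs).2, htN] at this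
  exact Submodule.smul_mem _ _ this

/-- The equations `h0`--`h3` generate the ideal of the (affine cone over the) Kalman variety. -/
theorem mem_of_rowVanishing
    {J : Ideal (MvPolynomial (Fin m × Fin 3) (MvPolynomial ((Fin 3 × Fin 3) ⊕ ε) K))}
    (h0 : ∀ i j k, det3 (fun q => X (i, q)) (fun q => X (j, q)) (fun q => X (k, q)) ∈ J)
    (h1 : ∀ i j k, det3 (fun q => X (i, q)) (fun q => X (j, q))
      (rv (fun q => X (k, q)) fun p q => C (genMat K ε p q)) ∈ J)
    (h2 : ∀ i j k, det3 (fun q => X (i, q)) (fun q => X (j, q))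
      (rv (rv (fun q => X (k, q)) fun p q => C (genMat K ε p q))
        fun p q => C (genMat K ε p q)) ∈ J)
    (h3 : ∀ i j k, det3 (fun q => X (i, q)) (rv (fun q => X (j, q)) fun p q => C (genMat K ε p q))
      (rv (rv (fun q => X (k, q)) fun p q => C (genMat K ε p q))
        fun p q => C (genMat K ε p q)) ∈ J)
    (hJ : ∀ f ∈ J, RowVanishing f)
    {f : MvPolynomial (Fin m × Fin 3) (MvPolynomial ((Fin 3 × Fin 3) ⊕ ε) K)}
    (hf : RowVanishing f) : f ∈ J := by
  obtain ⟨N, hN⟩ := exists_mem_lower J f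
  induction N with
  | zero =>
    simpa [lower] using hN
  | succ N ih => exact ih (descent_step h0 h1 h2 h3 hJ hf hN)

end Descent
section Generators

variable {R : Type*} [CommRing R] {m : ℕ} (a : Fin 3 → Fin 3 → R) (g : Fin m → Fin 3 → R)

lemma det3_derivation (u v w : Fin 3 → R) :
    det3 (rv u a) v w + det3 u (rv v a) w + det3 u v (rv w a) = tr3 a * det3 u v w := by
  simp only [det3, dot, crs_zero, crs_one, crs_two, rv, tr3]; ring

lemma det3_derivation_two (u v w : Fin 3 → R) :
    det3 (rv u a) (rv v a) w + det3 (rv u a) v (rv w a) + det3 u (rv v a) (rv w a) =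
      mi3 a * det3 u v w := by
  simp only [det3, dot, crs_zero, crs_one, crs_two, rv, mi3]; ring

lemma det3_rv (u v w : Fin 3 → R) :
    det3 (rv u a) (rv v a) (rv w a) = det3 (a 0) (a 1) (a 2) * det3 u v w := by
  simp only [det3, dot, crs_zero, crs_one, crs_two, rv]; ring

lemma det3_rv_rv_rv (u v w : Fin 3 → R) :
    det3 u v (rv (rv (rv w a) a) a) = tr3 a * det3 u v (rv (rv w a) a) -
      mi3 a * det3 u v (rv w a) + det3 (a 0) (a 1) (a 2) * det3 u v w := by
  rw [show rv (rv (rv w a) a) a = fun j => tr3 a * rv (rv w a) a j - mi3 a * rv w a j +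
    det3 (a 0) (a 1) (a 2) * w j from funext fun j => rv_rv_rv ..]
  simp only [det3, dot]; ring

lemma det3_swap_left (u v w : Fin 3 → R) : det3 v u w = -det3 u v w := by
  simp only [det3, dot, crs_zero, crs_one, crs_two]; ring

lemma det3_swap_right (u v w : Fin 3 → R) : det3 u w v = -det3 u v w := by
  simp only [det3, dot, crs_zero, crs_one, crs_two]; ring

lemma det3_self_left (u w : Fin 3 → R) : det3 u u w = 0 := by
  simp only [det3, dot, crs_zero, crs_one, crs_two]; ring

lemma det3_self_right (u w : Fin 3 → R) : det3 u w w = 0 := by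
  simp only [det3, dot, crs_zero, crs_one, crs_two]; ring

/-- The minimal generators, indexed by triples of rows. -/
def gen (t : Fin m × Fin m × Fin m) : R :=
  if t.1 ≤ t.2.1 then
    if t.2.1 ≤ t.2.2 then det3 (g t.1) (rv (g t.2.1) a) (rv (rv (g t.2.2) a) a)
    else det3 (g t.1) (rv (g t.2.1) a) (rv (g t.2.2) a)
  else
    if t.2.1 ≤ t.2.2 then det3 (g t.1) (g t.2.1) (rv (g t.2.2) a)
    else det3 (g t.1) (g t.2.1) (g t.2.2)

variable {a g} {N : AddSubgroup R}

lemma of_sorted {P : Fin m → Fin m → Fin m → Prop} (h12 : ∀ i j k, P i j k → P j i k)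
    (h23 : ∀ i j k, P i j k → P i k j) (h : ∀ i j k, i ≤ j → j ≤ k → P i j k) (i j k : Fin m) :
    P i j k := by
  rcases le_total i j with h1 | h1 <;> rcases le_total j k with h2 | h2 <;>
    rcases le_total i k with h3 | h3
  · exact h _ _ _ h1 h2
  · exact h _ _ _ h1 h2
  · exact h23 _ _ _ (h _ _ _ h3 h2)
  · exact h23 _ _ _ (h12 _ _ _ (h _ _ _ h3 h1))
  · exact h12 _ _ _ (h _ _ _ h1 h3)
  · exact h12 _ _ _ (h23 _ _ _ (h _ _ _ h2 h3))
  · exact h12 _ _ _ (h23 _ _ _ (h12 _ _ _ (h _ _ _ h2 h1)))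
  · exact h12 _ _ _ (h23 _ _ _ (h12 _ _ _ (h _ _ _ h2 h1)))

lemma det3_mem (hN : ∀ t, gen a g t ∈ N) (i j k : Fin m) : det3 (g i) (g j) (g k) ∈ N := by
  have h12 : ∀ i j k, det3 (g i) (g j) (g k) ∈ N → det3 (g j) (g i) (g k) ∈ N :=
    fun i j k h => by rw [det3_swap_left]; exact neg_mem h
  have h23 : ∀ i j k, det3 (g i) (g j) (g k) ∈ N → det3 (g i) (g k) (g j) ∈ N :=
    fun i j k h => by rw [det3_swap_right]; exact neg_mem h
  refine of_sorted h12 h23 (fun i j k h1 h2 => ?_) i j k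
  rcases h1.eq_or_lt with rfl | h1
  · rw [det3_self_left]; exact zero_mem _
  rcases h2.eq_or_lt with rfl | h2
  · rw [det3_self_right]; exact zero_mem _
  have := hN (k, j, i)
  rw [gen, if_neg (not_le.2 h2), if_neg (not_le.2 h1)] at this
  exact h12 _ _ _ (h23 _ _ _ (h12 _ _ _ this))

lemma det3_one_mem (hN : ∀ t, gen a g t ∈ N) (ht : ∀ x ∈ N, tr3 a * x ∈ N) (i j k : Fin m) :
    det3 (g i) (g j) (rv (g k) a) ∈ N := by
  have h12 : ∀ i j k, det3 (g i) (g j) (rv (g k) a) ∈ N → det3 (g j) (g i) (rv (g k) a) ∈ N :=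
    fun i j k h => by rw [det3_swap_left]; exact neg_mem h
  have base : ∀ i j k, j < i → j ≤ k → det3 (g i) (g j) (rv (g k) a) ∈ N := fun i j k h1 h2 => by
    have := hN (i, j, k)
    rwa [gen, if_neg (not_le.2 h1), if_pos h2] at this
  have key : ∀ i j k, j < i → det3 (g i) (g j) (rv (g k) a) ∈ N := fun i j k h1 => by
    rcases le_or_gt j k with h2 | h2
    · exact base _ _ _ h1 h2
    · have e := det3_derivation a (g i) (g j) (g k)
      rw [← det3_rot (rv (g i) a), det3_rot (g k) (g i) (rv (g j) a)] at e
      have e1 := base j k i h2 (h2.trans h1).le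
      have e2 := h12 _ _ _ (base i k j (h2.trans h1) h2.le)
      have e3 := ht _ (det3_mem hN i j k)
      rw [← e] at e3
      exact (add_mem_cancel_left (add_mem e1 e2)).1 e3
  rcases lt_trichotomy i j with h | rfl | h
  · exact h12 _ _ _ (key _ _ _ h)
  · rw [det3_self_left]; exact zero_mem _
  · exact key _ _ _ h

lemma det3_one_one_mem (hN : ∀ t, gen a g t ∈ N) (hm : ∀ x ∈ N, mi3 a * x ∈ N) (i j k : Fin m) :
    det3 (g i) (rv (g j) a) (rv (g k) a) ∈ N := by
  have h23 : ∀ i j k, det3 (g i) (rv (g j) a) (rv (g k) a) ∈ N →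
      det3 (g i) (rv (g k) a) (rv (g j) a) ∈ N :=
    fun i j k h => by rw [det3_swap_right]; exact neg_mem h
  have base : ∀ i j k, i ≤ j → k < j → det3 (g i) (rv (g j) a) (rv (g k) a) ∈ N :=
    fun i j k h1 h2 => by
      have := hN (i, j, k)
      rwa [gen, if_pos h1, if_neg (not_le.2 h2)] at this
  have key : ∀ i j k, k < j → det3 (g i) (rv (g j) a) (rv (g k) a) ∈ N := fun i j k h2 => by
    rcases le_or_gt i j with h1 | h1
    · exact base _ _ _ h1 h2
    · have e := det3_derivation_two a (g i) (g j) (g k)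
      rw [det3_rot (g k) (rv (g i) a) (rv (g j) a), ← det3_rot (rv (g i) a) (g j)] at e
      have e1 := base k i j (h2.trans h1).le h1
      have e2 := h23 _ _ _ (base j i k h1.le (h2.trans h1))
      have e3 := hm _ (det3_mem hN i j k)
      rw [← e] at e3
      exact (add_mem_cancel_left (add_mem e1 e2)).1 e3
  rcases lt_trichotomy k j with h | rfl | h
  · exact key _ _ _ h
  · rw [det3_self_right]; exact zero_mem _
  · exact h23 _ _ _ (key _ _ _ h)

lemma det3_two_mem (hN : ∀ t, gen a g t ∈ N) (ht : ∀ x ∈ N, tr3 a * x ∈ N)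
    (hm : ∀ x ∈ N, mi3 a * x ∈ N) (i j k : Fin m) :
    det3 (g i) (g j) (rv (rv (g k) a) a) ∈ N := by
  have e := det3_derivation a (g i) (g j) (rv (g k) a)
  rw [det3_swap_left (g j) (rv (g i) a)] at e
  have e3 := ht _ (det3_one_mem hN ht i j k)
  rw [← e] at e3
  exact (add_mem_cancel_left (add_mem (neg_mem (det3_one_one_mem hN hm j i k))
    (det3_one_one_mem hN hm i j k))).1 e3

lemma det3_one_two_mem (hN : ∀ t, gen a g t ∈ N) (ht : ∀ x ∈ N, tr3 a * x ∈ N)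
    (hm : ∀ x ∈ N, mi3 a * x ∈ N) (hd : ∀ x ∈ N, det3 (a 0) (a 1) (a 2) * x ∈ N)
    (i j k : Fin m) : det3 (g i) (rv (g j) a) (rv (rv (g k) a) a) ∈ N := by
  have h12 : ∀ i j k, det3 (g i) (rv (g j) a) (rv (rv (g k) a) a) ∈ N →
      det3 (g j) (rv (g i) a) (rv (rv (g k) a) a) ∈ N := fun i j k h => by
    have e := det3_derivation a (g i) (g j) (rv (rv (g k) a) a)
    rw [det3_swap_left (g j) (rv (g i) a), det3_rv_rv_rv] at e
    have e1 : det3 (g j) (rv (g i) a) (rv (rv (g k) a) a) =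
        det3 (g i) (rv (g j) a) (rv (rv (g k) a) a) - mi3 a * det3 (g i) (g j) (rv (g k) a) +
          det3 (a 0) (a 1) (a 2) * det3 (g i) (g j) (g k) := by
      linear_combination -e
    rw [e1]
    exact add_mem (sub_mem h (hm _ (det3_one_mem hN ht i j k))) (hd _ (det3_mem hN i j k))
  have h23 : ∀ i j k, det3 (g i) (rv (g j) a) (rv (rv (g k) a) a) ∈ N →
      det3 (g i) (rv (g k) a) (rv (rv (g j) a) a) ∈ N := fun i j k h => by
    have e := det3_derivation a (g i) (rv (g j) a) (rv (g k) a)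
    rw [det3_rv, det3_swap_right (g i) (rv (g k) a)] at e
    have e1 : det3 (g i) (rv (g k) a) (rv (rv (g j) a) a) =
        det3 (g i) (rv (g j) a) (rv (rv (g k) a) a) +
          det3 (a 0) (a 1) (a 2) * det3 (g i) (g j) (g k) -
          tr3 a * det3 (g i) (rv (g j) a) (rv (g k) a) := by
      linear_combination -e
    rw [e1]
    exact sub_mem (add_mem h (hd _ (det3_mem hN i j k))) (ht _ (det3_one_one_mem hN hm i j k))
  refine of_sorted h12 h23 (fun i j k h1 h2 => ?_) i j k
  have := hN (i, j, k)
  rwa [gen, if_pos h1, if_pos h2] at this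

lemma map_gen {R' : Type*} [CommRing R'] (φ : R →+* R') (a : Fin 3 → Fin 3 → R)
    (g : Fin m → Fin 3 → R) (t : Fin m × Fin m × Fin m) :
    φ (gen a g t) = gen (fun i j => φ (a i j)) (fun i j => φ (g i j)) t := by
  unfold gen
  split_ifs <;> simp only [map_det3, map_rv]

end Generators
section Counting

/-- The degree of the generator indexed by a triple. -/
def genDeg {m : ℕ} (t : Fin m × Fin m × Fin m) : ℕ :=
  if t.1 ≤ t.2.1 then if t.2.1 ≤ t.2.2 then 6 else 5 else if t.2.1 ≤ t.2.2 then 4 else 3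

lemma card_triples {m : ℕ} (P Q : Fin m → Fin m → Prop) [DecidableRel P] [DecidableRel Q] :
    Fintype.card {t : Fin m × Fin m × Fin m // P t.1 t.2.1 ∧ Q t.2.1 t.2.2} =
      ∑ j, (Finset.univ.filter fun i => P i j).card * (Finset.univ.filter fun k => Q j k).card := by
  have e : {t : Fin m × Fin m × Fin m // P t.1 t.2.1 ∧ Q t.2.1 t.2.2} ≃
      Σ j, {i // P i j} × {k // Q j k} :=
    { toFun := fun t => ⟨t.1.2.1, ⟨t.1.1, t.2.1⟩, ⟨t.1.2.2, t.2.2⟩⟩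
      invFun := fun t => ⟨(t.2.1, t.1, t.2.2), t.2.1.2, t.2.2.2⟩
      left_inv := fun _ => rfl
      right_inv := fun _ => rfl }
  rw [Fintype.card_congr e, Fintype.card_sigma]
  simp only [Fintype.card_prod, Fintype.card_subtype]

lemma sum_succ_mul (m : ℕ) : ∑ j ∈ Finset.range m, (j + 1) * j = 2 * (m + 1).choose 3 := by
  induction m with
  | zero => rfl
  | succ m ih =>
    rw [Finset.sum_range_succ, ih, Nat.choose_succ_succ' (m + 1) 2]
    have := Nat.add_one_mul_choose_eq m 1
    simp only [Nat.choose_one_right] at this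
    linarith

lemma sum_mul_sub (m : ℕ) : ∑ j ∈ Finset.range m, (m - 1 - j) * j = m.choose 3 := by
  induction m with
  | zero => rfl
  | succ m ih =>
    have h : ∀ j ∈ Finset.range m, (m + 1 - 1 - j) * j = (m - 1 - j) * j + j := fun j hj => by
      have := Finset.mem_range.1 hj
      rw [show m + 1 - 1 - j = m - 1 - j + 1 by omega]; ring
    rw [Finset.sum_range_succ, Finset.sum_congr rfl h, Finset.sum_add_distrib, ih,
      Finset.sum_range_id, ← Nat.choose_two_right, Nat.choose_succ_succ' m 2]
    simp [add_comm]

lemma sum_succ_mul_sub (m : ℕ) :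
    ∑ j ∈ Finset.range m, (j + 1) * (m - j) = (m + 2).choose 3 := by
  induction m with
  | zero => rfl
  | succ m ih =>
    have h : ∀ j ∈ Finset.range m, (j + 1) * (m + 1 - j) = (j + 1) * (m - j) + (j + 1) :=
      fun j hj => by
        have := Finset.mem_range.1 hj
        rw [show m + 1 - j = m - j + 1 by omega]; ring
    have h2 : ∑ j ∈ Finset.range (m + 1), (j + 1) = (m + 2).choose 2 := by
      have := Finset.sum_range_succ' (fun j => j) (m + 1)
      rw [Nat.choose_two_right, ← Finset.sum_range_id, this, add_zero]
    rw [Finset.sum_range_succ] at h2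
    rw [Finset.sum_range_succ, Finset.sum_congr rfl h, Finset.sum_add_distrib, ih,
      show m + 1 + 2 = m + 2 + 1 from rfl, Nat.choose_succ_succ' (m + 2) 2, ← h2]
    rw [show m + 1 - m = 1 by omega]; ring

lemma card_le {m : ℕ} (j : Fin m) : (Finset.univ.filter fun i => i ≤ j).card = j + 1 := by
  have := Fin.card_Iic j
  rwa [show Finset.Iic j = Finset.univ.filter fun i => i ≤ j by ext; simp] at this

lemma card_ge {m : ℕ} (j : Fin m) : (Finset.univ.filter fun i => j ≤ i).card = m - j := by
  have := Fin.card_Ici j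
  rwa [show Finset.Ici j = Finset.univ.filter fun i => j ≤ i by ext; simp] at this

lemma card_lt {m : ℕ} (j : Fin m) : (Finset.univ.filter fun i => i < j).card = j := by
  have := Fin.card_Iio j
  rwa [show Finset.Iio j = Finset.univ.filter fun i => i < j by ext; simp] at this

lemma card_gt {m : ℕ} (j : Fin m) : (Finset.univ.filter fun i => j < i).card = m - 1 - j := by
  have := Fin.card_Ioi j
  rwa [show Finset.Ioi j = Finset.univ.filter fun i => j < i by ext; simp] at this

lemma card_genDeg_three (m : ℕ) :
    Nat.card {t : Fin m × Fin m × Fin m // genDeg t = 3} = m.choose 3 := by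
  rw [← sum_mul_sub, ← Fin.sum_univ_eq_sum_range (fun j => (m - 1 - j) * j),
    ← Finset.sum_congr rfl fun j _ => by rw [← card_gt j, ← card_lt j], ← card_triples,
    Nat.card_eq_fintype_card]
  refine Fintype.card_congr (Equiv.subtypeEquivRight fun t => ?_)
  unfold genDeg
  split_ifs <;> simp_all [not_lt_of_ge]

lemma card_genDeg_four (m : ℕ) :
    Nat.card {t : Fin m × Fin m × Fin m // genDeg t = 4} = 2 * (m + 1).choose 3 := by
  have h : ∀ j ∈ Finset.range m, (m - 1 - j + 1) * (m - 1 - j) = (m - 1 - j) * (m - j) :=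
    fun j hj => by
      have := Finset.mem_range.1 hj
      rw [show m - j = m - 1 - j + 1 by omega]; ring
  rw [← sum_succ_mul, ← Finset.sum_range_reflect, Finset.sum_congr rfl h,
    ← Fin.sum_univ_eq_sum_range (fun j => (m - 1 - j) * (m - j)),
    ← Finset.sum_congr rfl fun j _ => by rw [← card_gt j, ← card_ge j], ← card_triples,
    Nat.card_eq_fintype_card]
  refine Fintype.card_congr (Equiv.subtypeEquivRight fun t => ?_)
  unfold genDeg
  split_ifs <;> simp_all [not_lt_of_ge]

lemma card_genDeg_five (m : ℕ) :
    Nat.card {t : Fin m × Fin m × Fin m // genDeg t = 5} = 2 * (m + 1).choose 3 := by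
  rw [← sum_succ_mul, ← Fin.sum_univ_eq_sum_range (fun j => (j + 1) * j),
    ← Finset.sum_congr rfl fun j _ => by rw [← card_le j, ← card_lt j], ← card_triples,
    Nat.card_eq_fintype_card]
  refine Fintype.card_congr (Equiv.subtypeEquivRight fun t => ?_)
  unfold genDeg
  split_ifs <;> simp_all [not_lt_of_ge]

lemma card_genDeg_six (m : ℕ) :
    Nat.card {t : Fin m × Fin m × Fin m // genDeg t = 6} = (m + 2).choose 3 := by
  rw [← sum_succ_mul_sub, ← Fin.sum_univ_eq_sum_range (fun j => (j + 1) * (m - j)),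
    ← Finset.sum_congr rfl fun j _ => by rw [← card_le j, ← card_ge j], ← card_triples,
    Nat.card_eq_fintype_card]
  refine Fintype.card_congr (Equiv.subtypeEquivRight fun t => ?_)
  unfold genDeg
  split_ifs <;> simp_all

lemma card_genDeg_other (m j : ℕ) (h3 : j ≠ 3) (h4 : j ≠ 4) (h5 : j ≠ 5) (h6 : j ≠ 6) :
    Nat.card {t : Fin m × Fin m × Fin m // genDeg t = j} = 0 := by
  have : IsEmpty {t : Fin m × Fin m × Fin m // genDeg t = j} := ⟨fun ⟨t, ht⟩ => by
    unfold genDeg at ht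
    split_ifs at ht <;> omega⟩
  exact Nat.card_of_isEmpty

end Counting

section Homogeneity

open MvPolynomial

variable {K : Type*} [Field K] {σ : Type*} {m : ℕ}

lemma det3_isHomogeneous {x y z : Fin 3 → MvPolynomial σ K} {p q r : ℕ}
    (hx : ∀ i, (x i).IsHomogeneous p) (hy : ∀ i, (y i).IsHomogeneous q)
    (hz : ∀ i, (z i).IsHomogeneous r) : (det3 x y z).IsHomogeneous (p + q + r) := by
  have h : ∀ i, (crs x y i).IsHomogeneous (p + q) := fun i => by
    fin_cases i <;> exact ((hx _).mul (hy _)).sub ((hx _).mul (hy _))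
  exact (((h 0).mul (hz 0)).add ((h 1).mul (hz 1))).add ((h 2).mul (hz 2))

lemma rv_isHomogeneous {x : Fin 3 → MvPolynomial σ K} {a : Fin 3 → Fin 3 → MvPolynomial σ K}
    {p : ℕ} (hx : ∀ i, (x i).IsHomogeneous p) (ha : ∀ i j, (a i j).IsHomogeneous 1) (i : Fin 3) :
    (rv x a i).IsHomogeneous (p + 1) :=
  (((hx 0).mul (ha 0 i)).add ((hx 1).mul (ha 1 i))).add ((hx 2).mul (ha 2 i))

lemma gen_isHomogeneous {a : Fin 3 → Fin 3 → MvPolynomial σ K} {g : Fin m → Fin 3 → MvPolynomial σ K}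
    (ha : ∀ i j, (a i j).IsHomogeneous 1) (hg : ∀ i j, (g i j).IsHomogeneous 1)
    (t : Fin m × Fin m × Fin m) : (gen a g t).IsHomogeneous (genDeg t) := by
  have h1 := fun i => rv_isHomogeneous (hg i) ha
  have h2 := fun i => rv_isHomogeneous (h1 i) ha
  unfold gen genDeg
  split_ifs
  · exact det3_isHomogeneous (hg _) (h1 _) (h2 _)
  · exact det3_isHomogeneous (hg _) (h1 _) (h1 _)
  · exact det3_isHomogeneous (hg _) (hg _) (h1 _)
  · exact det3_isHomogeneous (hg _) (hg _) (hg _)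

lemma gen_isHomogeneous_rows {a : Fin 3 → Fin 3 → MvPolynomial σ K}
    {g : Fin m → Fin 3 → MvPolynomial σ K}
    (ha : ∀ i j, (a i j).IsHomogeneous 0) (hg : ∀ i j, (g i j).IsHomogeneous 1)
    (t : Fin m × Fin m × Fin m) : (gen a g t).IsHomogeneous 3 := by
  have h : ∀ x : Fin 3 → MvPolynomial σ K, (∀ i, (x i).IsHomogeneous 1) →
      ∀ i, (rv x a i).IsHomogeneous 1 := fun x hx i =>
    (((hx 0).mul (ha 0 i)).add ((hx 1).mul (ha 1 i))).add ((hx 2).mul (ha 2 i))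
  have h1 := fun i => h _ (hg i)
  have h2 := fun i => h _ (h1 i)
  unfold gen
  split_ifs
  · exact det3_isHomogeneous (hg _) (h1 _) (h2 _)
  · exact det3_isHomogeneous (hg _) (h1 _) (h1 _)
  · exact det3_isHomogeneous (hg _) (hg _) (h1 _)
  · exact det3_isHomogeneous (hg _) (hg _) (hg _)

end Homogeneity

section Independence

open MvPolynomial

variable {K : Type*} [Field K] {m : ℕ}

/-- The diagonal array with entries `d`. -/
noncomputable def diagC (σ : Type*) (d : Fin 3 → K) : Fin 3 → Fin 3 → MvPolynomial σ K :=
  fun i j => C (if i = j then d i else 0)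

lemma det3_diag {σ : Type*} (d : Fin 3 → K) (u v w : Fin 3 → MvPolynomial σ K) :
    C ((d 1 - d 0) * (d 2 - d 0) * (d 2 - d 1)) * (u 0 * v 1 * w 2) =
      det3 u (rv v (diagC σ d)) (rv (rv w (diagC σ d)) (diagC σ d)) -
      C (d 0 + d 1) * det3 u (rv v (diagC σ d)) (rv w (diagC σ d)) -
      C (d 0 * d 1) * det3 u w (rv v (diagC σ d)) -
      C (d 0) * det3 u v (rv (rv w (diagC σ d)) (diagC σ d)) +
      C (d 0 * (d 0 + d 1)) * det3 u v (rv w (diagC σ d)) -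
      C (d 0 * d 0 * d 1) * det3 u v w := by
  simp only [det3, dot, crs_zero, crs_one, crs_two, rv, diagC, C_mul, C_add, C_sub, Fin.isValue,
    Fin.reduceEq, if_true, if_false, C_0]
  ring

lemma linearIndependent_gen {d : Fin 3 → K} (hd : Function.Injective d) :
    LinearIndependent K (gen (diagC (Fin m × Fin 3) d) fun (i : Fin m) q => X (i, q)) := by
  set g : Fin m → Fin 3 → MvPolynomial (Fin m × Fin 3) K := fun i q => X (i, q)
  set N := Submodule.span K (Set.range (gen (diagC (Fin m × Fin 3) d) g)) with hNdef
  have hC : ∀ (c : K) x, x ∈ N → C c * x ∈ N := fun c x hx => by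
    rw [← smul_eq_C_mul]; exact Submodule.smul_mem _ _ hx
  have hN : ∀ t, gen (diagC (Fin m × Fin 3) d) g t ∈ N.toAddSubgroup :=
    fun t => Submodule.subset_span ⟨t, rfl⟩
  have ht : ∀ x ∈ N.toAddSubgroup, tr3 (diagC (Fin m × Fin 3) d) * x ∈ N.toAddSubgroup :=
    fun x hx => by
      simp only [tr3, diagC, ← C_add]
      exact hC _ x hx
  have hm : ∀ x ∈ N.toAddSubgroup, mi3 (diagC (Fin m × Fin 3) d) * x ∈ N.toAddSubgroup :=
    fun x hx => by
      simp only [mi3, diagC, ← C_add, ← C_mul, ← C_sub]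
      exact hC _ x hx
  have hdt : ∀ x ∈ N.toAddSubgroup, det3 (diagC (Fin m × Fin 3) d 0)
      (diagC (Fin m × Fin 3) d 1) (diagC (Fin m × Fin 3) d 2) * x ∈ N.toAddSubgroup :=
    fun x hx => by
      simp only [det3, dot, crs_zero, crs_one, crs_two, diagC, ← C_add, ← C_mul, ← C_sub]
      exact hC _ x hx
  set e : Fin m × Fin m × Fin m → (Fin m × Fin 3 →₀ ℕ) := fun t =>
    Finsupp.single (t.1, 0) 1 + Finsupp.single (t.2.1, 1) 1 + Finsupp.single (t.2.2, 2) 1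
  have he : Function.Injective e := by
    rintro ⟨i, j, k⟩ ⟨i', j', k'⟩ h
    have h0 := DFunLike.congr_fun h (i, 0)
    have h1 := DFunLike.congr_fun h (j, 1)
    have h2 := DFunLike.congr_fun h (k, 2)
    simp [e, Finsupp.single_apply] at h0 h1 h2
    simp [h0, h1, h2]
  have hmono : ∀ t, basisMonomials (Fin m × Fin 3) K (e t) ∈ N := fun t => by
    have hc : (d 1 - d 0) * (d 2 - d 0) * (d 2 - d 1) ≠ 0 := by
      refine mul_ne_zero (mul_ne_zero ?_ ?_) ?_ <;>
        exact sub_ne_zero.2 (hd.ne (by decide))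
    have h1 : C ((d 1 - d 0) * (d 2 - d 0) * (d 2 - d 1)) *
        (g t.1 0 * g t.2.1 1 * g t.2.2 2) ∈ N := by
      rw [det3_diag]
      refine sub_mem (add_mem (sub_mem (sub_mem (sub_mem ?_ (hC _ _ ?_)) (hC _ _ ?_))
        (hC _ _ ?_)) (hC _ _ ?_)) (hC _ _ ?_)
      · exact det3_one_two_mem hN ht hm hdt _ _ _
      · exact det3_one_one_mem hN hm _ _ _
      · exact det3_one_mem hN ht _ _ _
      · exact det3_two_mem hN ht hm _ _ _
      · exact det3_one_mem hN ht _ _ _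
      · exact det3_mem hN _ _ _
    rw [← smul_eq_C_mul] at h1
    have h2 := (Submodule.smul_mem_iff _ hc).1 h1
    rw [coe_basisMonomials]
    simpa [g, e, X, monomial_mul] using h2
  have hli := (basisMonomials (Fin m × Fin 3) K).linearIndependent.comp e he
  rw [linearIndependent_iff_card_le_finrank_span]
  have h3 := finrank_span_eq_card hli
  rw [← h3]
  have : Module.Finite K N := Module.Finite.span_of_finite K (Set.finite_range _)
  refine Submodule.finrank_mono (Submodule.span_le.2 ?_)
  rintro _ ⟨t, rfl⟩
  exact hmono t

end Independence
section Minimality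

open MvPolynomial

variable {K : Type*} [Field K] {m : ℕ}

lemma homogeneousComponent_mul_add {σ : Type*} (p : MvPolynomial σ K) {q : MvPolynomial σ K}
    (i : ℕ) {j : ℕ} (hq : q.IsHomogeneous j) :
    homogeneousComponent (i + j) (p * q) = homogeneousComponent i p * q := by
  let := gradedAlgebra (σ := σ) (R := K)
  have := DirectSum.coe_decompose_mul_add_of_right_mem (homogeneousSubmodule σ K) (a := p) (b := q)
    (i := i) (j := j) hq
  rw [← decomposition.decompose'_apply, ← decomposition.decompose'_apply]
  exact this

variable {σ ε : Type*} (e : σ ≃ (Fin m × Fin 3) ⊕ ((Fin 3 × Fin 3) ⊕ ε))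

/-- The matrix of variables corresponding to the upper left block. -/
noncomputable def alphaX (K : Type*) [Field K] : Fin 3 → Fin 3 → MvPolynomial σ K :=
  fun i j => X (e.symm (Sum.inr (Sum.inl (i, j))))

/-- The rows of variables of the lower left block. -/
noncomputable def rowsX (K : Type*) [Field K] : Fin m → Fin 3 → MvPolynomial σ K :=
  fun i q => X (e.symm (Sum.inl (i, q)))

/-- The point with diagonal upper left block `d` and all other coordinates zero. -/
def diagPoint (d : Fin 3 → K) : σ → K := fun s =>
  Sum.elim (fun _ => 0) (Sum.elim (fun p => if p.1 = p.2 then d p.1 else 0) fun _ => 0) (e s)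

/-- Specialization of the upper left block to a diagonal matrix. -/
noncomputable def diagSpec (d : Fin 3 → K) : MvPolynomial σ K →+* MvPolynomial (Fin m × Fin 3) K :=
  eval₂Hom C fun s => Sum.elim X
    (Sum.elim (fun p => C (if p.1 = p.2 then d p.1 else 0)) fun _ => 0) (e s)

lemma diagSpec_gen (d : Fin 3 → K) (t : Fin m × Fin m × Fin m) :
    diagSpec e d (gen (alphaX e K) (rowsX e K) t) =
      gen (diagC (Fin m × Fin 3) d) (fun i q => X (i, q)) t := by
  rw [map_gen]
  congr 1
  · funext i j; simp [diagSpec, alphaX, diagC]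
  · funext i j; simp [diagSpec, rowsX]

lemma coeff_zero_diagSpec (d : Fin 3 → K) (f : MvPolynomial σ K) :
    coeff 0 (diagSpec e d f) = eval (diagPoint e d) f := by
  have : (constantCoeff : MvPolynomial (Fin m × Fin 3) K →+* K).comp (diagSpec e d) =
      eval (diagPoint e d) := by
    refine MvPolynomial.ringHom_ext (fun r => by simp [diagSpec]) fun s => ?_
    rw [RingHom.comp_apply, diagSpec, eval₂Hom_X', eval_X, diagPoint]
    rcases e s with s | s | s <;> simp
  exact congrArg (fun φ => φ f) this

lemma eval_diagPoint_eq {d : Fin 3 → K} (hd : Function.Injective d)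
    {c : Fin m × Fin m × Fin m → K} {s : Fin m × Fin m × Fin m → MvPolynomial σ K}
    (h : ∑ t, C (c t) * gen (alphaX e K) (rowsX e K) t =
      ∑ t, s t * gen (alphaX e K) (rowsX e K) t) (t : Fin m × Fin m × Fin m) :
    eval (diagPoint e d) (s t) = c t := by
  have h1 : ∑ t, (C (c t) - s t) * gen (alphaX e K) (rowsX e K) t = 0 := by
    simp only [sub_mul, Finset.sum_sub_distrib, h, sub_self]
  have h2 := congrArg (fun f => homogeneousComponent (0 + 3) (diagSpec e d f)) h1
  simp only [map_sum, map_mul, diagSpec_gen, map_zero] at h2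
  have hg : ∀ t, (gen (diagC (Fin m × Fin 3) d) (fun (i : Fin m) q => X (i, q)) t).IsHomogeneous 3 :=
    gen_isHomogeneous_rows (fun _ _ => isHomogeneous_C _ _) fun _ _ => isHomogeneous_X _ _
  simp only [homogeneousComponent_mul_add _ _ (hg _), homogeneousComponent_zero,
    coeff_zero_diagSpec, ← smul_eq_C_mul] at h2
  have h3 := Fintype.linearIndependent_iff.1 (linearIndependent_gen hd) _ h2 t
  rw [map_sub, eval_C, sub_eq_zero] at h3
  exact h3.symm

/-- Minimality of the generators. -/
lemma coeff_eq_zero_of_sum_eq [Infinite K] {c : Fin m × Fin m × Fin m → K}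
    {s : Fin m × Fin m × Fin m → MvPolynomial σ K}
    (h : ∑ t, C (c t) * gen (alphaX e K) (rowsX e K) t =
      ∑ t, s t * gen (alphaX e K) (rowsX e K) t)
    (hs : ∀ t, eval 0 (s t) = 0) (t : Fin m × Fin m × Fin m) : c t = 0 := by
  set d : Fin 3 → K := fun i => Infinite.natEmbedding K i with hd
  have hdi : Function.Injective d :=
    (Infinite.natEmbedding K).injective.comp Fin.val_injective
  obtain ⟨i, hi⟩ : ∃ i, d i ≠ 0 := by
    by_contra! h0
    exact absurd (hdi ((h0 0).trans (h0 1).symm)) (by decide)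
  have key := eval_eq_zero_of_curve_through
    (fun s => Polynomial.C (diagPoint e d s) * Polynomial.X) (0 : σ → K) (fun i => by simp)
    (e.symm (Sum.inr (Sum.inl (i, i)))) (by simpa [diagPoint] using hi) (s t - C (c t))
    fun τ q hq => by
      rcases eq_or_ne τ 0 with rfl | hτ
      · rw [hq]; simp
      · have hq' : q = diagPoint e (fun i => d i * τ) := by
          funext y
          rw [hq, Polynomial.eval_mul, Polynomial.eval_C, Polynomial.eval_X, diagPoint, diagPoint]
          rcases e y with y | y | y <;> simp
        rw [hq', map_sub, eval_diagPoint_eq e (fun i j hij => hdi (mul_right_cancel₀ hτ hij)) h,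
          eval_C, sub_self, mul_zero]
  rw [map_sub, hs, eval_C, zero_sub, neg_eq_zero] at key
  exact key

end Minimality

section GradedNakayama

open MvPolynomial

variable {K : Type*} [Field K] {σ ι : Type*}

lemma homogeneousComponent_mem_of_span {S : Set (MvPolynomial σ K)}
    (hS : ∀ f ∈ S, ∃ d, f.IsHomogeneous d) {f : MvPolynomial σ K} (hf : f ∈ Ideal.span S) (j : ℕ) :
    homogeneousComponent j f ∈ Ideal.span S := by
  let := gradedAlgebra (σ := σ) (R := K)
  have h : (Ideal.span S).IsHomogeneous (homogeneousSubmodule σ K) :=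
    Ideal.homogeneous_span _ _ fun f hf => (hS f hf).imp fun d hd => hd
  rw [← decomposition.decompose'_apply]
  exact h j hf

open Classical in
/-- The number of minimal generators of an ideal in each degree. -/
theorem finrank_sub_finrank_eq_card [Finite σ] [Fintype ι] (G : ι → MvPolynomial σ K) (d : ι → ℕ)
    (hG : ∀ t, (G t).IsHomogeneous (d t))
    (hmin : ∀ (c : ι → K) (s : ι → MvPolynomial σ K), ∑ t, C (c t) * G t = ∑ t, s t * G t →
      (∀ t, eval 0 (s t) = 0) → ∀ t, c t = 0) (j : ℕ) :
    Module.finrank K ((Ideal.span (Set.range G)).restrictScalars K ⊓ homogeneousSubmodule σ K j :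
        Submodule K (MvPolynomial σ K)) -
      Module.finrank K ((Ideal.span (Set.range (X : σ → MvPolynomial σ K)) *
        Ideal.span (Set.range G)).restrictScalars K ⊓ homogeneousSubmodule σ K j :
        Submodule K (MvPolynomial σ K)) = Nat.card {t // d t = j} := by
  set m : Ideal (MvPolynomial σ K) := Ideal.span (Set.range X) with hm
  set I := Ideal.span (Set.range G) with hI
  have hm0 : ∀ f ∈ m, eval 0 f = 0 := fun f hf => by
    have : m ≤ RingHom.ker (eval (0 : σ → K)) := by
      rw [hm, Ideal.span_le]
      rintro _ ⟨i, rfl⟩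
      simp
    exact this hf
  have hm1 : ∀ f : MvPolynomial σ K, f - C (eval 0 f) ∈ m := fun f => by
    induction f using MvPolynomial.induction_on with
    | C r => simp
    | add p q hp hq =>
      rw [map_add, C_add, add_sub_add_comm]; exact add_mem hp hq
    | mul_X p i hp =>
      simp only [map_mul, eval_X, Pi.zero_apply, mul_zero, C_0, sub_zero]
      exact Ideal.mul_mem_left _ _ (Ideal.subset_span ⟨i, rfl⟩)
  have hmIc : ∀ f ∈ m * I, homogeneousComponent j f ∈ m * I := fun f hf => by
    rw [hm, hI, Ideal.span_mul_span'] at hf ⊢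
    refine homogeneousComponent_mem_of_span ?_ hf j
    rintro _ ⟨_, ⟨i, rfl⟩, _, ⟨t, rfl⟩, rfl⟩
    exact ⟨_, (isHomogeneous_X K i).mul (hG t)⟩
  have hmem : ∀ f ∈ m * I, ∃ s : ι → MvPolynomial σ K, (∀ t, eval 0 (s t) = 0) ∧
      f = ∑ t, s t * G t := fun f hf => by
    obtain ⟨a, ha, rfl⟩ := (Submodule.mem_ideal_smul_span_iff_exists_sum m G f).1 hf
    exact ⟨a, fun t => hm0 _ (ha t), by rw [Finsupp.sum_fintype _ _ (by simp)]; rfl⟩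
  set W : Submodule K (MvPolynomial σ K) :=
    Submodule.span K (Set.range fun t : {t // d t = j} => G t) with hW
  have hWmem : ∀ f ∈ W, ∃ c : {t // d t = j} → K, f = ∑ t, C (c t) * G t := fun f hf => by
    obtain ⟨c, rfl⟩ := (Submodule.mem_span_range_iff_exists_fun K).1 hf
    exact ⟨c, by simp only [smul_eq_C_mul]⟩
  have hext : ∀ c : {t // d t = j} → K, ∑ t, C (c t) * G t =
      ∑ t, C (if h : d t = j then c ⟨t, h⟩ else 0) * G t := fun c => by
    rw [← Finset.sum_filter_add_sum_filter_not Finset.univ (fun t => d t = j),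
      Finset.sum_eq_zero (s := Finset.univ.filter fun t => ¬ d t = j) (fun t ht => by
        rw [dif_neg (Finset.mem_filter.1 ht).2, C_0, zero_mul]), add_zero,
      Finset.sum_subtype (p := fun t => d t = j) _ (fun t => by simp)]
    exact Finset.sum_congr rfl fun t _ => by rw [dif_pos t.2]
  have hzero : ∀ c : {t // d t = j} → K, ∑ t, C (c t) * G t ∈ m * I → c = 0 := fun c hc => by
    obtain ⟨s, hs, he⟩ := hmem _ hc
    rw [hext] at he
    funext t
    have := hmin _ s he hs t
    rwa [dif_pos t.2] at this
  have hli : LinearIndependent K fun t : {t // d t = j} => G t := by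
    rw [Fintype.linearIndependent_iff]
    intro c hc
    simp only [smul_eq_C_mul] at hc
    exact congrFun (hzero c (hc ▸ zero_mem _))
  have hle : (m * I).restrictScalars K ≤ I.restrictScalars K := fun x hx => by
    rw [Submodule.restrictScalars_mem] at hx ⊢
    exact Ideal.mul_le_right hx
  have hsup : (I.restrictScalars K ⊓ homogeneousSubmodule σ K j : Submodule K (MvPolynomial σ K)) =
      ((m * I).restrictScalars K ⊓ homogeneousSubmodule σ K j) ⊔ W := by
    refine le_antisymm ?_ (sup_le (inf_le_inf_right _ hle) ?_)
    · rintro f ⟨hf, hfj⟩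
      obtain ⟨a, rfl⟩ := (Ideal.mem_span_range_iff_exists_fun).1 hf
      have h1 : ∑ t, a t * G t = ∑ t, (a t - C (eval 0 (a t))) * G t +
          ∑ t, C (eval 0 (a t)) * G t := by
        rw [← Finset.sum_add_distrib]
        exact Finset.sum_congr rfl fun t _ => by ring
      have h2 : homogeneousComponent j (∑ t, a t * G t) = ∑ t, a t * G t :=
        (homogeneousComponent_of_mem hfj).trans (if_pos rfl)
      rw [← h2, h1, map_add]
      refine Submodule.add_mem_sup ⟨hmIc _ (sum_mem fun t _ => Ideal.mul_mem_mul (hm1 _)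
        (Ideal.subset_span ⟨t, rfl⟩)), homogeneousComponent_mem _ _⟩ ?_
      rw [map_sum]
      refine sum_mem fun t _ => ?_
      rw [homogeneousComponent_C_mul, homogeneousComponent_of_mem (hG t), ← smul_eq_C_mul]
      refine Submodule.smul_mem _ _ ?_
      split_ifs with h
      · exact Submodule.subset_span ⟨⟨t, h.symm⟩, rfl⟩
      · exact zero_mem _
    · rw [hW, Submodule.span_le]
      rintro _ ⟨t, rfl⟩
      refine ⟨Ideal.subset_span ⟨t, rfl⟩, ?_⟩
      have := hG t
      rwa [t.2] at this
  have hinf : ((m * I).restrictScalars K ⊓ homogeneousSubmodule σ K j) ⊓ W = ⊥ := by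
    rw [eq_bot_iff]
    rintro f ⟨⟨hf, -⟩, hfW⟩
    obtain ⟨c, rfl⟩ := hWmem f hfW
    rw [hzero c hf]
    simp
  have hfin : Module.Finite K (homogeneousSubmodule σ K j) :=
    Module.Finite.iff_fg.2 (homogeneousSubmodule_fg (σ := σ) (R := K) j)
  have hfin1 : Module.Finite K ((m * I).restrictScalars K ⊓ homogeneousSubmodule σ K j :
      Submodule K (MvPolynomial σ K)) :=
    Submodule.finiteDimensional_of_le inf_le_right
  have hfin2 : Module.Finite K W := Module.Finite.span_of_finite K (Set.finite_range _)
  have := Submodule.finrank_sup_add_finrank_inf_eq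
    ((m * I).restrictScalars K ⊓ homogeneousSubmodule σ K j) W
  rw [hinf, finrank_bot, add_zero, ← hsup, finrank_span_eq_card hli] at this
  rw [this, Nat.add_sub_cancel_left, Nat.card_eq_fintype_card]

end GradedNakayama
section Assembly

open MvPolynomial

variable {K : Type*} [Field K] {m : ℕ}

/-- The block decomposition of the entries of a square matrix of size `3 + m`. -/
def splitEquiv (m : ℕ) : (Fin 3 ⊕ Fin m) × (Fin 3 ⊕ Fin m) ≃
    (Fin m × Fin 3) ⊕ ((Fin 3 × Fin 3) ⊕ ((Fin 3 ⊕ Fin m) × Fin m)) where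
  toFun
    | (Sum.inl i, Sum.inl j) => Sum.inr (Sum.inl (i, j))
    | (Sum.inr i, Sum.inl j) => Sum.inl (i, j)
    | (i, Sum.inr j) => Sum.inr (Sum.inr (i, j))
  invFun
    | Sum.inl (i, j) => (Sum.inr i, Sum.inl j)
    | Sum.inr (Sum.inl (i, j)) => (Sum.inl i, Sum.inl j)
    | Sum.inr (Sum.inr (i, j)) => (i, Sum.inr j)
  left_inv := by rintro ⟨i | i, j | j⟩ <;> rfl
  right_inv := by rintro (⟨i, j⟩ | ⟨i, j⟩ | ⟨i | i, j⟩) <;> rfl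

/-- The block decomposition of the variables. -/
def entryEquiv (m : ℕ) : Fin (3 + m) × Fin (3 + m) ≃
    (Fin m × Fin 3) ⊕ ((Fin 3 × Fin 3) ⊕ ((Fin 3 ⊕ Fin m) × Fin m)) :=
  (finSumFinEquiv.symm.prodCongr finSumFinEquiv.symm).trans (splitEquiv m)

lemma entryEquiv_symm_inl (i : Fin m) (q : Fin 3) :
    (entryEquiv m).symm (Sum.inl (i, q)) = (Fin.natAdd 3 i, Fin.castAdd m q) := rfl

lemma entryEquiv_symm_inr (i j : Fin 3) :
    (entryEquiv m).symm (Sum.inr (Sum.inl (i, j))) = (Fin.castAdd m i, Fin.castAdd m j) := rfl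

lemma mulVec_append (M : Matrix (Fin (3 + m)) (Fin (3 + m)) K) (v : Fin 3 → K)
    (i : Fin (3 + m)) :
    M.mulVec (Fin.append v 0) i = dot (fun q => M i (Fin.castAdd m q)) v := by
  rw [Matrix.mulVec, dotProduct, Fin.sum_univ_add]
  simp [dot, Fin.sum_univ_three]

lemma mem_kalmanSet_iff (M : Matrix (Fin (3 + m)) (Fin (3 + m)) K) :
    M ∈ kalmanSet K (3 + m) 3 1 ↔ ∃ (v : Fin 3 → K) (lam : K), v ≠ 0 ∧
      (∀ i, mv (fun i j => M (Fin.castAdd m i) (Fin.castAdd m j)) v i = lam * v i) ∧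
      ∀ i, dot (fun q => M (Fin.natAdd 3 i) (Fin.castAdd m q)) v = 0 := by
  have hmv : ∀ v i, mv (fun i j => M (Fin.castAdd m i) (Fin.castAdd m j)) v i =
      dot (fun q => M (Fin.castAdd m i) (Fin.castAdd m q)) v := fun v i => rfl
  constructor
  · rintro ⟨U, hU, hdim, hM⟩
    obtain ⟨⟨u, hu⟩, hu0, hspan⟩ := finrank_eq_one_iff'.1 hdim
    obtain ⟨lam, hlam⟩ := hspan ⟨_, hM u hu⟩
    have hlam' : lam • u = M.mulVec u := congrArg Subtype.val hlam
    set v : Fin 3 → K := fun i => u (Fin.castAdd m i) with hv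
    have hvu : Fin.append v 0 = u := by
      funext i
      refine Fin.addCases (fun i => ?_) (fun i => ?_) i
      · rw [Fin.append_left]
      · rw [Fin.append_right]
        exact (hU hu (Fin.natAdd 3 i) (by simp)).symm
    refine ⟨v, lam, ?_, fun i => ?_, fun i => ?_⟩
    · intro h0
      apply hu0
      ext1
      change u = 0
      rw [← hvu, h0]
      funext i
      refine Fin.addCases (fun i => ?_) (fun i => ?_) i <;> simp
    · rw [hmv, ← mulVec_append, hvu, ← hlam']
      rfl
    · rw [← mulVec_append, hvu, ← hlam', Pi.smul_apply, ← hvu, Fin.append_right]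
      simp
  · rintro ⟨v, lam, hv, h1, h2⟩
    have hM : M.mulVec (Fin.append v 0) = lam • Fin.append v 0 := by
      funext i
      rw [mulVec_append, Pi.smul_apply]
      refine Fin.addCases (fun i => ?_) (fun i => ?_) i
      · rw [Fin.append_left, ← hmv, h1, smul_eq_mul]
      · rw [Fin.append_right, h2]; simp
    refine ⟨K ∙ (Fin.append v 0 : Fin (3 + m) → K), ?_, finrank_span_singleton ?_, ?_⟩
    · rw [Submodule.span_singleton_le_iff_mem]
      intro i
      refine Fin.addCases (fun i hi => ?_) (fun i _ => ?_) i
      · simp at hi; omega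
      · simp
    · intro h0
      apply hv
      funext i
      have := congrFun h0 (Fin.castAdd m i)
      rwa [Fin.append_left] at this
    · intro w hw
      obtain ⟨c, rfl⟩ := Submodule.mem_span_singleton.1 hw
      rw [Matrix.mulVec_smul, hM]
      exact Submodule.smul_mem _ _ (Submodule.smul_mem _ _ (Submodule.mem_span_singleton_self _))

lemma det3_mul_apply {R : Type*} [CommRing R] (x y z v : Fin 3 → R) (l : Fin 3) :
    det3 x y z * v l = crs y z l * dot x v + crs z x l * dot y v + crs x y l * dot z v := by
  fin_cases l <;> simp [det3, dot] <;> ring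

lemma det3_eq_zero_of_dot {x y z v : Fin 3 → K} (hv : v ≠ 0) (hx : dot x v = 0)
    (hy : dot y v = 0) (hz : dot z v = 0) : det3 x y z = 0 := by
  obtain ⟨l, hl⟩ := Function.ne_iff.1 hv
  have := det3_mul_apply x y z v l
  rw [hx, hy, hz, mul_zero, mul_zero, mul_zero, add_zero, add_zero] at this
  exact (mul_eq_zero.1 this).resolve_right hl

lemma gen_eq_zero {a : Fin 3 → Fin 3 → K} {g : Fin m → Fin 3 → K} {v : Fin 3 → K} {lam : K}
    (hv : v ≠ 0) (ha : ∀ i, mv a v i = lam * v i) (hg : ∀ i, dot (g i) v = 0)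
    (t : Fin m × Fin m × Fin m) : gen a g t = 0 := by
  have h : ∀ x : Fin 3 → K, dot x v = 0 → dot (rv x a) v = 0 := fun x hx => by
    rw [← dot_mv]
    simp only [dot, ha] at hx ⊢
    linear_combination lam * hx
  have h1 := fun i => h _ (hg i)
  have h2 := fun i => h _ (h1 i)
  unfold gen
  split_ifs <;> exact det3_eq_zero_of_dot hv (by simp [hg]) (by simp [hg, h1])
    (by simp [hg, h1, h2])

lemma mem_span_gen_of_rowVanishing [IsAlgClosed K] {ε : Type*} [Finite ε]
    {f : MvPolynomial (Fin m × Fin 3) (MvPolynomial ((Fin 3 × Fin 3) ⊕ ε) K)}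
    (hf : RowVanishing f) :
    f ∈ Ideal.span (Set.range (gen (fun p q => C (genMat K ε p q))
      fun (i : Fin m) q => X (i, q))) := by
  set J := Ideal.span (Set.range (gen (fun p q => C (genMat K ε p q))
      fun (i : Fin m) q => X (i, q)))
  have hN : ∀ t, gen (fun p q => C (genMat K ε p q)) (fun (i : Fin m) q => X (i, q)) t ∈
      J.toAddSubgroup := fun t => Ideal.subset_span ⟨t, rfl⟩
  have hmul : ∀ c, ∀ x ∈ J.toAddSubgroup, c * x ∈ J.toAddSubgroup :=
    fun c x hx => J.mul_mem_left c hx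
  refine mem_of_rowVanishing (det3_mem hN) (det3_one_mem hN (hmul _))
    (det3_two_mem hN (hmul _) (hmul _)) (det3_one_two_mem hN (hmul _) (hmul _) (hmul _)) ?_ hf
  intro f hf x y v lam hv hx hy
  have : J ≤ RingHom.ker ((eval y).comp (map (eval x))) := by
    rw [Ideal.span_le]
    rintro _ ⟨t, rfl⟩
    rw [SetLike.mem_coe, RingHom.mem_ker, map_gen]
    refine gen_eq_zero (lam := lam) hv ?_ ?_ t
    · simpa [genMat] using hx
    · simpa using hy
  exact this hf

lemma kalmanIdeal_eq_span [IsAlgClosed K] :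
    kalmanIdeal K (3 + m) 3 1 =
      Ideal.span (Set.range (gen (alphaX (entryEquiv m) K) (rowsX (entryEquiv m) K))) := by
  refine le_antisymm (fun f hf => ?_) (Ideal.span_le.2 ?_)
  · obtain ⟨Φ, hΦ⟩ : ∃ Φ : MvPolynomial (Fin (3 + m) × Fin (3 + m)) K ≃ₐ[K] MvPolynomial
        (Fin m × Fin 3) (MvPolynomial ((Fin 3 × Fin 3) ⊕ ((Fin 3 ⊕ Fin m) × Fin m)) K),
        Φ = (renameEquiv K (entryEquiv m)).trans (sumAlgEquiv K _ _) := ⟨_, rfl⟩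
    have hl : ∀ p, Φ (X ((entryEquiv m).symm (Sum.inl p))) = X p := fun p => by
      rw [hΦ, AlgEquiv.trans_apply, renameEquiv_apply, rename_X, Equiv.apply_symm_apply]
      exact sumAlgEquiv_X_inl ..
    have hr : ∀ p, Φ (X ((entryEquiv m).symm (Sum.inr p))) = C (X p) := fun p => by
      rw [hΦ, AlgEquiv.trans_apply, renameEquiv_apply, rename_X, Equiv.apply_symm_apply]
      exact sumAlgEquiv_X_inr ..
    have he : ∀ x y f, eval y (map (eval x) (Φ f)) =
        eval (fun s => Sum.elim y x (entryEquiv m s)) f := fun x y f => by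
      have : ((eval y).comp (map (eval x))).comp (Φ : _ →+* _) =
          eval (fun s => Sum.elim y x (entryEquiv m s)) := by
        refine MvPolynomial.ringHom_ext (fun r => ?_) fun s => ?_
        · have h1 : Φ (C r) = C (C r) := Φ.commutes r
          rw [RingHom.comp_apply, RingHom.coe_coe, h1]
          simp
        · obtain ⟨s, rfl⟩ := (entryEquiv m).symm.surjective s
          rw [RingHom.comp_apply, RingHom.coe_coe]
          rcases s with s | s
          · rw [hl]; simp
          · rw [hr]; simp
      exact congrArg (fun φ => φ f) this
    have hv : RowVanishing (Φ f) := by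
      intro x y v lam hv hx hy
      rw [he]
      exact hf (fun p q => Sum.elim y x (entryEquiv m (p, q)))
        ((mem_kalmanSet_iff _).2 ⟨v, lam, hv, fun i => by
          simp only [← entryEquiv_symm_inr, Equiv.apply_symm_apply]; exact hx i, fun i => by
          simp only [← entryEquiv_symm_inl, Equiv.apply_symm_apply]; exact hy i⟩)
    have hle : Ideal.span (Set.range (gen (fun p q => C (genMat K ((Fin 3 ⊕ Fin m) × Fin m) p q))
        fun (i : Fin m) q => X (i, q))) ≤ (Ideal.span (Set.range (gen (alphaX (entryEquiv m) K)
          (rowsX (entryEquiv m) K)))).comap (Φ.symm : _ →+* _) := by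
      rw [Ideal.span_le]
      rintro _ ⟨t, rfl⟩
      rw [SetLike.mem_coe, Ideal.mem_comap, map_gen]
      refine Ideal.subset_span ⟨t, ?_⟩
      congr 1
      · funext i j
        rw [alphaX, genMat, ← hr]
        exact (Φ.symm_apply_apply _).symm
      · funext i j
        rw [rowsX, ← hl]
        exact (Φ.symm_apply_apply _).symm
    have := hle (mem_span_gen_of_rowVanishing hv)
    rw [Ideal.mem_comap] at this
    rwa [RingHom.coe_coe, Φ.symm_apply_apply] at this
  · rintro _ ⟨t, rfl⟩ M hM
    obtain ⟨v, lam, hv, h1, h2⟩ := (mem_kalmanSet_iff M).1 hM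
    rw [map_gen]
    refine gen_eq_zero (lam := lam) hv (fun i => ?_) (fun i => ?_) t
    · simp only [alphaX, eval_X, entryEquiv_symm_inr]; exact h1 i
    · simp only [rowsX, eval_X, entryEquiv_symm_inl]; exact h2 i

lemma minGens_eq_card [IsAlgClosed K] (m j : ℕ) :
    minGens K (3 + m) (kalmanIdeal K (3 + m) 3 1) j =
      Nat.card {t : Fin m × Fin m × Fin m // genDeg t = j} := by
  rw [kalmanIdeal_eq_span]
  have : Infinite K := IsAlgClosed.instInfinite
  exact finrank_sub_finrank_eq_card _ genDeg
    (gen_isHomogeneous (fun _ _ => isHomogeneous_X _ _) fun _ _ => isHomogeneous_X _ _)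
    (fun c s h hs => coeff_eq_zero_of_sum_eq (entryEquiv m) h hs) j

end Assembly
end Kalman

theorem stmt10 (K : Type*) [Field K] [IsAlgClosed K] (n : ℕ) (hn : 4 ≤ n) :
    minGens K n (kalmanIdeal K n 3 1) 3 = (n - 3).choose 3 ∧
    minGens K n (kalmanIdeal K n 3 1) 4 = 2 * (n - 2).choose 3 ∧
    minGens K n (kalmanIdeal K n 3 1) 5 = 2 * (n - 2).choose 3 ∧
    minGens K n (kalmanIdeal K n 3 1) 6 = (n - 1).choose 3 ∧
    (∀ j : ℕ, j ≠ 3 → j ≠ 4 → j ≠ 5 → j ≠ 6 →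
      minGens K n (kalmanIdeal K n 3 1) j = 0) := by
  obtain ⟨m, rfl⟩ := Nat.exists_eq_add_of_le (show 3 ≤ n by omega)
  rw [show 3 + m - 3 = m by omega, show 3 + m - 2 = m + 1 by omega,
    show 3 + m - 1 = m + 2 by omega]
  simp only [Kalman.minGens_eq_card]
  exact ⟨Kalman.card_genDeg_three m, Kalman.card_genDeg_four m, Kalman.card_genDeg_five m,
    Kalman.card_genDeg_six m, Kalman.card_genDeg_other m⟩
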